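/- There exist absolute constants C > 0 and N_0 such that the following holds for all n ≥ N_0. Let (d_1,…,d_n) be positive integers with even sum such that d_max^4 ≤ (d−2)n. Fix a partition A_1,…,A_n of {1,…,(d−1)n} with |A_j| = d_j − 1 for each j, let B be a uniformly random (n−2)-element subset of {1,…,(d−1)n}, and define the random vector X = (X_1,…,X_n) by X_j = |A_j ∩ B| + 1. Then the expected number of spanning trees E τ_d of a uniformly random graph in Γ_d satisfies E τ_d = H_d · exp(E) · E( e^{g(X)} ), where |E| ≤ C·( d_max^4/((d−2)n) + η ) and η = min{ d_max^4/((d−2)² n), d_max³ (log n)/((d−2)n), d_max (d−2) }. -/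

import Mathlib

attribute [local instance] Classical.propDecidable

namespace ExpectedSpanningTrees

/-- Average degree `d` of the degree sequence. -/
noncomputable def davg (n : ℕ) (d : Fin n → ℕ) : ℝ := (∑ j, (d j : ℝ)) / n

/-- The variance-type quantity `R = (1/n) Σ (d_j − d)²`. -/
noncomputable def Rvar (n : ℕ) (d : Fin n → ℕ) : ℝ :=
  (∑ j, ((d j : ℝ) - davg n d) ^ 2) / n

/-- `λ(x) = (1/(2(d−2)n+4)) Σ_j (d_j−x_j)_2`. -/
noncomputable def lamx (n : ℕ) (d x : Fin n → ℕ) : ℝ :=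
  (∑ j, (Nat.descFactorial (d j - x j) 2 : ℝ)) / (2 * ((davg n d - 2) * n) + 4)

/-- `μ(T) = (1/((d−2)n+2)) Σ_{{i,j}∈E(T)} (d_i−x_i)(d_j−x_j)`. -/
noncomputable def muT (n : ℕ) (d x : Fin n → ℕ) (T : SimpleGraph (Fin n)) : ℝ :=
  (∑ e ∈ T.edgeFinset,
    Sym2.lift ⟨fun i j => ((d i - x i : ℕ) : ℝ) * ((d j - x j : ℕ) : ℝ),
      fun i j => by ring⟩ e) / ((davg n d - 2) * n + 2)

/-- The set of labelled trees on `{1,…,n}` with degree sequence `x`. -/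
noncomputable def treesWith (n : ℕ) (x : Fin n → ℕ) : Finset (SimpleGraph (Fin n)) :=
  Finset.univ.filter (fun T => T.IsTree ∧ ∀ j, T.degree j = x j)

/-- `μ̄(x)`, the average of `μ(T)` over trees `T` with degree sequence `x`. -/
noncomputable def mubar (n : ℕ) (d x : Fin n → ℕ) : ℝ :=
  (∑ T ∈ treesWith n x, muT n d x T) / ((treesWith n x).card : ℝ)

/-- `g(x) = (R+d²)²/(4d²) − 1/4 − λ(x) − λ(x)² − μ̄(x)`. -/
noncomputable def gfun (n : ℕ) (d x : Fin n → ℕ) : ℝ :=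
  (Rvar n d + davg n d ^ 2) ^ 2 / (4 * davg n d ^ 2) - 1 / 4
    - lamx n d x - lamx n d x ^ 2 - mubar n d x

/-- The number of spanning trees of a simple graph on `Fin n`. -/
noncomputable def spanningTreeCount {n : ℕ} (G : SimpleGraph (Fin n)) : ℕ :=
  (Finset.univ.filter (fun T : SimpleGraph (Fin n) => T ≤ G ∧ T.IsTree)).card

/-- The quantity `H_d` from the paper. -/
noncomputable def Hd (n : ℕ) (d : Fin n → ℕ) : ℝ :=
  Real.sqrt (davg n d - 1) / ((davg n d - 2) ^ ((3 : ℝ) / 2) * n) *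
    ((∏ j, (d j : ℝ)) ^ ((1 : ℝ) / n) * (davg n d - 1) ^ (davg n d - 1) /
      (davg n d ^ (davg n d / 2) * (davg n d - 2) ^ (davg n d / 2 - 1))) ^ (n : ℝ)

section GraphCounting

variable {V : Type*} [Fintype V]

lemma degree_sup_of_disjoint {V : Type*} {G F : SimpleGraph V} (h : Disjoint G F) (v : V)
    [Fintype ((G ⊔ F).neighborSet v)] [Fintype (G.neighborSet v)] [Fintype (F.neighborSet v)] :
    (G ⊔ F).degree v = G.degree v + F.degree v := by
  rw [← SimpleGraph.card_neighborFinset_eq_degree, ← SimpleGraph.card_neighborFinset_eq_degree,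
    ← SimpleGraph.card_neighborFinset_eq_degree, ← Finset.card_union_of_disjoint]
  · congr 1
    ext u
    simp
  · rw [Finset.disjoint_left]
    intro u hu hu'
    rw [SimpleGraph.mem_neighborFinset] at hu hu'
    exact (SimpleGraph.disjoint_left.mp h) v u hu hu'

lemma degree_sdiff_add {G F : SimpleGraph V} (h : F ≤ G) (v : V)
    [Fintype ((G \ F).neighborSet v)] [Fintype (G.neighborSet v)] [Fintype (F.neighborSet v)] :
    (G \ F).degree v + F.degree v = G.degree v := by
  rw [← degree_sup_of_disjoint disjoint_sdiff_self_left]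
  have key : ∀ (H : SimpleGraph V) [Fintype (H.neighborSet v)], H = G → H.degree v = G.degree v := by
    intro H _ hH
    subst hH
    congr!
  exact key _ (sdiff_sup_cancel h)

lemma degree_edge {V : Type*} {i j : V} (hij : i ≠ j) (v : V)
    [Fintype ((SimpleGraph.edge i j).neighborSet v)] :
    (SimpleGraph.edge i j).degree v = (if v = i then 1 else 0) + (if v = j then 1 else 0) := by
  rw [← SimpleGraph.card_neighborFinset_eq_degree]
  by_cases h1 : v = i
  · subst h1
    have : (SimpleGraph.edge v j).neighborFinset v = {j} := by
      ext u
      simp only [SimpleGraph.mem_neighborFinset, SimpleGraph.edge_adj, Finset.mem_singleton]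
      grind
    simp [this, hij]
  · by_cases h2 : v = j
    · subst h2
      have : (SimpleGraph.edge i v).neighborFinset v = {i} := by
        ext u
        simp only [SimpleGraph.mem_neighborFinset, SimpleGraph.edge_adj, Finset.mem_singleton]
        grind
      simp [this, h1]
    · have : (SimpleGraph.edge i j).neighborFinset v = ∅ := by
        ext u
        simp only [SimpleGraph.mem_neighborFinset, SimpleGraph.edge_adj, Finset.notMem_empty]
        grind
      simp [this, h1, h2]

lemma edge_le_iff_adj {V : Type*} {G : SimpleGraph V} {i j : V} (hij : i ≠ j) :
    SimpleGraph.edge i j ≤ G ↔ G.Adj i j := by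
  rw [SimpleGraph.edge_le_iff]
  simp [hij]

lemma disjoint_edge_iff {V : Type*} {G : SimpleGraph V} {i j : V} (hij : i ≠ j) :
    Disjoint G (SimpleGraph.edge i j) ↔ ¬ G.Adj i j := by
  rw [SimpleGraph.disjoint_left]
  constructor
  · intro h hG
    exact h i j hG (by simp [SimpleGraph.edge_adj, hij])
  · intro h u v huv he
    rw [SimpleGraph.edge_adj] at he
    rcases he with ⟨⟨rfl, rfl⟩ | ⟨rfl, rfl⟩, _⟩
    · exact h huv
    · exact h huv.symm

/-- The real-valued indicator of a proposition. -/
noncomputable def ind (p : Prop) : ℝ := if p then 1 else 0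

lemma ind_of_true {p : Prop} (h : p) : ind p = 1 := if_pos h

lemma ind_of_false {p : Prop} (h : ¬ p) : ind p = 0 := if_neg h

lemma ind_nonneg (p : Prop) : 0 ≤ ind p := by
  unfold ind
  split_ifs <;> norm_num

/-- The simple graphs with degree sequence `y` that share no edge with `X`. -/
noncomputable def graphsAvoiding (y : V → ℕ) (X : SimpleGraph V) : Finset (SimpleGraph V) :=
  Finset.univ.filter fun G => (∀ v, G.degree v = y v) ∧ Disjoint G X

/-- The number of graphs with degree sequence `y` that avoid `X` and satisfy `P`. -/
noncomputable def countGraphs (y : V → ℕ) (X : SimpleGraph V) (P : SimpleGraph V → Prop) : ℝ :=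
  (((graphsAvoiding y X).filter P).card : ℝ)

lemma mem_graphsAvoiding {y : V → ℕ} {X G : SimpleGraph V} :
    G ∈ graphsAvoiding y X ↔ (∀ v, G.degree v = y v) ∧ Disjoint G X := by
  simp [graphsAvoiding]

lemma countGraphs_nonneg (y : V → ℕ) (X : SimpleGraph V) (P : SimpleGraph V → Prop) :
    0 ≤ countGraphs y X P := Nat.cast_nonneg _

lemma countGraphs_eq_sum (y : V → ℕ) (X : SimpleGraph V) (P : SimpleGraph V → Prop) :
    countGraphs y X P = ∑ G ∈ graphsAvoiding y X, ind (P G) := by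
  simp [countGraphs, ind]

lemma countGraphs_mono {y : V → ℕ} {X : SimpleGraph V} {P Q : SimpleGraph V → Prop}
    (h : ∀ G ∈ graphsAvoiding y X, P G → Q G) : countGraphs y X P ≤ countGraphs y X Q := by
  unfold countGraphs
  refine Nat.cast_le.mpr (Finset.card_le_card ?_)
  intro G hG
  rw [Finset.mem_filter] at hG ⊢
  exact ⟨hG.1, h G hG.1 hG.2⟩

lemma countGraphs_congr {y : V → ℕ} {X : SimpleGraph V} {P Q : SimpleGraph V → Prop}
    (h : ∀ G ∈ graphsAvoiding y X, P G ↔ Q G) : countGraphs y X P = countGraphs y X Q :=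
  le_antisymm (countGraphs_mono fun G hG => (h G hG).1) (countGraphs_mono fun G hG => (h G hG).2)

lemma countGraphs_eq_zero {y : V → ℕ} {X : SimpleGraph V} {P : SimpleGraph V → Prop}
    (h : ∀ G ∈ graphsAvoiding y X, ¬ P G) : countGraphs y X P = 0 := by
  unfold countGraphs
  rw [Finset.filter_false_of_mem h]
  simp

lemma countGraphs_and_add_and_not (y : V → ℕ) (X : SimpleGraph V) (P Q : SimpleGraph V → Prop) :
    countGraphs y X (fun G => P G ∧ Q G) + countGraphs y X (fun G => P G ∧ ¬ Q G)
      = countGraphs y X P := by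
  simp only [countGraphs_eq_sum, ← Finset.sum_add_distrib]
  refine Finset.sum_congr rfl fun G _ => ?_
  by_cases hP : P G <;> by_cases hQ : Q G <;> simp [hP, hQ, ind]

/-- Forcing the edges of `F` amounts to lowering the degrees and forbidding `F`. -/
lemma countGraphs_extract (y : V → ℕ) {X F : SimpleGraph V} (hF : Disjoint F X)
    (P : SimpleGraph V → Prop) :
    countGraphs (fun v => y v + F.degree v) X (fun G => F ≤ G ∧ P G)
      = countGraphs y (X ⊔ F) (fun G => P (G ⊔ F)) := by
  unfold countGraphs
  congr 1
  refine Finset.card_bij' (fun G _ => G \ F) (fun G _ => G ⊔ F) ?_ ?_ ?_ ?_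
  · intro G hG
    simp only [Finset.mem_filter, mem_graphsAvoiding] at hG ⊢
    obtain ⟨⟨hd, hX⟩, hFG, hP⟩ := hG
    refine ⟨⟨fun v => ?_, ?_⟩, ?_⟩
    · rw [← Nat.add_right_cancel_iff (n := F.degree v), degree_sdiff_add hFG, hd]
    · exact disjoint_sup_right.mpr ⟨hX.mono_left sdiff_le, disjoint_sdiff_self_left⟩
    · rwa [sdiff_sup_cancel hFG]
  · intro G hG
    simp only [Finset.mem_filter, mem_graphsAvoiding] at hG ⊢
    obtain ⟨⟨hd, hX⟩, hP⟩ := hG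
    rw [disjoint_sup_right] at hX
    refine ⟨⟨fun v => ?_, ?_⟩, le_sup_right, hP⟩
    · rw [degree_sup_of_disjoint hX.2, hd]
    · exact disjoint_sup_left.mpr ⟨hX.1, hF⟩
  · intro G hG
    simp only [Finset.mem_filter] at hG
    exact sdiff_sup_cancel hG.2.1
  · intro G hG
    simp only [Finset.mem_filter, mem_graphsAvoiding, disjoint_sup_right] at hG
    rw [sup_sdiff_right_self]
    exact hG.1.2.2.sdiff_eq_left

/-- Switching the edges of `F₁` to those of `F₂`, where both have the same degrees. -/
lemma countGraphs_switch_le (y : V → ℕ) {X F₁ F₂ : SimpleGraph V} (hX : Disjoint F₂ X)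
    (hdeg : ∀ v, F₁.degree v = F₂.degree v) :
    countGraphs y X (fun G => F₁ ≤ G ∧ Disjoint G F₂)
      ≤ countGraphs y X (fun G => F₂ ≤ G ∧ Disjoint G F₁) := by
  unfold countGraphs
  refine Nat.cast_le.mpr (Finset.card_le_card_of_injOn (fun G => (G \ F₁) ⊔ F₂) ?_ ?_)
  · intro G hG
    simp only [Finset.coe_filter, Set.mem_ofPred_eq, mem_graphsAvoiding] at hG ⊢
    obtain ⟨⟨hd, hGX⟩, h1, h2⟩ := hG
    refine ⟨⟨fun v => ?_, ?_⟩, le_sup_right, ?_⟩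
    · rw [degree_sup_of_disjoint (h2.mono_left sdiff_le), ← hdeg, degree_sdiff_add h1, hd]
    · exact disjoint_sup_left.mpr ⟨hGX.mono_left sdiff_le, hX⟩
    · exact disjoint_sup_left.mpr ⟨disjoint_sdiff_self_left, (h2.mono_left h1).symm⟩
  · intro G hG H hH hGH
    simp only [Finset.coe_filter, Set.mem_ofPred_eq] at hG hH hGH
    have key : ∀ K : SimpleGraph V, F₁ ≤ K → Disjoint K F₂ → (((K \ F₁) ⊔ F₂) \ F₂) ⊔ F₁ = K := by
      intro K h1 h2
      rw [sup_sdiff_right_self, (h2.mono_left sdiff_le).sdiff_eq_left, sdiff_sup_cancel h1]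
    rw [← key G hG.2.1 hG.2.2, ← key H hH.2.1 hH.2.2, hGH]

lemma countGraphs_switch_adj_le (y : V → ℕ) {X : SimpleGraph V} {i j a b : V}
    (hij : i ≠ j) (hab : a ≠ b) (hia : i ≠ a) (hjb : j ≠ b) (haj : a ≠ j) (hbi : b ≠ i)
    (hXia : ¬ X.Adj i a) (hXjb : ¬ X.Adj j b) :
    countGraphs y X (fun G => (G.Adj i j ∧ G.Adj a b) ∧ ¬ G.Adj i a ∧ ¬ G.Adj j b)
      ≤ countGraphs y X (fun G => (G.Adj i a ∧ G.Adj j b) ∧ ¬ G.Adj i j ∧ ¬ G.Adj a b) := by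
  have h := countGraphs_switch_le y (X := X) (F₁ := SimpleGraph.edge i j ⊔ SimpleGraph.edge a b)
    (F₂ := SimpleGraph.edge i a ⊔ SimpleGraph.edge j b) ?_ ?_
  · simpa only [sup_le_iff, disjoint_sup_right, edge_le_iff_adj, disjoint_edge_iff, hij, hab, hia,
      hjb, ne_eq, not_false_eq_true] using h
  · rw [disjoint_comm, disjoint_sup_right, disjoint_edge_iff hia, disjoint_edge_iff hjb]
    exact ⟨hXia, hXjb⟩
  · intro v
    rw [degree_sup_of_disjoint, degree_sup_of_disjoint, degree_edge hij, degree_edge hab,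
      degree_edge hia, degree_edge hjb]
    · ring
    · rw [disjoint_edge_iff hjb, SimpleGraph.edge_adj]; grind
    · rw [disjoint_edge_iff hab, SimpleGraph.edge_adj]; grind

lemma sum_adj_eq_degree (G : SimpleGraph V) (v : V) :
    ∑ u, ind (G.Adj v u) = G.degree v := by
  rw [← SimpleGraph.card_neighborFinset_eq_degree, SimpleGraph.neighborFinset_eq_filter]
  simp [ind]

/-- Each graph has `y i` edges at the vertex `i`. -/
lemma sum_countGraphs_adj (y : V → ℕ) (X : SimpleGraph V) (P : SimpleGraph V → Prop) (i : V) :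
    ∑ a, countGraphs y X (fun G => P G ∧ G.Adj i a) = y i * countGraphs y X P := by
  simp only [countGraphs_eq_sum]
  rw [Finset.sum_comm, Finset.mul_sum]
  refine Finset.sum_congr rfl fun G hG => ?_
  rw [← (mem_graphsAvoiding.mp hG).1 i, ← sum_adj_eq_degree]
  by_cases hP : P G <;> simp [hP, ind]

end GraphCounting

section EdgeProbability

variable {V : Type*} [Fintype V]

lemma sum_ite_degree_le {G : SimpleGraph V} {Δ : ℕ} (hG : ∀ v, G.degree v ≤ Δ) (B : V → Prop)
    {b : ℝ} (hB : ∑ a, ind (B a) ≤ b) :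
    ∑ a, ∑ c, ind (G.Adj a c ∧ B a) ≤ Δ * b := by
  calc ∑ a, ∑ c, ind (G.Adj a c ∧ B a)
      = ∑ a, ind (B a) * G.degree a := by
        refine Finset.sum_congr rfl fun a _ => ?_
        rw [← sum_adj_eq_degree]
        by_cases h : B a <;> simp [h, ind]
    _ ≤ ∑ a, ind (B a) * Δ := by
        gcongr with a
        · exact ind_nonneg _
        · exact hG a
    _ ≤ Δ * b := by
        rw [← Finset.sum_mul, mul_comm]
        gcongr

lemma sum_ite_near_le (G X : SimpleGraph V) {Δ : ℕ} {i : V}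
    (h : G.degree i + X.degree i ≤ Δ) :
    ∑ a, ind (a = i ∨ G.Adj i a ∨ X.Adj i a) ≤ Δ + 1 := by
  calc ∑ a, ind (a = i ∨ G.Adj i a ∨ X.Adj i a)
      ≤ ∑ a, (ind (a = i) + (ind (G.Adj i a)
          + ind (X.Adj i a))) := by
        gcongr with a
        unfold ind
        split_ifs <;> first | (exfalso; tauto) | norm_num
    _ = 1 + (G.degree i + X.degree i) := by
        rw [Finset.sum_add_distrib, Finset.sum_add_distrib, sum_adj_eq_degree, sum_adj_eq_degree]
        simp [ind]
    _ ≤ Δ + 1 := by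
        have : ((G.degree i + X.degree i : ℕ) : ℝ) ≤ Δ := by exact_mod_cast h
        push_cast at this
        linarith

/-- The number of directed edges of `G` available for switching with the edge `ij`. -/
lemma le_sum_switchable (y : V → ℕ) {X G : SimpleGraph V} {Δ : ℕ}
    (hΔ : ∀ v, y v + X.degree v ≤ Δ) (hG : ∀ v, G.degree v = y v) (i j : V) :
    (∑ v, (y v : ℝ)) - 2 * Δ * (Δ + 1) ≤ ∑ a, ∑ b, ind (G.Adj a b ∧
      ¬ (a = i ∨ G.Adj i a ∨ X.Adj i a) ∧ ¬ (b = j ∨ G.Adj j b ∨ X.Adj j b)) := by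
  have hGΔ : ∀ v, G.degree v ≤ Δ := fun v => by have := hΔ v; have := hG v; omega
  have h1 := sum_ite_degree_le hGΔ (fun a => a = i ∨ G.Adj i a ∨ X.Adj i a)
    (sum_ite_near_le G X (Δ := Δ) (by rw [hG]; exact hΔ i))
  have h2 := sum_ite_degree_le hGΔ (fun a => a = j ∨ G.Adj j a ∨ X.Adj j a)
    (sum_ite_near_le G X (Δ := Δ) (by rw [hG]; exact hΔ j))
  rw [Finset.sum_comm] at h2
  have h3 : ∑ v, (y v : ℝ) = ∑ a, ∑ b, ind (G.Adj a b) := by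
    refine Finset.sum_congr rfl fun a _ => ?_
    rw [sum_adj_eq_degree, hG]
  have h4 : ∑ a, ∑ b, ind (G.Adj a b) ≤
      ∑ a, ∑ b, (ind (G.Adj a b ∧ ¬ (a = i ∨ G.Adj i a ∨ X.Adj i a) ∧
        ¬ (b = j ∨ G.Adj j b ∨ X.Adj j b))
        + (ind (G.Adj a b ∧ (a = i ∨ G.Adj i a ∨ X.Adj i a))
        + ind (G.Adj b a ∧ (b = j ∨ G.Adj j b ∨ X.Adj j b)))) := by
    gcongr with a _ b _
    rw [G.adj_comm b a]
    by_cases hab : G.Adj a b <;> by_cases hA : (a = i ∨ G.Adj i a ∨ X.Adj i a) <;>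
      by_cases hB : (b = j ∨ G.Adj j b ∨ X.Adj j b) <;> simp only [hab, hA, hB, ind] <;> norm_num
  simp only [Finset.sum_add_distrib] at h4
  linarith

lemma countGraphs_adj_mul_le (y : V → ℕ) {X : SimpleGraph V} {Δ : ℕ}
    (hΔ : ∀ v, y v + X.degree v ≤ Δ) {i j : V} (hij : i ≠ j) :
    countGraphs y X (fun G => G.Adj i j) * ((∑ v, (y v : ℝ)) - 2 * Δ * (Δ + 1))
      ≤ y i * y j * countGraphs y X (fun G => ¬ G.Adj i j) := by
  have hswitch : ∀ a b, countGraphs y X (fun G => G.Adj i j ∧ G.Adj a b ∧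
      ¬ (a = i ∨ G.Adj i a ∨ X.Adj i a) ∧ ¬ (b = j ∨ G.Adj j b ∨ X.Adj j b))
      ≤ countGraphs y X (fun G => (¬ G.Adj i j ∧ G.Adj i a) ∧ G.Adj j b) := by
    intro a b
    by_cases hc : a ≠ b ∧ i ≠ a ∧ j ≠ b ∧ a ≠ j ∧ b ≠ i ∧ ¬ X.Adj i a ∧ ¬ X.Adj j b
    · obtain ⟨hab, hia, hjb, haj, hbi, hXia, hXjb⟩ := hc
      refine (countGraphs_mono ?_).trans
        ((countGraphs_switch_adj_le y hij hab hia hjb haj hbi hXia hXjb).trans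
          (countGraphs_mono ?_))
      · intro G _; tauto
      · intro G _; tauto
    · rw [countGraphs_eq_zero]
      · exact countGraphs_nonneg _ _ _
      · rintro G - ⟨h1, h2, h3, h4⟩
        apply hc
        have := h2.ne
        refine ⟨this, ?_, ?_, ?_, ?_, ?_, ?_⟩
        · rintro rfl; tauto
        · rintro rfl; tauto
        · rintro rfl; tauto
        · rintro rfl; exact h4 (Or.inr (Or.inl h1.symm))
        · tauto
        · tauto
  calc countGraphs y X (fun G => G.Adj i j) * ((∑ v, (y v : ℝ)) - 2 * Δ * (Δ + 1))
      = ∑ G ∈ graphsAvoiding y X,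
          ind (G.Adj i j) * ((∑ v, (y v : ℝ)) - 2 * Δ * (Δ + 1)) := by
        rw [countGraphs_eq_sum, Finset.sum_mul]
    _ ≤ ∑ G ∈ graphsAvoiding y X, ∑ a, ∑ b, ind (G.Adj i j ∧ G.Adj a b ∧
          ¬ (a = i ∨ G.Adj i a ∨ X.Adj i a) ∧ ¬ (b = j ∨ G.Adj j b ∨ X.Adj j b)) := by
        refine Finset.sum_le_sum fun G hG => ?_
        by_cases h : G.Adj i j
        · simpa only [h, true_and, ind_of_true, one_mul] using
            le_sum_switchable y hΔ (mem_graphsAvoiding.mp hG).1 i j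
        · simp [h, ind]
    _ = ∑ a, ∑ b, countGraphs y X (fun G => G.Adj i j ∧ G.Adj a b ∧
          ¬ (a = i ∨ G.Adj i a ∨ X.Adj i a) ∧ ¬ (b = j ∨ G.Adj j b ∨ X.Adj j b)) := by
        simp only [countGraphs_eq_sum]
        rw [Finset.sum_comm]
        exact Finset.sum_congr rfl fun a _ => Finset.sum_comm
    _ ≤ ∑ a, ∑ b, countGraphs y X (fun G => (¬ G.Adj i j ∧ G.Adj i a) ∧ G.Adj j b) := by
        gcongr with a _ b _
        exact hswitch a b
    _ = y i * y j * countGraphs y X (fun G => ¬ G.Adj i j) := by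
        simp only [sum_countGraphs_adj]
        rw [← Finset.mul_sum, sum_countGraphs_adj]
        ring

/-- Conditionally on containing `F`, an edge `ij` is present with probability
at most `y i * y j / h`. -/
lemma countGraphs_forced_adj_le (y : V → ℕ) {X F : SimpleGraph V} {Δ : ℕ}
    (hΔ : ∀ v, y v + X.degree v ≤ Δ) {i j : V} (hij : i ≠ j) (hF : ¬ F.Adj i j) {h f : ℝ} (h0 : 0 < h)
    (hf : ∀ [∀ v, Fintype (F.neighborSet v)], ∑ v, (F.degree v : ℝ) ≤ f)
    (hh : h ≤ (∑ v, (y v : ℝ)) - f - 2 * Δ * (Δ + 1)) :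
    countGraphs y X (fun G => F ≤ G ∧ G.Adj i j)
      ≤ y i * y j / h * countGraphs y X (fun G => F ≤ G) := by
  by_cases hex : ∃ G ∈ graphsAvoiding y X, F ≤ G
  · obtain ⟨G, hG, hFG⟩ := hex
    rw [mem_graphsAvoiding] at hG
    have hle : ∀ v, F.degree v ≤ y v := fun v => by
      rw [← hG.1 v, ← degree_sdiff_add hFG v]; exact Nat.le_add_left _ _
    have hFX : Disjoint F X := hG.2.mono_left hFG
    obtain ⟨z, hz⟩ : ∃ z : V → ℕ, y = fun v => z v + F.degree v :=
      ⟨fun v => y v - F.degree v, by funext v; have := hle v; simp only; omega⟩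
    have e1 := countGraphs_extract z hFX (fun G => G.Adj i j)
    have e2 := countGraphs_extract z hFX (fun _ => True)
    simp only [and_true, ← hz] at e1 e2
    rw [e1, e2]
    have e3 : countGraphs z (X ⊔ F) (fun G => (G ⊔ F).Adj i j)
        = countGraphs z (X ⊔ F) (fun G => G.Adj i j) :=
      countGraphs_congr fun G _ => by simp [hF]
    rw [e3]
    have key := countGraphs_adj_mul_le z (X := X ⊔ F) (Δ := Δ) (fun v => by
      rw [degree_sup_of_disjoint hFX.symm]
      have h1 := hΔ v
      have h2 : y v = z v + F.degree v := congrFun hz v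
      omega) hij
    have hsum : (∑ v, (z v : ℝ)) = (∑ v, (y v : ℝ)) - (∑ v, (F.degree v : ℝ)) := by
      rw [← Finset.sum_sub_distrib]
      refine Finset.sum_congr rfl fun v _ => ?_
      have h2 : (y v : ℝ) = z v + F.degree v := by exact_mod_cast congrFun hz v
      rw [h2]
      ring
    rw [hsum] at key
    have hmono : countGraphs z (X ⊔ F) (fun G => ¬ G.Adj i j)
        ≤ countGraphs z (X ⊔ F) (fun _ => True) := countGraphs_mono fun _ _ _ => trivial
    have hzy : ∀ v, z v ≤ y v := fun v => by
      have h2 : y v = z v + F.degree v := congrFun hz v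
      omega
    rw [div_mul_eq_mul_div, le_div_iff₀ h0]
    calc _ ≤ countGraphs z (X ⊔ F) (fun G => G.Adj i j) *
            ((∑ v, (y v : ℝ)) - (∑ v, (F.degree v : ℝ)) - 2 * Δ * (Δ + 1)) := by
          gcongr
          · exact countGraphs_nonneg _ _ _
          · exact hh.trans (sub_le_sub_right (sub_le_sub_left hf _) _)
      _ ≤ _ := key
      _ ≤ _ := by
          gcongr
          · exact countGraphs_nonneg _ _ _
          · exact hzy i
          · exact hzy j
  · push Not at hex
    rw [countGraphs_eq_zero fun G hG h => hex G hG h.1, countGraphs_eq_zero hex]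
    simp

lemma sum_degree_edge_le (i j : V) [∀ v, Fintype ((SimpleGraph.edge i j).neighborSet v)] :
    ∑ v, ((SimpleGraph.edge i j).degree v : ℝ) ≤ 2 := by
  by_cases hij : i = j
  · have : ∀ v, (SimpleGraph.edge i j).degree v = 0 := fun v => by
      rw [← SimpleGraph.card_neighborFinset_eq_degree, Finset.card_eq_zero,
        Finset.eq_empty_iff_forall_notMem]
      intro u
      rw [SimpleGraph.mem_neighborFinset, SimpleGraph.edge_adj]
      grind
    simp [this]
  · simp only [degree_edge hij]
    push_cast
    rw [Finset.sum_add_distrib]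
    simp
    norm_num

lemma sum_degree_sup_le (F₁ F₂ : SimpleGraph V) [∀ v, Fintype ((F₁ ⊔ F₂).neighborSet v)]
    [∀ v, Fintype (F₁.neighborSet v)] [∀ v, Fintype (F₂.neighborSet v)] :
    ∑ v, ((F₁ ⊔ F₂).degree v : ℝ) ≤ ∑ v, (F₁.degree v : ℝ) + ∑ v, (F₂.degree v : ℝ) := by
  rw [← Finset.sum_add_distrib]
  refine Finset.sum_le_sum fun v _ => ?_
  rw [← SimpleGraph.card_neighborFinset_eq_degree, ← SimpleGraph.card_neighborFinset_eq_degree,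
    ← SimpleGraph.card_neighborFinset_eq_degree]
  norm_cast
  refine le_trans (le_of_eq ?_) (Finset.card_union_le _ _)
  congr 1
  ext u
  simp

end EdgeProbability

section EdgeProbabilityLower

variable {V : Type*} [Fintype V]

lemma countGraphs_adj_le (y : V → ℕ) {X : SimpleGraph V} {Δ : ℕ}
    (hΔ : ∀ v, y v + X.degree v ≤ Δ) {i j : V} (hij : i ≠ j) {h : ℝ} (h0 : 0 < h)
    (hh : h ≤ (∑ v, (y v : ℝ)) - 2 * Δ * (Δ + 1)) :
    countGraphs y X (fun G => G.Adj i j)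
      ≤ y i * y j / h * countGraphs y X (fun _ => True) := by
  have key := countGraphs_forced_adj_le y (F := ⊥) hΔ hij (by simp) h0 (f := 0) (by simp)
    (by simpa using hh)
  simpa using key

lemma countGraphs_two_adj_le (y : V → ℕ) {X : SimpleGraph V} {Δ : ℕ}
    (hΔ : ∀ v, y v + X.degree v ≤ Δ) {i j k l : V} (hij : i ≠ j) (hkl : k ≠ l)
    (hne : ¬ (SimpleGraph.edge i j).Adj k l) {h : ℝ} (h0 : 0 < h)
    (hh : h ≤ (∑ v, (y v : ℝ)) - 2 - 2 * Δ * (Δ + 1)) :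
    countGraphs y X (fun G => G.Adj i j ∧ G.Adj k l)
      ≤ (y i * y j / h) * (y k * y l / h) * countGraphs y X (fun _ => True) := by
  have h1 := countGraphs_adj_le y hΔ hij h0 (by linarith)
  have h2 := countGraphs_forced_adj_le y (F := SimpleGraph.edge i j) hΔ hkl hne h0
    (by intro _; exact sum_degree_edge_le i j) hh
  simp only [edge_le_iff_adj hij] at h2
  calc _ ≤ _ := h2
    _ ≤ y k * y l / h * (y i * y j / h * countGraphs y X (fun _ => True)) := by gcongr
    _ = _ := by ring

lemma countGraphs_three_adj_le (y : V → ℕ) {X : SimpleGraph V} {Δ : ℕ}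
    (hΔ : ∀ v, y v + X.degree v ≤ Δ) {i j k l p q : V} (hij : i ≠ j) (hkl : k ≠ l) (hpq : p ≠ q)
    (hne : ¬ (SimpleGraph.edge i j).Adj k l) (hne₁ : ¬ (SimpleGraph.edge i j).Adj p q)
    (hne₂ : ¬ (SimpleGraph.edge k l).Adj p q) {h : ℝ} (h0 : 0 < h)
    (hh : h ≤ (∑ v, (y v : ℝ)) - 4 - 2 * Δ * (Δ + 1)) :
    countGraphs y X (fun G => (G.Adj i j ∧ G.Adj k l) ∧ G.Adj p q)
      ≤ (y i * y j / h) * (y k * y l / h) * (y p * y q / h) * countGraphs y X (fun _ => True) := by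
  have h1 := countGraphs_two_adj_le y hΔ hij hkl hne h0 (by linarith)
  have h2 := countGraphs_forced_adj_le y (F := SimpleGraph.edge i j ⊔ SimpleGraph.edge k l)
    hΔ hpq (by simp [hne₁, hne₂]) h0
    (by
      intro _
      exact (sum_degree_sup_le _ _).trans
        ((add_le_add (sum_degree_edge_le i j) (sum_degree_edge_le k l)).trans
          (by norm_num : (2 : ℝ) + 2 ≤ 4))) hh
  simp only [sup_le_iff, edge_le_iff_adj hij, edge_le_iff_adj hkl] at h2
  calc _ ≤ _ := h2
    _ ≤ y p * y q / h * ((y i * y j / h) * (y k * y l / h) * countGraphs y X (fun _ => True)) := by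
        gcongr
    _ = _ := by ring

lemma sum_sq_le {y : V → ℕ} {Δ : ℕ} (hΔ : ∀ v, y v ≤ Δ) :
    ∑ v, (y v : ℝ) * y v ≤ Δ * ∑ v, (y v : ℝ) := by
  rw [Finset.mul_sum]
  gcongr with v
  exact hΔ v

lemma sum_adj_mul_le {y : V → ℕ} {X : SimpleGraph V} {Δ : ℕ}
    (hΔ : ∀ v, y v + X.degree v ≤ Δ) :
    ∑ a, ∑ b, ind (X.Adj a b) * ((y a : ℝ) * y b) ≤ Δ ^ 2 * ∑ v, (y v : ℝ) := by
  rw [Finset.mul_sum]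
  refine Finset.sum_le_sum fun a _ => ?_
  calc ∑ b, ind (X.Adj a b) * ((y a : ℝ) * y b)
      ≤ ∑ b, ind (X.Adj a b) * ((y a : ℝ) * Δ) := by
        gcongr with b
        · exact ind_nonneg _
        · have := hΔ b; omega
    _ = X.degree a * ((y a : ℝ) * Δ) := by rw [← Finset.sum_mul, sum_adj_eq_degree]
    _ ≤ Δ * ((y a : ℝ) * Δ) := by
        gcongr
        have := hΔ a; omega
    _ = _ := by ring

/-- The pairs of edges at `i` and at `j` that cannot be switched to create the edge `ij`
are rare. -/
lemma sum_countGraphs_unswitchable_le (y : V → ℕ) {X : SimpleGraph V} {Δ : ℕ}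
    (hΔ : ∀ v, y v + X.degree v ≤ Δ) {i j : V} (hij : i ≠ j) {h : ℝ} (h0 : 0 < h)
    (hh : h ≤ (∑ v, (y v : ℝ)) - 4 - 2 * Δ * (Δ + 1)) :
    ∑ a, ∑ b, countGraphs y X (fun G => ((¬ G.Adj i j ∧ G.Adj i a) ∧ G.Adj j b) ∧
        ¬ (a ≠ b ∧ ¬ G.Adj a b ∧ ¬ X.Adj a b))
      ≤ y i * y j * (Δ * (∑ v, (y v : ℝ)) / h ^ 2 + Δ ^ 2 * (∑ v, (y v : ℝ)) ^ 2 / h ^ 3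
        + Δ ^ 2 * (∑ v, (y v : ℝ)) / h ^ 2) * countGraphs y X (fun _ => True) := by
  set N := countGraphs y X (fun _ => True) with hN
  have hN0 : 0 ≤ N := countGraphs_nonneg _ _ _
  have hpt : ∀ a b, countGraphs y X (fun G => ((¬ G.Adj i j ∧ G.Adj i a) ∧ G.Adj j b) ∧
        ¬ (a ≠ b ∧ ¬ G.Adj a b ∧ ¬ X.Adj a b))
      ≤ y i * y j * N * ((if a = b then (y a : ℝ) * y b else 0) / h ^ 2
        + (y a * y a) * (y b * y b) / h ^ 3 + ind (X.Adj a b) * (y a * y b) / h ^ 2) := by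
    intro a b
    have hnn1 : 0 ≤ (if a = b then (y a : ℝ) * y b else 0) / h ^ 2 := by split_ifs <;> positivity
    have hnn2 : 0 ≤ ((y a : ℝ) * y a) * (y b * y b) / h ^ 3 := by positivity
    have hnn3 : 0 ≤ ind (X.Adj a b) * ((y a : ℝ) * y b) / h ^ 2 := by
      have := ind_nonneg (X.Adj a b)
      positivity
    have hyN : 0 ≤ (y i : ℝ) * y j * N := by positivity
    by_cases hc : a = i ∨ b = j ∨ a = j ∨ b = i
    · rw [countGraphs_eq_zero]
      · positivity
      · rintro G - ⟨⟨⟨h1, h2⟩, h3⟩, -⟩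
        rcases hc with rfl | rfl | rfl | rfl
        · exact h2.ne rfl
        · exact h3.ne rfl
        · exact h1 h2
        · exact h1 h3.symm
    push Not at hc
    obtain ⟨hai, hbj, haj, hbi⟩ := hc
    have htwo := countGraphs_two_adj_le y hΔ (i := i) (j := a) (k := j) (l := b) (Ne.symm hai)
      (Ne.symm hbj) (by rw [SimpleGraph.edge_adj]; grind) h0 (by linarith)
    rw [← hN] at htwo
    by_cases hX : X.Adj a b
    · refine (countGraphs_mono (Q := fun G => G.Adj i a ∧ G.Adj j b) ?_).trans (htwo.trans ?_)
      · intro G _ hG; tauto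
      · calc _ = y i * y j * N * (ind (X.Adj a b) * (y a * y b) / h ^ 2) := by
              rw [ind_of_true hX]; field_simp
          _ ≤ _ := by gcongr; linarith
    by_cases hab : a = b
    · refine (countGraphs_mono (Q := fun G => G.Adj i a ∧ G.Adj j b) ?_).trans (htwo.trans ?_)
      · intro G _ hG; tauto
      · calc _ = y i * y j * N * ((if a = b then (y a : ℝ) * y b else 0) / h ^ 2) := by
              rw [if_pos hab]; field_simp
          _ ≤ _ := by gcongr; linarith
    · have hthree := countGraphs_three_adj_le y hΔ (i := i) (j := a) (k := j) (l := b)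
        (p := a) (q := b) (Ne.symm hai) (Ne.symm hbj) hab
        (by rw [SimpleGraph.edge_adj]; grind) (by rw [SimpleGraph.edge_adj]; grind)
        (by rw [SimpleGraph.edge_adj]; grind) h0 hh
      rw [← hN] at hthree
      refine (countGraphs_mono ?_).trans (hthree.trans ?_)
      · intro G _ hG; tauto
      · calc _ = y i * y j * N * ((y a * y a) * (y b * y b) / h ^ 3) := by field_simp
          _ ≤ _ := by gcongr; linarith
  refine (Finset.sum_le_sum fun a _ => Finset.sum_le_sum fun b _ => hpt a b).trans ?_
  have hy : ∀ v, y v ≤ Δ := fun v => by have := hΔ v; omega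
  have s1 : ∑ a, ∑ b, (if a = b then (y a : ℝ) * y b else 0) ≤ Δ * ∑ v, (y v : ℝ) := by
    simpa using sum_sq_le hy
  have s2 : ∑ a, ∑ b, ((y a : ℝ) * y a) * (y b * y b) ≤ Δ ^ 2 * (∑ v, (y v : ℝ)) ^ 2 := by
    rw [← Finset.sum_mul_sum, ← sq, ← mul_pow]
    exact pow_le_pow_left₀ (Finset.sum_nonneg fun v _ => by positivity) (sum_sq_le hy) 2
  have s3 := sum_adj_mul_le hΔ
  calc _ = y i * y j * N * ((∑ a, ∑ b, (if a = b then (y a : ℝ) * y b else 0)) / h ^ 2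
        + (∑ a, ∑ b, ((y a : ℝ) * y a) * (y b * y b)) / h ^ 3
        + (∑ a, ∑ b, ind (X.Adj a b) * ((y a : ℝ) * y b)) / h ^ 2) := by
        simp only [Finset.mul_sum, Finset.sum_div, ← Finset.sum_add_distrib]
    _ ≤ y i * y j * N * (Δ * (∑ v, (y v : ℝ)) / h ^ 2
        + Δ ^ 2 * (∑ v, (y v : ℝ)) ^ 2 / h ^ 3 + Δ ^ 2 * (∑ v, (y v : ℝ)) / h ^ 2) :=
        mul_le_mul_of_nonneg_left (add_le_add (add_le_add
          (div_le_div_of_nonneg_right s1 (by positivity))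
          (div_le_div_of_nonneg_right s2 (by positivity)))
          (div_le_div_of_nonneg_right s3 (by positivity))) (by positivity)
    _ = _ := by ring

/-- In a random graph with degrees `y` avoiding `X`, the edge `ij` is present with probability
`(y i * y j / m) * (1 + O(Δ ^ 2 / m))`, where `m` is the sum of the degrees. -/
theorem abs_countGraphs_adj_sub_le (y : V → ℕ) {X : SimpleGraph V} {Δ : ℕ}
    (hΔ : ∀ v, y v + X.degree v ≤ Δ) (hΔ3 : 3 ≤ Δ) {m : ℝ} (hm : m = ∑ v, (y v : ℝ))
    (hmΔ : 8 * (Δ : ℝ) ^ 2 ≤ m) {i j : V} (hij : i ≠ j) (hX : ¬ X.Adj i j) :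
    |countGraphs y X (fun G => G.Adj i j) - y i * y j / m * countGraphs y X (fun _ => True)|
      ≤ 20 * (y i * y j * Δ ^ 2 / m ^ 2) * countGraphs y X (fun _ => True) := by
  have hΔ3' : (3 : ℝ) ≤ Δ := by exact_mod_cast hΔ3
  have hm0 : 0 < m := by nlinarith
  have hhalf : m / 2 ≤ (∑ v, (y v : ℝ)) - 4 - 2 * Δ * (Δ + 1) := by rw [← hm]; nlinarith
  set N := countGraphs y X (fun _ => True) with hN
  set A := countGraphs y X (fun G => G.Adj i j) with hA
  have hN0 : 0 ≤ N := countGraphs_nonneg _ _ _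
  have hA0 : 0 ≤ A := countGraphs_nonneg _ _ _
  have hyi : y i ≤ Δ := by have := hΔ i; omega
  have hyj : y j ≤ Δ := by have := hΔ j; omega
  have hyi' : (y i : ℝ) ≤ Δ := by exact_mod_cast hyi
  have hyj' : (y j : ℝ) ≤ Δ := by exact_mod_cast hyj
  have hY0 : 0 ≤ (y i : ℝ) * y j := by positivity
  have hYΔ : (y i : ℝ) * y j ≤ Δ ^ 2 := by rw [sq]; gcongr
  rw [abs_le]
  constructor
  · have hcompl : A + countGraphs y X (fun G => ¬ G.Adj i j) = N := by
      simpa using countGraphs_and_add_and_not y X (fun _ => True) (fun G => G.Adj i j)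
    have hAle : A ≤ y i * y j / (m / 2) * N :=
      countGraphs_adj_le y hΔ hij (by positivity) (by linarith)
    have hbad := sum_countGraphs_unswitchable_le y hΔ hij (h := m / 2) (by positivity) hhalf
    rw [← hm, ← hN] at hbad
    have hgood : ∑ a, ∑ b, countGraphs y X (fun G => ((¬ G.Adj i j ∧ G.Adj i a) ∧ G.Adj j b) ∧
        (a ≠ b ∧ ¬ G.Adj a b ∧ ¬ X.Adj a b)) ≤ m * A := by
      calc _ ≤ ∑ a, ∑ b, countGraphs y X (fun G => G.Adj i j ∧ G.Adj a b) := by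
            gcongr with a _ b _
            by_cases hc : a ≠ b ∧ i ≠ a ∧ j ≠ b ∧ a ≠ j ∧ b ≠ i ∧ ¬ X.Adj a b
            · obtain ⟨hab, hia, hjb, haj, hbi, hXab⟩ := hc
              refine (countGraphs_mono ?_).trans
                ((countGraphs_switch_adj_le y (X := X) hia hjb hij hab (Ne.symm haj)
                  hbi hX hXab).trans (countGraphs_mono ?_))
              · intro G _; tauto
              · intro G _; tauto
            · rw [countGraphs_eq_zero]
              · exact countGraphs_nonneg _ _ _
              · rintro G - ⟨⟨⟨h1, h2⟩, h3⟩, h4, h5, h6⟩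
                apply hc
                refine ⟨h4, h2.ne, h3.ne, ?_, ?_, h6⟩
                · rintro rfl; exact h1 h2
                · rintro rfl; exact h1 h3.symm
        _ = m * A := by
            simp only [sum_countGraphs_adj]
            rw [← Finset.sum_mul, ← hm]
    have htotal : y i * y j * countGraphs y X (fun G => ¬ G.Adj i j)
        = ∑ a, ∑ b, countGraphs y X (fun G => (¬ G.Adj i j ∧ G.Adj i a) ∧ G.Adj j b) := by
      simp only [sum_countGraphs_adj]
      rw [← Finset.mul_sum, sum_countGraphs_adj]
      ring
    have hsplit : y i * y j * (N - A) ≤ m * A + y i * y j * (Δ * m / (m / 2) ^ 2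
        + Δ ^ 2 * m ^ 2 / (m / 2) ^ 3 + Δ ^ 2 * m / (m / 2) ^ 2) * N := by
      rw [← hcompl, add_sub_cancel_left, htotal, hcompl]
      refine le_trans (le_of_eq ?_) (add_le_add hgood hbad)
      simp only [← Finset.sum_add_distrib, countGraphs_and_add_and_not]
    have e1 : Δ * m / (m / 2) ^ 2 + Δ ^ 2 * m ^ 2 / (m / 2) ^ 3 + Δ ^ 2 * m / (m / 2) ^ 2
        = (4 * Δ + 12 * Δ ^ 2) / m := by field_simp; ring
    have e2 : (4 * Δ + 12 * Δ ^ 2) / m ≤ 16 * (Δ : ℝ) ^ 2 / m := by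
      gcongr; nlinarith
    rw [e1] at hsplit
    have h3 : y i * y j * ((4 * Δ + 12 * Δ ^ 2) / m) * N ≤ y i * y j * (16 * (Δ : ℝ) ^ 2 / m) * N := by
      gcongr
    have h4 : y i * y j * A ≤ Δ ^ 2 * (y i * y j / (m / 2) * N) := by gcongr
    have h5 : y i * y j * N ≤ m * A + 18 * (y i * y j * Δ ^ 2 / m) * N := by
      have e3 : Δ ^ 2 * (y i * y j / (m / 2) * N) = 2 * (y i * y j * Δ ^ 2 / m) * N := by
        field_simp
      have e4 : y i * y j * (16 * (Δ : ℝ) ^ 2 / m) * N = 16 * (y i * y j * Δ ^ 2 / m) * N := by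
        field_simp
      linarith
    have h6 : y i * y j / m * N ≤ A + 18 * (y i * y j * Δ ^ 2 / m ^ 2) * N := by
      have := div_le_div_of_nonneg_right h5 hm0.le
      calc y i * y j / m * N = y i * y j * N / m := by ring
        _ ≤ _ := this
        _ = _ := by field_simp
    have h7 : 0 ≤ 2 * (y i * y j * Δ ^ 2 / m ^ 2) * N := by positivity
    linarith
  · have hden : 0 < m - 2 * Δ * (Δ + 1) := by rw [hm]; nlinarith
    have hAle : A ≤ y i * y j / (m - 2 * Δ * (Δ + 1)) * N :=
      countGraphs_adj_le y hΔ hij hden (by rw [hm])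
    have h1 : (1 : ℝ) / (m - 2 * Δ * (Δ + 1)) ≤ 1 / m + 20 * (Δ ^ 2 / m ^ 2) := by
      rw [div_add' _ _ _ hm0.ne', div_le_div_iff₀ hden hm0]
      have : 20 * ((Δ : ℝ) ^ 2 / m ^ 2) * m * (m - 2 * Δ * (Δ + 1))
          = 20 * Δ ^ 2 * ((m - 2 * Δ * (Δ + 1)) / m) := by field_simp
      have h2 : (1 : ℝ) / 2 ≤ (m - 2 * Δ * (Δ + 1)) / m := by
        rw [div_le_div_iff₀ two_pos hm0, hm]; linarith
      nlinarith
    calc A - y i * y j / m * N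
        ≤ y i * y j * N * (1 / (m - 2 * Δ * (Δ + 1)) - 1 / m) := by
          calc _ ≤ y i * y j / (m - 2 * Δ * (Δ + 1)) * N - y i * y j / m * N := by gcongr
            _ = _ := by ring
      _ ≤ y i * y j * N * (20 * (Δ ^ 2 / m ^ 2)) := by gcongr; linarith
      _ = _ := by ring

end EdgeProbabilityLower

section ForbiddenEdges

variable {V : Type*} [Fintype V]

lemma exp_neg_le_one_sub {p : ℝ} (h1 : p ≤ 3 / 5) :
    Real.exp (-p - 5 / 2 * p ^ 2) ≤ 1 - p := by
  have hp : 0 < 1 - p := by linarith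
  rw [← Real.le_log_iff_exp_le hp]
  refine le_trans ?_ (Real.one_sub_inv_le_log_of_pos hp)
  rw [← sub_nonneg]
  have : 1 - (1 - p)⁻¹ - (-p - 5 / 2 * p ^ 2) = p ^ 2 * (3 / 2 - 5 / 2 * p) / (1 - p) := by
    field_simp
    ring
  rw [this]
  apply div_nonneg _ hp.le
  apply mul_nonneg (sq_nonneg p)
  linarith

/-- The product of the weights of the two endpoints of an edge. -/
noncomputable def edgeWeight {V : Type*} (y : V → ℝ) : Sym2 V → ℝ :=
  Sym2.lift ⟨fun i j => y i * y j, fun i j => by ring⟩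

lemma edgeWeight_mk {V : Type*} (y : V → ℝ) (i j : V) : edgeWeight y s(i, j) = y i * y j := rfl

lemma two_mul_sum_edgeFinset (G : SimpleGraph V) (f : Sym2 V → ℝ) :
    2 * ∑ e ∈ G.edgeFinset, f e = ∑ a, ∑ b, ind (G.Adj a b) * f s(a, b) := by
  have h1 : ∑ a, ∑ b, ind (G.Adj a b) * f s(a, b)
      = ∑ p ∈ Finset.univ.filter (fun p : V × V => G.Adj p.1 p.2), f s(p.1, p.2) := by
    rw [Finset.sum_filter, Fintype.sum_prod_type]
    refine Finset.sum_congr rfl fun a _ => Finset.sum_congr rfl fun b _ => ?_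
    by_cases h : G.Adj a b <;> simp [h, ind]
  rw [h1, ← Finset.sum_fiberwise_of_maps_to (t := G.edgeFinset) (g := fun p : V × V => s(p.1, p.2)),
    Finset.mul_sum]
  · refine Finset.sum_congr rfl fun e he => ?_
    induction e with
    | h a b =>
      rw [SimpleGraph.mem_edgeFinset, SimpleGraph.mem_edgeSet] at he
      have : (Finset.univ.filter (fun p : V × V => G.Adj p.1 p.2)).filter
          (fun p => s(p.1, p.2) = s(a, b)) = {(a, b), (b, a)} := by
        ext ⟨u, v⟩
        simp only [Finset.mem_filter, Finset.mem_univ, true_and, Sym2.eq_iff, Finset.mem_insert,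
          Finset.mem_singleton, Prod.mk.injEq]
        constructor
        · exact fun h => h.2
        · rintro (⟨rfl, rfl⟩ | ⟨rfl, rfl⟩)
          · exact ⟨he, by simp⟩
          · exact ⟨he.symm, by simp⟩
      rw [this, Finset.sum_pair (by simp [he.ne])]
      simp only [Sym2.eq_swap (a := b) (b := a)]
      ring
  · intro p hp
    simpa using hp

lemma countGraphs_sup_edge (y : V → ℕ) (X : SimpleGraph V) {i j : V} (hij : i ≠ j) :
    countGraphs y (X ⊔ SimpleGraph.edge i j) (fun _ => True)
      = countGraphs y X (fun _ => True) - countGraphs y X (fun G => G.Adj i j) := by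
  have h := countGraphs_and_add_and_not y X (fun _ => True) (fun G => G.Adj i j)
  have h2 : countGraphs y (X ⊔ SimpleGraph.edge i j) (fun _ => True)
      = countGraphs y X (fun G => True ∧ ¬ G.Adj i j) := by
    unfold countGraphs
    congr 2
    ext G
    simp only [Finset.mem_filter, mem_graphsAvoiding, disjoint_sup_right, disjoint_edge_iff hij]
    tauto
  rw [h2]
  simp only [true_and] at h ⊢
  linarith

/-- Forbidding one more edge `ij` multiplies the count by
`exp (-(y i * y j / m) * (1 + O(Δ ^ 2 / m)))`. -/
lemma countGraphs_sup_edge_bounds (y : V → ℕ) {X : SimpleGraph V} {Δ : ℕ}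
    (hΔ : ∀ v, y v + X.degree v ≤ Δ) (hΔ3 : 3 ≤ Δ) {m : ℝ} (hm : m = ∑ v, (y v : ℝ))
    (hmΔ : 8 * (Δ : ℝ) ^ 2 ≤ m) {i j : V} (hij : i ≠ j) (hX : ¬ X.Adj i j) :
    Real.exp (-(1 + 60 * (Δ ^ 2 / m)) * (y i * y j / m)) * countGraphs y X (fun _ => True)
        ≤ countGraphs y (X ⊔ SimpleGraph.edge i j) (fun _ => True) ∧
      countGraphs y (X ⊔ SimpleGraph.edge i j) (fun _ => True)
        ≤ Real.exp (-(1 - 60 * (Δ ^ 2 / m)) * (y i * y j / m))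
          * countGraphs y X (fun _ => True) := by
  rw [countGraphs_sup_edge y X hij]
  have h := abs_countGraphs_adj_sub_le y hΔ hΔ3 hm hmΔ hij hX
  have hΔ3' : (3 : ℝ) ≤ Δ := by exact_mod_cast hΔ3
  have hm0 : 0 < m := by nlinarith
  set N := countGraphs y X (fun _ => True)
  set A := countGraphs y X (fun G => G.Adj i j)
  have hN0 : 0 ≤ N := countGraphs_nonneg _ _ _
  have hyi : (y i : ℝ) ≤ Δ := by have := hΔ i; exact_mod_cast (by omega : y i ≤ Δ)
  have hyj : (y j : ℝ) ≤ Δ := by have := hΔ j; exact_mod_cast (by omega : y j ≤ Δ)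
  set δ : ℝ := Δ ^ 2 / m with hδ
  set t : ℝ := y i * y j / m with ht
  have ht0 : 0 ≤ t := by positivity
  have hδ0 : 0 ≤ δ := by positivity
  have htδ : t ≤ δ := by rw [ht, hδ, sq]; gcongr
  have hδ8 : δ ≤ 1 / 8 := by
    rw [hδ, div_le_div_iff₀ hm0 (by norm_num)]; linarith
  have e : 20 * (y i * y j * Δ ^ 2 / m ^ 2) = 20 * (t * δ) := by
    rw [ht, hδ]; field_simp
  rw [e, abs_le] at h
  constructor
  · set p := t + 20 * (t * δ) with hp
    have hp0 : 0 ≤ p := by positivity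
    have hp1 : p ≤ 7 / 2 * t := by nlinarith
    have hp2 : Real.exp (-(1 + 60 * δ) * t) ≤ 1 - p := by
      refine le_trans (Real.exp_le_exp.mpr ?_) (exp_neg_le_one_sub (by linarith))
      have : p ^ 2 ≤ (7 / 2 * t) ^ 2 := by gcongr
      nlinarith
    calc _ ≤ (1 - p) * N := by gcongr
      _ ≤ N - A := by rw [hp]; linarith [h.2]
  · calc N - A ≤ (-(1 - 60 * δ) * t + 1) * N := by
          have : 0 ≤ t * δ * N := by positivity
          nlinarith [h.1]
      _ ≤ _ := by gcongr; exact Real.add_one_le_exp _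

/-- Forbidding the edges of a sparse graph `X` multiplies the count by
`exp (-μ * (1 + O(Δ ^ 2 / m)))`, where `μ` is the sum of `y i * y j / m` over the edges of `X`. -/
theorem countGraphs_avoiding_bounds (y : V → ℕ) {X : SimpleGraph V} {Δ : ℕ}
    (hΔ : ∀ v, y v + X.degree v ≤ Δ) (hΔ3 : 3 ≤ Δ) {m : ℝ} (hm : m = ∑ v, (y v : ℝ))
    (hmΔ : 8 * (Δ : ℝ) ^ 2 ≤ m) {μ : ℝ}
    (hμ : μ = (∑ e ∈ X.edgeFinset, edgeWeight (fun v => (y v : ℝ)) e) / m) :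
    Real.exp (-(1 + 60 * (Δ ^ 2 / m)) * μ) * countGraphs y ⊥ (fun _ => True)
        ≤ countGraphs y X (fun _ => True) ∧
      countGraphs y X (fun _ => True)
        ≤ Real.exp (-(1 - 60 * (Δ ^ 2 / m)) * μ) * countGraphs y ⊥ (fun _ => True) := by
  have key : ∀ E : Finset (Sym2 V), E ⊆ X.edgeFinset →
      ∀ Y : SimpleGraph V, Y = SimpleGraph.fromEdgeSet (E : Set (Sym2 V)) →
      Real.exp (-(1 + 60 * (Δ ^ 2 / m)) * ((∑ e ∈ E, edgeWeight (fun v => (y v : ℝ)) e) / m))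
          * countGraphs y ⊥ (fun _ => True) ≤ countGraphs y Y (fun _ => True) ∧
        countGraphs y Y (fun _ => True)
          ≤ Real.exp (-(1 - 60 * (Δ ^ 2 / m)) *
            ((∑ e ∈ E, edgeWeight (fun v => (y v : ℝ)) e) / m))
            * countGraphs y ⊥ (fun _ => True) := by
    intro E
    induction E using Finset.induction_on with
    | empty =>
      rintro - Y rfl
      simp
    | insert e E he ih =>
      intro hE Y hY
      induction e with
      | h i j =>
        rw [Finset.insert_subset_iff, SimpleGraph.mem_edgeFinset, SimpleGraph.mem_edgeSet] at hE
        obtain ⟨Z, hZ⟩ : ∃ Z, Z = SimpleGraph.fromEdgeSet (E : Set (Sym2 V)) := ⟨_, rfl⟩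
        have hij : i ≠ j := hE.1.ne
        have hYZ : Y = Z ⊔ SimpleGraph.edge i j := by
          rw [hY, hZ, SimpleGraph.edge, ← SimpleGraph.fromEdgeSet_union, Finset.coe_insert,
            Set.insert_eq, Set.union_comm]
        have hZX : Z ≤ X := by
          rw [hZ]
          intro a b hab
          rw [SimpleGraph.fromEdgeSet_adj] at hab
          have := hE.2 (Finset.mem_coe.mp hab.1)
          simpa using this
        have hZadj : ¬ Z.Adj i j := by
          rw [hZ, SimpleGraph.fromEdgeSet_adj]
          exact fun h => he (Finset.mem_coe.mp h.1)
        have hΔZ : ∀ v, y v + Z.degree v ≤ Δ := fun v =>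
          le_trans (Nat.add_le_add_left (SimpleGraph.degree_le_of_le hZX) _) (hΔ v)
        have hstep := countGraphs_sup_edge_bounds y hΔZ hΔ3 hm hmΔ hij hZadj
        have ih' := ih hE.2 Z hZ
        rw [hYZ, Finset.sum_insert he, edgeWeight_mk, add_div]
        simp only [mul_add, Real.exp_add, mul_assoc]
        constructor
        · refine le_trans ?_ hstep.1
          have := ih'.1
          gcongr
        · refine le_trans hstep.2 ?_
          have := ih'.2
          gcongr
  have h := key X.edgeFinset subset_rfl X (by simp)
  rw [← hμ] at h
  exact h

lemma sum_edgeWeight_le {y : V → ℕ} {X : SimpleGraph V} {Δ : ℕ}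
    (hΔ : ∀ v, y v + X.degree v ≤ Δ) :
    ∑ e ∈ X.edgeFinset, edgeWeight (fun v => (y v : ℝ)) e ≤ Δ ^ 2 * ∑ v, (y v : ℝ) := by
  have h1 := two_mul_sum_edgeFinset X (edgeWeight (fun v => (y v : ℝ)))
  have h2 := sum_adj_mul_le hΔ
  simp only [edgeWeight_mk] at h1
  have h3 : 0 ≤ (Δ : ℝ) ^ 2 * ∑ v, (y v : ℝ) := by positivity
  linarith

end ForbiddenEdges

section VertexSplitting

variable {V : Type*} [Fintype V]

lemma countGraphs_extract_edge {y z : V → ℕ} {X : SimpleGraph V} {i j : V} (hij : i ≠ j)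
    (hX : ¬ X.Adj i j)
    (hy : ∀ u, y u = z u + ((if u = i then 1 else 0) + (if u = j then 1 else 0)))
    (P : SimpleGraph V → Prop) :
    countGraphs y X (fun G => G.Adj i j ∧ P G)
      = countGraphs z (X ⊔ SimpleGraph.edge i j) (fun G => P (G ⊔ SimpleGraph.edge i j)) := by
  rw [← countGraphs_extract z (F := SimpleGraph.edge i j) ((disjoint_edge_iff hij).mpr hX).symm]
  simp only [edge_le_iff_adj hij]
  congr 1
  funext u
  rw [degree_edge hij, hy]

lemma countGraphs_adj_eq_zero {y : V → ℕ} {X : SimpleGraph V} {P : SimpleGraph V → Prop} {i j : V}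
    (hj : y j = 0) (hP : ∀ G, P G → G.Adj i j) : countGraphs y X P = 0 := by
  refine countGraphs_eq_zero fun G hG h => ?_
  have h1 := (mem_graphsAvoiding.mp hG).1 j
  have h2 : 0 < G.degree j := (G.degree_pos_iff_exists_adj j).mpr ⟨i, (hP G h).symm⟩
  omega

/-- Moving one edge end from the vertex `v` to a fresh vertex. -/
structure IsSplit (y y' : V → ℕ) (v v' : V) : Prop where
  ne : v ≠ v'
  zero : y v' = 0
  one : y' v' = 1
  succ : y v = y' v + 1
  other : ∀ u, u ≠ v → u ≠ v' → y' u = y u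

variable {y y' : V → ℕ} {v v' : V}

lemma IsSplit.countGraphs_adj (h : IsSplit y y' v v') {a : V} (hav : a ≠ v) (hav' : a ≠ v') :
    countGraphs y ⊥ (fun G => G.Adj v a)
      = countGraphs y' ⊥ (fun G => G.Adj v' a ∧ ¬ G.Adj v a) := by
  have ha := h.other a hav hav'
  by_cases hy0 : y a = 0
  · rw [countGraphs_adj_eq_zero (i := v) (j := a) hy0 fun _ h => h,
      countGraphs_adj_eq_zero (i := v') (j := a) (ha.trans hy0) fun _ h => h.1]
  obtain ⟨z, hz⟩ : ∃ z : V → ℕ, ∀ u, y u = z u +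
      ((if u = v then 1 else 0) + (if u = a then 1 else 0)) := by
    refine ⟨fun u => y u - ((if u = v then 1 else 0) + (if u = a then 1 else 0)), fun u => ?_⟩
    have := h.succ
    by_cases h1 : u = v
    · subst h1; simp only [hav.symm, if_true, if_false]; omega
    · by_cases h2 : u = a
      · subst h2; simp only [h1, if_true, if_false]; omega
      · simp [h1, h2]
  have hz' : ∀ u, y' u = z u + ((if u = v' then 1 else 0) + (if u = a then 1 else 0)) := by
    intro u
    have hzu := hz u
    by_cases h1 : u = v
    · subst h1
      have := h.succ
      simp only [h.ne, hav.symm, if_true, if_false] at hzu ⊢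
      omega
    · by_cases h2 : u = v'
      · subst h2
        have := h.zero
        have := h.one
        simp only [h1, hav'.symm, if_true, if_false] at hzu ⊢
        omega
      · rw [h.other u h1 h2, hzu]
        simp [h1, h2]
  have hzv' : z v' = 0 := by have := hz v'; have := h.zero; omega
  have e1 := countGraphs_extract_edge (X := ⊥) hav.symm (by simp) hz (fun _ => True)
  have e2 := countGraphs_extract_edge (X := ⊥) hav'.symm (by simp) hz' (fun G => ¬ G.Adj v a)
  simp only [and_true] at e1
  rw [e1, e2]
  unfold countGraphs
  congr 2
  ext G
  have hne : ¬ (SimpleGraph.edge v' a).Adj v a := by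
    rw [SimpleGraph.edge_adj]
    have := h.ne
    grind
  simp only [Finset.mem_filter, mem_graphsAvoiding, bot_sup_eq, disjoint_edge_iff hav.symm,
    disjoint_edge_iff hav'.symm, SimpleGraph.sup_adj, hne, or_false, and_true]
  constructor
  · rintro ⟨h1, h2⟩
    refine ⟨⟨h1, fun h3 => ?_⟩, h2⟩
    have h4 : 0 < G.degree v' := (G.degree_pos_iff_exists_adj v').mpr ⟨a, h3⟩
    rw [h1 v', hzv'] at h4
    exact lt_irrefl _ h4
  · rintro ⟨⟨h1, -⟩, h2⟩
    exact ⟨h1, h2⟩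

lemma countGraphs_adj_self (y : V → ℕ) (X : SimpleGraph V) (a : V) :
    countGraphs y X (fun G => G.Adj a a) = 0 :=
  countGraphs_eq_zero fun _ _ h => h.ne rfl

/-- The exact relation between the numbers of graphs before and after splitting a vertex. -/
lemma IsSplit.mul_countGraphs (h : IsSplit y y' v v') :
    (y v : ℝ) * countGraphs y ⊥ (fun _ => True)
      = countGraphs y' ⊥ (fun _ => True) - (countGraphs y' ⊥ (fun G => G.Adj v' v)
        + ∑ a, countGraphs y' ⊥ (fun G => G.Adj v' a ∧ G.Adj v a)) := by
  have h1 := sum_countGraphs_adj y ⊥ (fun _ => True) v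
  have h2 := sum_countGraphs_adj y' ⊥ (fun _ => True) v'
  simp only [true_and] at h1 h2
  rw [h.one, Nat.cast_one, one_mul] at h2
  rw [← h1, ← h2]
  have key : ∀ a, countGraphs y ⊥ (fun G => G.Adj v a) = countGraphs y' ⊥ (fun G => G.Adj v' a)
      - ((if a = v then countGraphs y' ⊥ (fun G => G.Adj v' v) else 0)
        + countGraphs y' ⊥ (fun G => G.Adj v' a ∧ G.Adj v a)) := by
    intro a
    by_cases hav : a = v
    · subst hav
      rw [countGraphs_adj_self, if_pos rfl, countGraphs_eq_zero (P := fun G => G.Adj v' a ∧ _)]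
      · ring
      · intro G _ hG
        exact hG.2.ne rfl
    by_cases hav' : a = v'
    · subst hav'
      rw [countGraphs_adj_eq_zero (i := v) (j := a) h.zero fun _ h => h, countGraphs_adj_self,
        if_neg hav, countGraphs_eq_zero]
      · ring
      · intro G _ hG
        exact hG.1.ne rfl
    · rw [h.countGraphs_adj hav hav', if_neg hav,
        ← countGraphs_and_add_and_not y' ⊥ (fun G => G.Adj v' a) (fun G => G.Adj v a)]
      ring
  simp only [key, Finset.sum_sub_distrib, Finset.sum_add_distrib]
  simp

end VertexSplitting

section SplittingEstimate

variable {V : Type*} [Fintype V]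

lemma degree_bot_eq_zero {V : Type*} (v : V) [Fintype ((⊥ : SimpleGraph V).neighborSet v)] :
    (⊥ : SimpleGraph V).degree v = 0 := by
  rw [← SimpleGraph.card_neighborFinset_eq_degree, Finset.card_eq_zero,
    Finset.eq_empty_iff_forall_notMem]
  simp

lemma abs_countGraphs_bot_adj_sub_le (y : V → ℕ) {Δ : ℕ} (hΔ : ∀ v, y v ≤ Δ) (hΔ3 : 3 ≤ Δ) {m : ℝ}
    (hm : m = ∑ v, (y v : ℝ)) (hmΔ : 8 * (Δ : ℝ) ^ 2 ≤ m) {i j : V} (hij : i ≠ j) :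
    |countGraphs y ⊥ (fun G => G.Adj i j) - y i * y j / m * countGraphs y ⊥ (fun _ => True)|
      ≤ 20 * (y i * y j * Δ ^ 2 / m ^ 2) * countGraphs y ⊥ (fun _ => True) :=
  abs_countGraphs_adj_sub_le y (fun v => by rw [degree_bot_eq_zero]; exact hΔ v) hΔ3 hm hmΔ hij
    (by simp)

lemma countGraphs_bot_adj_le (y : V → ℕ) {Δ : ℕ} (hΔ : ∀ v, y v ≤ Δ) {i j : V} (hij : i ≠ j)
    {h : ℝ} (h0 : 0 < h) (hh : h ≤ (∑ v, (y v : ℝ)) - 2 * Δ * (Δ + 1)) :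
    countGraphs y ⊥ (fun G => G.Adj i j)
      ≤ y i * y j / h * countGraphs y ⊥ (fun _ => True) :=
  countGraphs_adj_le y (fun v => by rw [degree_bot_eq_zero]; exact hΔ v) hij h0 hh

lemma countGraphs_bot_two_adj_le (y : V → ℕ) {Δ : ℕ} (hΔ : ∀ v, y v ≤ Δ) {i j k l : V}
    (hij : i ≠ j) (hkl : k ≠ l) (hne : ¬ (SimpleGraph.edge i j).Adj k l) {h : ℝ} (h0 : 0 < h)
    (hh : h ≤ (∑ v, (y v : ℝ)) - 2 - 2 * Δ * (Δ + 1)) :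
    countGraphs y ⊥ (fun G => G.Adj i j ∧ G.Adj k l)
      ≤ (y i * y j / h) * (y k * y l / h) * countGraphs y ⊥ (fun _ => True) :=
  countGraphs_two_adj_le y (fun v => by rw [degree_bot_eq_zero]; exact hΔ v) hij hkl hne h0 hh

lemma abs_sub_le_of_conditional {A M N q b m D : ℝ} (hA : 0 ≤ A) (hM0 : 0 ≤ M) (hN : 0 ≤ N)
    (hq : 0 ≤ q) (hb : 0 ≤ b) (hD : 9 ≤ D) (hm : 9 * D ≤ m)
    (hAM : |A - q / (m - 2) * M| ≤ 20 * (q * D / (m - 2) ^ 2) * M)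
    (hMN : |M - b / m * N| ≤ 20 * (b * D / m ^ 2) * N) :
    |A - q * b / m ^ 2 * N| ≤ 100 * (D / m) * (q * b / m ^ 2 * N) := by
  have hm0 : 0 < m := by linarith
  have hm2 : 0 < m - 2 := by linarith
  set ε := D / m with hε
  have hε0 : 0 ≤ ε := by positivity
  have hε9 : ε ≤ 1 / 9 := by rw [hε, div_le_div_iff₀ hm0 (by norm_num)]; linarith
  set r := m / (m - 2) with hr
  have hr1 : 1 ≤ r := by rw [hr, one_le_div hm2]; linarith
  have hr2 : r ≤ 1 + ε / 4 := by
    rw [hr, div_le_iff₀ hm2, hε]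
    have : (1 + D / m / 4) * (m - 2) = m - 2 + D * ((m - 2) / m) / 4 := by field_simp
    rw [this]
    have h8 : (8 : ℝ) / 9 ≤ (m - 2) / m := by
      rw [div_le_div_iff₀ (by norm_num) hm0]; linarith
    nlinarith
  set Q := q / m with hQ
  set B := b / m * N with hB
  have hQ0 : 0 ≤ Q := by positivity
  have hB0 : 0 ≤ B := by positivity
  have e1 : q / (m - 2) = Q * r := by rw [hQ, hr]; field_simp
  have e2 : 20 * (q * D / (m - 2) ^ 2) = 20 * (Q * r) * (ε * r) := by
    rw [hQ, hr, hε]; field_simp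
  have e3 : 20 * (b * D / m ^ 2) * N = 20 * ε * B := by rw [hB, hε]; field_simp
  have e4 : q * b / m ^ 2 * N = Q * B := by rw [hQ, hB]; field_simp
  rw [e1, e2] at hAM
  rw [e3] at hMN
  rw [e4]
  rw [abs_le] at hAM hMN ⊢
  have hQB : 0 ≤ Q * B := by positivity
  constructor
  · by_cases h100 : 1 ≤ 100 * ε
    · nlinarith
    push Not at h100
    have hM : (1 - 20 * ε) * B ≤ M := by linarith [hMN.1]
    have hεr : ε * r ≤ 101 / 100 * ε := by nlinarith
    have h1 : 0 ≤ 1 - 20 * (ε * r) := by linarith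
    have h2 : Q * (1 - 20 * (ε * r)) * M ≤ A := by
      have : Q * r * (1 - 20 * (ε * r)) * M ≤ A := by linarith [hAM.1]
      refine le_trans ?_ this
      gcongr
      exact le_mul_of_one_le_right hQ0 hr1
    have h3 : Q * (1 - 20 * (ε * r)) * ((1 - 20 * ε) * B) ≤ A := le_trans (by gcongr) h2
    have h4 : 1 - 100 * ε ≤ (1 - 20 * (ε * r)) * (1 - 20 * ε) := by nlinarith
    have h5 := mul_le_mul_of_nonneg_right h4 hQB
    linarith
  · have hM : M ≤ (1 + 20 * ε) * B := by linarith [hMN.2]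
    have hεr : ε * r ≤ 103 / 100 * ε := by nlinarith
    have h2 : A ≤ Q * r * (1 + 20 * (ε * r)) * M := by linarith [hAM.2]
    have h3 : A ≤ Q * (1 + ε / 4) * (1 + 20 * (103 / 100 * ε)) * ((1 + 20 * ε) * B) := by
      refine h2.trans ?_
      gcongr
    have h4 : (1 + ε / 4) * (1 + 20 * (103 / 100 * ε)) * (1 + 20 * ε) ≤ 1 + 100 * ε := by
      have : (1 + ε / 4) * (1 + 20 * (103 / 100 * ε)) ≤ 1 + 43 / 2 * ε := by nlinarith
      calc _ ≤ (1 + 43 / 2 * ε) * (1 + 20 * ε) := by gcongr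
        _ ≤ _ := by nlinarith
    have h5 := mul_le_mul_of_nonneg_right h4 hQB
    linarith

lemma abs_countGraphs_cherry_sub_le (y : V → ℕ) {Δ : ℕ} (hΔ : ∀ v, y v ≤ Δ) (hΔ3 : 3 ≤ Δ) {m : ℝ}
    (hm : m = ∑ v, (y v : ℝ)) (hmΔ : 9 * (Δ : ℝ) ^ 2 ≤ m) {v v' a : V} (hvv' : v ≠ v')
    (hav : a ≠ v) (hav' : a ≠ v') (hv' : y v' = 1) :
    |countGraphs y ⊥ (fun G => G.Adj v' a ∧ G.Adj v a)
        - y v * (y a - 1) * y a / m ^ 2 * countGraphs y ⊥ (fun _ => True)|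
      ≤ 100 * (Δ ^ 2 / m) *
        (y v * (y a - 1) * y a / m ^ 2 * countGraphs y ⊥ (fun _ => True)) := by
  by_cases hy0 : y a = 0
  · rw [countGraphs_adj_eq_zero (i := v') (j := a) hy0 fun _ h => h.1]
    simp [hy0]
  obtain ⟨z, hz⟩ : ∃ z : V → ℕ, ∀ u, y u = z u +
      ((if u = v' then 1 else 0) + (if u = a then 1 else 0)) := by
    refine ⟨fun u => y u - ((if u = v' then 1 else 0) + (if u = a then 1 else 0)), fun u => ?_⟩
    by_cases h1 : u = v'
    · subst h1; simp only [hav'.symm, if_true, if_false]; omega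
    · by_cases h2 : u = a
      · subst h2; simp only [h1, if_true, if_false]; omega
      · simp [h1, h2]
  have e1 := countGraphs_extract_edge (X := ⊥) hav'.symm (by simp) hz (fun G => G.Adj v a)
  have e2 := countGraphs_extract_edge (X := ⊥) hav'.symm (by simp) hz (fun _ => True)
  have hne : ¬ (SimpleGraph.edge v' a).Adj v a := by
    rw [SimpleGraph.edge_adj]
    grind
  simp only [and_true, bot_sup_eq, SimpleGraph.sup_adj, hne, or_false] at e1 e2
  have hΔ3' : (3 : ℝ) ≤ Δ := by exact_mod_cast hΔ3
  have hzv : z v = y v := by have := hz v; simp [hvv', hav.symm] at this; omega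
  have hza : (z a : ℝ) = y a - 1 := by
    have := hz a
    simp only [hav', if_true, if_false] at this
    rw [this]; push_cast; ring
  have hzm : m - 2 = ∑ v, (z v : ℝ) := by
    rw [hm, sub_eq_iff_eq_add]
    have : ∀ u, (y u : ℝ) = z u + ((if u = v' then 1 else 0) + (if u = a then 1 else 0)) := by
      intro u
      have := hz u
      rw [this]; push_cast; rfl
    simp only [this, Finset.sum_add_distrib]
    simp
    norm_num
  have h1 := abs_countGraphs_adj_sub_le z (X := SimpleGraph.edge v' a) (Δ := Δ) (fun u => by
    rw [degree_edge hav'.symm, ← hz u]; exact hΔ u) hΔ3 hzm (by nlinarith) hav.symm hne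
  have h2 := abs_countGraphs_bot_adj_sub_le y hΔ hΔ3 hm (by nlinarith) hav'.symm
  rw [← e1, ← e2, hzv, hza] at h1
  rw [hv', Nat.cast_one, one_mul] at h2
  exact abs_sub_le_of_conditional (countGraphs_nonneg _ _ _) (countGraphs_nonneg _ _ _) (countGraphs_nonneg _ _ _)
    (mul_nonneg (Nat.cast_nonneg _) (sub_nonneg.mpr (by exact_mod_cast Nat.pos_of_ne_zero hy0)))
    (Nat.cast_nonneg _) (by nlinarith) hmΔ h1 h2

/-- The quantity `λ` of a degree sequence: `∑ y (y - 1) / (2 m)`. -/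
noncomputable def lam (y : V → ℕ) : ℝ :=
  (∑ v, (y v : ℝ) * (y v - 1)) / (2 * ∑ v, (y v : ℝ))

lemma lam_nonneg (y : V → ℕ) : 0 ≤ lam y := by
  unfold lam
  refine div_nonneg (Finset.sum_nonneg fun v _ => ?_) (by positivity)
  rcases Nat.eq_zero_or_pos (y v) with h | h
  · simp [h]
  · exact mul_nonneg (Nat.cast_nonneg _) (sub_nonneg.mpr (by exact_mod_cast h))

lemma lam_le (y : V → ℕ) {Δ : ℕ} (hΔ : ∀ v, y v ≤ Δ) (h0 : 0 < ∑ v, (y v : ℝ)) :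
    2 * lam y ≤ Δ - 1 := by
  unfold lam
  rw [← mul_div_assoc, mul_div_mul_left _ _ two_ne_zero, div_le_iff₀ h0, Finset.mul_sum]
  refine Finset.sum_le_sum fun v _ => ?_
  rw [mul_comm]
  gcongr
  exact hΔ v

variable {y y' : V → ℕ} {v v' : V}

lemma IsSplit.sum_add {f : ℕ → ℝ} (h : IsSplit y y' v v') :
    ∑ u, f (y u) + (f (y' v) + f (y' v')) = ∑ u, f (y' u) + (f (y v) + f (y v')) := by
  have key : ∀ u, f (y u) + ((if u = v then f (y' v) else 0) + (if u = v' then f (y' v') else 0))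
      = f (y' u) + ((if u = v then f (y v) else 0) + (if u = v' then f (y v') else 0)) := by
    intro u
    have := h.ne
    by_cases h1 : u = v
    · subst h1; simp [this]; ring
    · by_cases h2 : u = v'
      · subst h2; simp [h1]; ring
      · simp [h1, h2, h.other u h1 h2]
  have := Finset.sum_congr (rfl : (Finset.univ : Finset V) = _) (fun u _ => key u)
  simpa only [Finset.sum_add_distrib, Finset.sum_ite_eq', Finset.mem_univ, if_true] using this

lemma IsSplit.sum_eq (h : IsSplit y y' v v') : ∑ u, (y u : ℝ) = ∑ u, (y' u : ℝ) := by
  have := h.sum_add (f := fun k => (k : ℝ))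
  rw [h.zero, h.one, h.succ] at this
  push_cast at this
  linarith

lemma IsSplit.lam_eq (h : IsSplit y y' v v') (h0 : 0 < ∑ u, (y u : ℝ)) :
    lam y = lam y' + y' v / ∑ u, (y u : ℝ) := by
  have := h.sum_add (f := fun k => (k : ℝ) * (k - 1))
  rw [h.zero, h.one, h.succ] at this
  push_cast at this
  unfold lam
  rw [← h.sum_eq]
  field_simp
  linarith

lemma IsSplit.le_bound {V : Type*} {y y' : V → ℕ} {v v' : V}
    (h : IsSplit y y' v v') {Δ : ℕ} (hΔ : ∀ v, y v ≤ Δ) (hΔ3 : 3 ≤ Δ) (u : V) :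
    y' u ≤ Δ := by
  by_cases h1 : u = v
  · have := hΔ v; have := h.succ; rw [h1]; omega
  · by_cases h2 : u = v'
    · rw [h2, h.one]; omega
    · rw [h.other u h1 h2]; exact hΔ u

lemma sum_countGraphs_cherry_le (y : V → ℕ) {Δ : ℕ} (hΔ : ∀ v, y v ≤ Δ) (hΔ3 : 3 ≤ Δ) {m : ℝ}
    (hm : m = ∑ v, (y v : ℝ)) (hmΔ : 9 * (Δ : ℝ) ^ 2 ≤ m) {v v' : V} (hvv' : v ≠ v')
    (hv' : y v' = 1) :
    countGraphs y ⊥ (fun G => G.Adj v' v) + ∑ a, countGraphs y ⊥ (fun G => G.Adj v' a ∧ G.Adj v a)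
      ≤ 14 / 3 * (Δ ^ 2 / m) * countGraphs y ⊥ (fun _ => True) := by
  have hΔ3' : (3 : ℝ) ≤ Δ := by exact_mod_cast hΔ3
  have hm0 : 0 < m := by nlinarith
  have hvΔ : (y v : ℝ) ≤ Δ := by exact_mod_cast hΔ v
  set N := countGraphs y ⊥ (fun _ => True) with hN
  have hN0 : 0 ≤ N := countGraphs_nonneg _ _ _
  have hhalf : m / 2 ≤ (∑ v, (y v : ℝ)) - 2 - 2 * Δ * (Δ + 1) := by rw [← hm]; nlinarith
  have hA1 : countGraphs y ⊥ (fun G => G.Adj v' v) ≤ 2 * y v / m * N := by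
    have := countGraphs_bot_adj_le y hΔ hvv'.symm (h := m / 2) (by positivity) (by linarith)
    rw [hv'] at this
    refine this.trans (le_of_eq ?_)
    push_cast
    field_simp
    rfl
  have hpt : ∀ a, countGraphs y ⊥ (fun G => G.Adj v' a ∧ G.Adj v a)
      ≤ 4 * y v / m ^ 2 * N * (y a * y a) := by
    intro a
    by_cases hav : a = v
    · rw [countGraphs_eq_zero]
      · positivity
      · rintro G - ⟨-, hG⟩; exact hG.ne hav.symm
    by_cases hav' : a = v'
    · rw [countGraphs_eq_zero]
      · positivity
      · rintro G - ⟨hG, -⟩; exact hG.ne hav'.symm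
    · have := countGraphs_bot_two_adj_le y hΔ (i := v') (j := a) (k := v) (l := a)
        (Ne.symm hav') (Ne.symm hav) (by rw [SimpleGraph.edge_adj]; grind)
        (h := m / 2) (by positivity) hhalf
      rw [hv'] at this
      refine this.trans (le_of_eq ?_)
      push_cast
      field_simp
      ring
  have hS1 : ∑ a, countGraphs y ⊥ (fun G => G.Adj v' a ∧ G.Adj v a)
      ≤ 4 * y v / m ^ 2 * N * (Δ * m) := by
    refine (Finset.sum_le_sum fun a _ => hpt a).trans ?_
    rw [← Finset.mul_sum]
    have := sum_sq_le hΔ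
    rw [← hm] at this
    exact mul_le_mul_of_nonneg_left this (by positivity)
  have h1 : 2 * y v / m * N ≤ 2 / 3 * (Δ ^ 2 / m) * N := by
    rw [← mul_div_assoc]
    have : 2 * (y v : ℝ) ≤ 2 / 3 * Δ ^ 2 := by nlinarith
    exact mul_le_mul_of_nonneg_right (div_le_div_of_nonneg_right this hm0.le) hN0
  have h2 : 4 * y v / m ^ 2 * N * (Δ * m) ≤ 4 * (Δ ^ 2 / m) * N := by
    have e : 4 * y v / m ^ 2 * N * (Δ * m) = 4 * (y v * Δ / m) * N := by field_simp
    rw [e, sq]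
    gcongr
  linarith

lemma abs_sum_countGraphs_cherry_sub_le (y : V → ℕ) {Δ : ℕ} (hΔ : ∀ v, y v ≤ Δ) (hΔ3 : 3 ≤ Δ)
    {m : ℝ} (hm : m = ∑ v, (y v : ℝ)) (hmΔ : 9 * (Δ : ℝ) ^ 2 ≤ m) {v v' : V} (hvv' : v ≠ v')
    (hv' : y v' = 1) :
    |countGraphs y ⊥ (fun G => G.Adj v' v) + ∑ a, countGraphs y ⊥ (fun G => G.Adj v' a ∧ G.Adj v a)
      - (y v / m + y v / m ^ 2 * ∑ a, (if a = v then 0 else (y a : ℝ) * (y a - 1)))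
        * countGraphs y ⊥ (fun _ => True)|
      ≤ 100 * (Δ ^ 2 / m) *
        ((y v / m + y v / m ^ 2 * ∑ a, (if a = v then 0 else (y a : ℝ) * (y a - 1)))
          * countGraphs y ⊥ (fun _ => True)) := by
  have hΔ3' : (3 : ℝ) ≤ Δ := by exact_mod_cast hΔ3
  have hm0 : 0 < m := by nlinarith
  set N := countGraphs y ⊥ (fun _ => True) with hN
  have hN0 : 0 ≤ N := countGraphs_nonneg _ _ _
  have hA := abs_countGraphs_bot_adj_sub_le y hΔ hΔ3 hm (by linarith) hvv'.symm
  rw [hv', ← hN] at hA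
  have hA' : |countGraphs y ⊥ (fun G => G.Adj v' v) - y v / m * N|
      ≤ 100 * (Δ ^ 2 / m) * (y v / m * N) := by
    calc _ ≤ 20 * (Δ ^ 2 / m) * (y v / m * N) := by
          convert hA using 1
          · push_cast; ring_nf
          · push_cast; field_simp
      _ ≤ _ := by
          have : 0 ≤ Δ ^ 2 / m * (y v / m * N) := by positivity
          linarith
  have hS : ∀ a, |countGraphs y ⊥ (fun G => G.Adj v' a ∧ G.Adj v a)
      - y v / m ^ 2 * (if a = v then 0 else (y a : ℝ) * (y a - 1)) * N|
      ≤ 100 * (Δ ^ 2 / m) * (y v / m ^ 2 * (if a = v then 0 else (y a : ℝ) * (y a - 1)) * N) := by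
    intro a
    by_cases hav : a = v
    · rw [if_pos hav, countGraphs_eq_zero]
      · simp
      · rintro G - ⟨-, hG⟩; exact hG.ne hav.symm
    rw [if_neg hav]
    by_cases hav' : a = v'
    · rw [countGraphs_eq_zero, hav', hv']
      · simp
      · rintro G - ⟨hG, -⟩; exact hG.ne hav'.symm
    · have := abs_countGraphs_cherry_sub_le y hΔ hΔ3 hm hmΔ hvv' hav hav' hv'
      rw [← hN] at this
      have e : y v * (y a - 1) * y a / m ^ 2 * N = y v / m ^ 2 * (y a * (y a - 1)) * N := by ring
      rwa [e] at this
  have hsum := (Finset.abs_sum_le_sum_abs _ Finset.univ).trans (Finset.sum_le_sum fun a _ => hS a)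
  have key := (abs_add_le _ _).trans (add_le_add hA' hsum)
  rw [Finset.sum_sub_distrib] at key
  simp only [← Finset.mul_sum, ← Finset.sum_mul] at key
  calc _ = _ := by congr 1; ring
    _ ≤ _ := key
    _ = _ := by ring

/-- The number of graphs before and after splitting a vertex. -/
lemma IsSplit.countGraphs_bounds (h : IsSplit y y' v v') {Δ : ℕ} (hΔ : ∀ v, y v ≤ Δ)
    (hΔ3 : 3 ≤ Δ) {m : ℝ} (hm : m = ∑ v, (y v : ℝ)) (hmΔ : 9 * (Δ : ℝ) ^ 2 ≤ m) {p : ℝ}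
    (hp : p = y' v / m * (1 + 2 * lam y')) :
    Real.exp (-p - 260 * (Δ ^ 2 / m) * p) * countGraphs y' ⊥ (fun _ => True)
        ≤ y v * countGraphs y ⊥ (fun _ => True) ∧
      y v * countGraphs y ⊥ (fun _ => True)
        ≤ Real.exp (-p + 260 * (Δ ^ 2 / m) * p) * countGraphs y' ⊥ (fun _ => True) := by
  have hΔ3' : (3 : ℝ) ≤ Δ := by exact_mod_cast hΔ3
  have hm0 : 0 < m := by nlinarith
  have hm' : m = ∑ v, (y' v : ℝ) := by rw [hm, h.sum_eq]
  have hΔ' := h.le_bound hΔ hΔ3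
  have hv'Δ : (y' v : ℝ) ≤ Δ := by exact_mod_cast hΔ' v
  have hcrude := sum_countGraphs_cherry_le y' hΔ' hΔ3 hm' hmΔ h.ne h.one
  have hsharp := abs_sum_countGraphs_cherry_sub_le y' hΔ' hΔ3 hm' hmΔ h.ne h.one
  have hlam0 := lam_nonneg y'
  rw [h.mul_countGraphs]
  have hW0 : 0 ≤ countGraphs y' ⊥ (fun G => G.Adj v' v)
      + ∑ a, countGraphs y' ⊥ (fun G => G.Adj v' a ∧ G.Adj v a) :=
    add_nonneg (countGraphs_nonneg _ _ _) (Finset.sum_nonneg fun _ _ => countGraphs_nonneg _ _ _)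
  generalize countGraphs y' ⊥ (fun G => G.Adj v' v)
      + ∑ a, countGraphs y' ⊥ (fun G => G.Adj v' a ∧ G.Adj v a) = W at *
  have hN0 : 0 ≤ countGraphs y' ⊥ (fun _ => True) := countGraphs_nonneg _ _ _
  generalize countGraphs y' ⊥ (fun _ => True) = N at *
  have hk0 : (0 : ℝ) ≤ y' v := Nat.cast_nonneg _
  have hrest : y' v / m + y' v / m ^ 2 * ∑ a, (if a = v then 0 else (y' a : ℝ) * (y' a - 1))
      = p - (y' v / m) * (y' v * (y' v - 1) / m) := by
    have e : ∑ a, (if a = v then 0 else (y' a : ℝ) * (y' a - 1))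
        = ∑ a, (y' a : ℝ) * (y' a - 1) - y' v * (y' v - 1) := by
      have : ∀ a, (if a = v then 0 else (y' a : ℝ) * (y' a - 1))
          = (y' a : ℝ) * (y' a - 1) - (if a = v then (y' v : ℝ) * (y' v - 1) else 0) := by
        intro a
        by_cases ha : a = v
        · simp [ha]
        · simp [ha]
      simp only [this, Finset.sum_sub_distrib]
      simp
    rw [e, hp, lam, ← hm']
    field_simp
    ring
  rw [hrest] at hsharp
  generalize hk : (y' v : ℝ) = k at *
  set ε : ℝ := Δ ^ 2 / m with hε
  have hε0 : 0 ≤ ε := by positivity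
  have hε9 : ε ≤ 1 / 9 := by rw [hε, div_le_div_iff₀ hm0 (by norm_num)]; linarith
  have hkm0 : 0 ≤ k / m := by positivity
  have hkp : k / m ≤ p := by
    rw [hp]
    exact le_mul_of_one_le_right hkm0 (by linarith)
  have hp0 : 0 ≤ p := hkm0.trans hkp
  have hkε : k * (k - 1) / m ≤ ε := by
    rw [hε]
    gcongr
    nlinarith
  have hkk : 0 ≤ k * (k - 1) / m := by
    rw [← hk]
    refine div_nonneg ?_ hm0.le
    rcases Nat.eq_zero_or_pos (y' v) with h0 | h0
    · simp [h0]
    · exact mul_nonneg (Nat.cast_nonneg _) (sub_nonneg.mpr (by exact_mod_cast h0))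
  have hdiff : k / m * (k * (k - 1) / m) ≤ ε * p := by
    rw [mul_comm ε]
    gcongr
  have hdiff0 : 0 ≤ k / m * (k * (k - 1) / m) := by positivity
  generalize k / m * (k * (k - 1) / m) = r at *
  have hεp : 0 ≤ ε * p := by positivity
  have hsharp' : |W - p * N| ≤ 101 * (ε * p) * N := by
    rw [abs_le] at hsharp ⊢
    have h1 : r * N ≤ ε * p * N := by gcongr
    have h2 : 0 ≤ r * N := by positivity
    have h3 : 0 ≤ 100 * ε * (r * N) := by positivity
    constructor <;> nlinarith [hsharp.1, hsharp.2]
  rw [abs_le] at hsharp'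
  constructor
  · rcases hN0.eq_or_lt with hN | hN
    · rw [← hN] at hcrude ⊢
      linarith
    set w := W / N with hw
    have hWw : W = w * N := by rw [hw]; field_simp
    have hw1 : w ≤ 14 / 3 * ε := by rw [hw, div_le_iff₀ hN]; exact hcrude
    have hw2 : w ≤ p + 101 * (ε * p) := by rw [hw, div_le_iff₀ hN]; linarith [hsharp'.2]
    have hw0 : 0 ≤ w := div_nonneg hW0 hN.le
    have hw3 : w ≤ 37 / 3 * p := by nlinarith
    have hw4 : w ^ 2 ≤ 14 / 3 * ε * (37 / 3 * p) := by rw [sq]; gcongr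
    have hexp : Real.exp (-p - 260 * ε * p) ≤ 1 - w := by
      refine le_trans (Real.exp_le_exp.mpr ?_) (exp_neg_le_one_sub (by linarith))
      linarith
    calc _ ≤ (1 - w) * N := by gcongr
      _ = N - W := by rw [hWw]; ring
  · calc N - W ≤ (-p + 260 * ε * p + 1) * N := by
          have : 0 ≤ ε * p * N := by positivity
          linarith [hsharp'.1]
      _ ≤ _ := by gcongr; exact Real.add_one_le_exp _

end SplittingEstimate

section GraphEnumeration

variable {V : Type*} [Fintype V]

/-- The number of perfect matchings of `2 k` points. -/
noncomputable def matchingCount (k : ℕ) : ℝ := ((2 * k).factorial : ℝ) / (2 ^ k * k.factorial)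

lemma matchingCount_pos (k : ℕ) : 0 < matchingCount k := by unfold matchingCount; positivity

lemma matchingCount_succ (k : ℕ) : matchingCount (k + 1) = (2 * k + 1) * matchingCount k := by
  unfold matchingCount
  rw [show 2 * (k + 1) = 2 * k + 1 + 1 by ring, Nat.factorial_succ, Nat.factorial_succ,
    Nat.factorial_succ]
  push_cast
  field_simp
  ring

lemma countGraphs_of_le_one (k : ℕ) (y : V → ℕ) (hy : ∀ v, y v ≤ 1)
    (hsum : ∑ v, (y v : ℝ) = 2 * k) : countGraphs y ⊥ (fun _ => True) = matchingCount k := by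
  induction k generalizing y with
  | zero =>
    have hy0 : ∀ v, y v = 0 := by
      have : ∑ v, (y v : ℝ) = 0 := by simpa using hsum
      rw [Finset.sum_eq_zero_iff_of_nonneg (fun v _ => Nat.cast_nonneg _)] at this
      intro v
      exact_mod_cast this v (Finset.mem_univ v)
    have : countGraphs y ⊥ (fun _ => True) = (({⊥} : Finset (SimpleGraph V)).card : ℝ) := by
      unfold countGraphs
      congr 2
      ext G
      simp only [Finset.mem_filter, mem_graphsAvoiding, hy0, and_true, disjoint_bot_right,
        Finset.mem_singleton]
      constructor
      · intro h
        ext a b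
        simp only [SimpleGraph.bot_adj, iff_false]
        intro hab
        have : 0 < G.degree a := (G.degree_pos_iff_exists_adj a).mpr ⟨b, hab⟩
        rw [h a] at this
        exact lt_irrefl _ this
      · rintro rfl v
        rw [degree_bot_eq_zero]
    rw [this]
    simp [matchingCount]
  | succ k ih =>
    obtain ⟨v, hv⟩ : ∃ v, y v = 1 := by
      by_contra hcon
      push Not at hcon
      have : ∀ v, y v = 0 := fun v => by have := hy v; have := hcon v; omega
      simp only [this, Nat.cast_zero, Finset.sum_const_zero] at hsum
      have : (0 : ℝ) < 2 * ((k + 1 : ℕ) : ℝ) := by positivity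
      linarith
    have h1 := sum_countGraphs_adj y ⊥ (fun _ => True) v
    rw [hv, Nat.cast_one, one_mul] at h1
    rw [← h1]
    have key : ∀ a, countGraphs y ⊥ (fun G => True ∧ G.Adj v a)
        = ((y a : ℝ) - (if a = v then 1 else 0)) * matchingCount k := by
      intro a
      simp only [true_and]
      by_cases hav : a = v
      · rw [hav, countGraphs_adj_self, if_pos rfl, hv]
        simp
      by_cases hya : y a = 0
      · rw [countGraphs_adj_eq_zero (i := v) (j := a) hya fun _ h => h]
        simp [hav, hya]
      have hya1 : y a = 1 := by have := hy a; omega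
      have hz : ∀ u, y u = (if u = v ∨ u = a then 0 else y u) +
          ((if u = v then 1 else 0) + (if u = a then 1 else 0)) := by
        intro u
        by_cases h1 : u = v
        · subst h1; simp [hv, Ne.symm hav]
        · by_cases h2 : u = a
          · subst h2; simp [hya1, hav]
          · simp [h1, h2]
      have e := countGraphs_extract_edge (X := ⊥) (Ne.symm hav) (by simp) hz (fun _ => True)
      simp only [and_true, bot_sup_eq] at e
      rw [e, hya1, if_neg hav]
      have e2 : countGraphs (fun u => if u = v ∨ u = a then 0 else y u) (SimpleGraph.edge v a)
          (fun _ => True)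
          = countGraphs (fun u => if u = v ∨ u = a then 0 else y u) ⊥ (fun _ => True) := by
        unfold countGraphs
        congr 2
        ext G
        simp only [Finset.mem_filter, mem_graphsAvoiding, disjoint_edge_iff (Ne.symm hav), disjoint_bot_right,
          and_true, and_iff_left_iff_imp]
        intro h h'
        have h4 : 0 < G.degree v := (G.degree_pos_iff_exists_adj v).mpr ⟨a, h'⟩
        have h5 := h v
        rw [if_pos (Or.inl rfl)] at h5
        omega
      rw [e2, ih]
      · simp
      · intro u
        split_ifs
        · omega
        · exact hy u
      · have e3 : ∑ u, (y u : ℝ) = ∑ u, (((if u = v ∨ u = a then 0 else y u : ℕ) : ℝ) +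
            ((if u = v then 1 else 0) + (if u = a then 1 else 0))) := by
          refine Finset.sum_congr rfl fun u _ => ?_
          have := hz u
          exact_mod_cast this
        rw [hsum] at e3
        simp only [Finset.sum_add_distrib, Finset.sum_ite_eq', Finset.mem_univ, if_true] at e3
        push_cast at e3 ⊢
        linarith
    simp only [key]
    rw [← Finset.sum_mul, Finset.sum_sub_distrib, hsum, matchingCount_succ]
    simp only [Finset.sum_ite_eq', Finset.mem_univ, if_true]
    push_cast
    ring

lemma IsSplit.prod_factorial {y y' : V → ℕ} {v v' : V} (h : IsSplit y y' v v') :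
    ∏ u, ((y u).factorial : ℝ) = y v * ∏ u, ((y' u).factorial : ℝ) := by
  have key : ∀ u, ((y u).factorial : ℝ) = (if u = v then (y v : ℝ) else 1) * (y' u).factorial := by
    intro u
    by_cases h1 : u = v
    · subst h1
      rw [if_pos rfl, h.succ, Nat.factorial_succ]
      push_cast
      ring
    · by_cases h2 : u = v'
      · rw [h2, h.zero, h.one, if_neg h.ne.symm]; simp
      · rw [h.other u h1 h2, if_neg h1, one_mul]
  simp only [key, Finset.prod_mul_distrib]
  simp

lemma exists_isSplit {V : Type*} {y : V → ℕ} {v v' : V} (hv : 2 ≤ y v) (hv' : y v' = 0) :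
    ∃ y', IsSplit y y' v v' := by
  have hne : v ≠ v' := by rintro rfl; omega
  refine ⟨fun u => if u = v then y v - 1 else if u = v' then 1 else y u, hne, hv', ?_, ?_, ?_⟩
  · simp [hne.symm]
  · simp only [if_true]; omega
  · intro u h1 h2
    simp [h1, h2]

lemma countGraphs_bot_bounds_of_room {Δ : ℕ} (hΔ3 : 3 ≤ Δ) {k : ℕ}
    (hmΔ : 9 * (Δ : ℝ) ^ 2 ≤ 2 * k) (e : ℕ) (y : V → ℕ) (hΔ : ∀ v, y v ≤ Δ)
    (hsum : ∑ v, (y v : ℝ) = 2 * k) (he : ∑ v, ((y v - 1 : ℕ) : ℝ) = e)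
    (hroom : (e : ℝ) ≤ ∑ v, ind (y v = 0)) :
    Real.exp (-(1 + 261 * (Δ ^ 2 / (2 * k))) * (lam y + lam y ^ 2)) * matchingCount k
        ≤ countGraphs y ⊥ (fun _ => True) * ∏ v, ((y v).factorial : ℝ) ∧
      countGraphs y ⊥ (fun _ => True) * ∏ v, ((y v).factorial : ℝ)
        ≤ Real.exp (-(1 - 261 * (Δ ^ 2 / (2 * k))) * (lam y + lam y ^ 2)) * matchingCount k := by
  have hΔ3' : (3 : ℝ) ≤ Δ := by exact_mod_cast hΔ3
  have hm0 : (0 : ℝ) < 2 * k := by nlinarith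
  induction e generalizing y with
  | zero =>
    have hy1 : ∀ v, y v ≤ 1 := by
      rw [Nat.cast_zero, Finset.sum_eq_zero_iff_of_nonneg (fun v _ => Nat.cast_nonneg _)] at he
      intro v
      have : y v - 1 = 0 := by exact_mod_cast he v (Finset.mem_univ v)
      omega
    have hlam : lam y = 0 := by
      unfold lam
      rw [Finset.sum_eq_zero, zero_div]
      intro v _
      have := hy1 v
      interval_cases y v <;> simp
    have hfact : ∏ v, ((y v).factorial : ℝ) = 1 := by
      refine Finset.prod_eq_one fun v _ => ?_
      have := hy1 v
      interval_cases y v <;> simp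
    rw [countGraphs_of_le_one k y hy1 hsum, hlam, hfact]
    simp
  | succ e ih =>
    obtain ⟨v, hv⟩ : ∃ v, 2 ≤ y v := by
      by_contra hcon
      push Not at hcon
      have : ∀ v, y v - 1 = 0 := fun v => by have := hcon v; omega
      simp only [this, Nat.cast_zero, Finset.sum_const_zero] at he
      have : (0 : ℝ) < ((e + 1 : ℕ) : ℝ) := by positivity
      linarith
    obtain ⟨v', hv'⟩ : ∃ v', y v' = 0 := by
      by_contra hcon
      push Not at hcon
      have : ∀ v, ind (y v = 0) = 0 := fun v => ind_of_false (hcon v)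
      simp only [this, Finset.sum_const_zero] at hroom
      have : (0 : ℝ) < ((e + 1 : ℕ) : ℝ) := by positivity
      linarith
    obtain ⟨y', h⟩ := exists_isSplit hv hv'
    have hsucc := h.succ
    have hy'v : 1 ≤ y' v := by omega
    have he' : ∑ v, ((y' v - 1 : ℕ) : ℝ) = e := by
      have h1 := h.sum_add (f := fun k => ((k - 1 : ℕ) : ℝ))
      rw [he, h.one, h.zero, h.succ] at h1
      simp only [Nat.add_sub_cancel, Nat.zero_sub, Nat.sub_self, Nat.cast_zero] at h1
      push_cast [hy'v] at h1
      linarith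
    have hroom' : (e : ℝ) ≤ ∑ v, ind (y' v = 0) := by
      have h1 := h.sum_add (f := fun k => ind (k = 0))
      rw [h.one, h.zero, ind_of_false (p := y' v = 0) (by omega), ind_of_false (by omega),
        ind_of_false (p := y v = 0) (by omega), ind_of_true rfl] at h1
      push_cast at hroom
      linarith
    have ih' := ih y' (h.le_bound hΔ hΔ3) (by rw [← h.sum_eq, hsum]) he' hroom'
    have hstep := h.countGraphs_bounds hΔ hΔ3 hsum.symm hmΔ rfl
    have hlam := h.lam_eq (by rw [hsum]; exact hm0)
    rw [hsum] at hlam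
    have hlam0 := lam_nonneg y'
    have hP0 : 0 ≤ ∏ u, ((y' u).factorial : ℝ) := by positivity
    have hvΔ : (y' v : ℝ) ≤ Δ := by exact_mod_cast h.le_bound hΔ hΔ3 v
    rw [h.prod_factorial]
    set m : ℝ := 2 * k with hm
    set ε : ℝ := Δ ^ 2 / m with hε
    have hε0 : 0 ≤ ε := by positivity
    set q := (y' v : ℝ) / m with hq
    have hq0 : 0 ≤ q := by positivity
    have hqε : q ≤ ε := by
      rw [hq, hε]
      gcongr
      nlinarith
    set p := q * (1 + 2 * lam y') with hp
    have hqp : q ≤ p := le_mul_of_one_le_right hq0 (by linarith)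
    have hqq : q ^ 2 ≤ ε * p := by rw [sq]; gcongr
    have hF : lam y + lam y ^ 2 = lam y' + lam y' ^ 2 + (p + q ^ 2) := by rw [hlam, hp]; ring
    have hεp : 0 ≤ ε * p := mul_nonneg hε0 (hq0.trans hqp)
    have hεq : 0 ≤ ε * q ^ 2 := by positivity
    rw [hF]
    simp only [mul_add (-_ : ℝ) (lam y' + lam y' ^ 2)]
    rw [Real.exp_add, Real.exp_add]
    have hN0 : 0 ≤ countGraphs y' ⊥ (fun _ => True) := countGraphs_nonneg _ _ _
    have eq : countGraphs y ⊥ (fun _ => True) * (y v * ∏ u, ((y' u).factorial : ℝ))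
        = (y v * countGraphs y ⊥ (fun _ => True)) * ∏ u, ((y' u).factorial : ℝ) := by ring
    rw [eq]
    constructor
    · calc _ = Real.exp (-(1 + 261 * ε) * (p + q ^ 2)) *
            (Real.exp (-(1 + 261 * ε) * (lam y' + lam y' ^ 2)) * matchingCount k) := by ring
        _ ≤ Real.exp (-p - 260 * ε * p) * (countGraphs y' ⊥ (fun _ => True)
            * ∏ u, ((y' u).factorial : ℝ)) := by
          refine mul_le_mul (Real.exp_le_exp.mpr ?_) ih'.1 ?_ (Real.exp_pos _).le
          · nlinarith
          · exact mul_nonneg (Real.exp_pos _).le (matchingCount_pos k).le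
        _ = (Real.exp (-p - 260 * ε * p) * countGraphs y' ⊥ (fun _ => True))
            * ∏ u, ((y' u).factorial : ℝ) := by ring
        _ ≤ _ := mul_le_mul_of_nonneg_right hstep.1 hP0
    · calc _ ≤ (Real.exp (-p + 260 * ε * p) * countGraphs y' ⊥ (fun _ => True))
            * ∏ u, ((y' u).factorial : ℝ) := mul_le_mul_of_nonneg_right hstep.2 hP0
        _ = Real.exp (-p + 260 * ε * p) * (countGraphs y' ⊥ (fun _ => True)
            * ∏ u, ((y' u).factorial : ℝ)) := by ring
        _ ≤ Real.exp (-(1 - 261 * ε) * (p + q ^ 2)) *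
            (Real.exp (-(1 - 261 * ε) * (lam y' + lam y' ^ 2)) * matchingCount k) := by
          refine mul_le_mul (Real.exp_le_exp.mpr ?_) ih'.2 (mul_nonneg hN0 hP0) (Real.exp_pos _).le
          nlinarith
        _ = _ := by ring

end GraphEnumeration

section Padding

variable {V W : Type*} [Fintype V] [Fintype W]

lemma countGraphs_sumElim_zero (y : V → ℕ) :
    countGraphs (Sum.elim y (fun _ : W => 0)) ⊥ (fun _ => True)
      = countGraphs y ⊥ (fun _ => True) := by
  unfold countGraphs
  congr 1
  refine Finset.card_nbij' (fun G => G.comap Sum.inl)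
    (fun G => G.map (Function.Embedding.inl : V ↪ V ⊕ W)) ?_ ?_ ?_ ?_
  · intro G hG
    simp only [Finset.coe_filter, Set.mem_ofPred_eq, and_true, mem_graphsAvoiding,
      disjoint_bot_right] at hG ⊢
    intro v
    have h := hG (Sum.inl v)
    have hz : ∀ w : W, ¬ G.Adj (Sum.inl v) (Sum.inr w) := by
      intro w hw
      have h1 : 0 < G.degree (Sum.inr w) :=
        (G.degree_pos_iff_exists_adj _).mpr ⟨Sum.inl v, hw.symm⟩
      rw [hG (Sum.inr w)] at h1
      simp at h1
    have h2 := sum_adj_eq_degree G (Sum.inl v)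
    rw [h, Fintype.sum_sum_type] at h2
    have h3 := sum_adj_eq_degree (G.comap Sum.inl) v
    simp only [hz, ind_of_false not_false, Finset.sum_const_zero, add_zero, Sum.elim_inl] at h2
    simp only [SimpleGraph.comap_adj] at h3
    rw [h2] at h3
    exact_mod_cast h3.symm
  · intro G hG
    simp only [Finset.coe_filter, Set.mem_ofPred_eq, and_true, mem_graphsAvoiding,
      disjoint_bot_right] at hG ⊢
    have hr : ∀ (a : V ⊕ W) (w : W),
        ¬ (G.map (Function.Embedding.inl : V ↪ V ⊕ W)).Adj (Sum.inr w) a := by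
      intro a w h
      rw [SimpleGraph.map_adj] at h
      obtain ⟨u, u', -, hu, -⟩ := h
      simp at hu
    have hl : ∀ (a b : V), (G.map (Function.Embedding.inl : V ↪ V ⊕ W)).Adj (Sum.inl a) (Sum.inl b)
        ↔ G.Adj a b := fun a b => SimpleGraph.map_adj_apply (f := Function.Embedding.inl)
    rintro (v | w)
    · have h2 := sum_adj_eq_degree (G.map (Function.Embedding.inl : V ↪ V ⊕ W)) (Sum.inl v)
      have hz : ∀ w : W, ¬ (G.map (Function.Embedding.inl : V ↪ V ⊕ W)).Adj (Sum.inl v)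
        (Sum.inr w) := fun w h => hr _ _ h.symm
      rw [Fintype.sum_sum_type] at h2
      simp only [hz, hl, ind_of_false not_false, Finset.sum_const_zero, add_zero,
        sum_adj_eq_degree, hG v] at h2
      simp only [Sum.elim_inl]
      exact_mod_cast h2.symm
    · have h2 := sum_adj_eq_degree (G.map (Function.Embedding.inl : V ↪ V ⊕ W)) (Sum.inr w)
      simp only [hr, ind_of_false not_false, Finset.sum_const_zero] at h2
      simp only [Sum.elim_inr]
      exact_mod_cast h2.symm
  · intro G hG
    simp only [Finset.coe_filter, Set.mem_ofPred_eq, and_true, mem_graphsAvoiding,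
      disjoint_bot_right] at hG
    have hz : ∀ (a : V ⊕ W) (w : W), ¬ G.Adj a (Sum.inr w) := by
      intro a w hw
      have h1 : 0 < G.degree (Sum.inr w) :=
        (G.degree_pos_iff_exists_adj _).mpr ⟨a, hw.symm⟩
      rw [hG (Sum.inr w)] at h1
      simp at h1
    ext a b
    simp only [SimpleGraph.map_adj, SimpleGraph.comap_adj]
    constructor
    · rintro ⟨u, u', h, rfl, rfl⟩
      exact h
    · intro h
      rcases a with a | a
      · rcases b with b | b
        · exact ⟨a, b, h, rfl, rfl⟩
        · exact (hz _ _ h).elim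
      · exact (hz _ _ h.symm).elim
  · intro G _
    exact SimpleGraph.comap_map_eq Function.Embedding.inl G

theorem countGraphs_bot_bounds {Δ : ℕ} (hΔ3 : 3 ≤ Δ) {k : ℕ}
    (hmΔ : 9 * (Δ : ℝ) ^ 2 ≤ 2 * k) (y : V → ℕ) (hΔ : ∀ v, y v ≤ Δ)
    (hsum : ∑ v, (y v : ℝ) = 2 * k) :
    Real.exp (-(1 + 261 * (Δ ^ 2 / (2 * k))) * (lam y + lam y ^ 2)) * matchingCount k
        ≤ countGraphs y ⊥ (fun _ => True) * ∏ v, ((y v).factorial : ℝ) ∧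
      countGraphs y ⊥ (fun _ => True) * ∏ v, ((y v).factorial : ℝ)
        ≤ Real.exp (-(1 - 261 * (Δ ^ 2 / (2 * k))) * (lam y + lam y ^ 2)) * matchingCount k := by
  have h := countGraphs_bot_bounds_of_room hΔ3 hmΔ (∑ v, (y v - 1))
    (Sum.elim y (fun _ : Fin (∑ v, (y v - 1)) => 0)) ?_ ?_ ?_ ?_
  · have hl : lam (Sum.elim y (fun _ : Fin (∑ v, (y v - 1)) => 0)) = lam y := by
      simp [lam, Fintype.sum_sum_type]
    rw [hl, countGraphs_sumElim_zero, Fintype.prod_sum_type] at h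
    simpa only [Sum.elim_inl, Sum.elim_inr, Nat.factorial_zero, Nat.cast_one,
      Finset.prod_const_one, mul_one] using h
  · rintro (v | v)
    · exact hΔ v
    · exact Nat.zero_le _
  · simpa [Fintype.sum_sum_type] using hsum
  · simp [Fintype.sum_sum_type]
  · rw [Fintype.sum_sum_type]
    simp only [Sum.elim_inr, ind_of_true trivial]
    have : 0 ≤ ∑ v, ind (y v = 0) := Finset.sum_nonneg fun v _ => ind_nonneg _
    simp only [Sum.elim_inl, Finset.sum_const, Finset.card_univ, Fintype.card_fin, nsmul_eq_mul,
      mul_one]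
    linarith

end Padding

section LeafRemoval

variable {V : Type*} [Fintype V]

lemma sum_eq_add_sum_compl_singleton {M : Type*} [AddCommMonoid M] (l : V) (f : V → M) :
    ∑ v, f v = f l + ∑ v : ↥({l}ᶜ : Set V), f v := by
  rw [Fintype.sum_eq_add_sum_compl l f]
  congr 1
  exact Finset.sum_subtype _ (by simp) f

/-- The trees with degree sequence `x`. -/
noncomputable def treesOf (x : V → ℕ) : Finset (SimpleGraph V) :=
  Finset.univ.filter fun T => T.IsTree ∧ ∀ v, T.degree v = x v

lemma mem_treesOf {x : V → ℕ} {T : SimpleGraph V} :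
    T ∈ treesOf x ↔ T.IsTree ∧ ∀ v, T.degree v = x v := by
  simp [treesOf]

/-- The graph obtained from a graph on the complement of `l` by joining `l` to `j`. -/
def attachLeaf {V : Type*} (l : V) (j : ↥({l}ᶜ : Set V)) (T : SimpleGraph ↥({l}ᶜ : Set V)) :
    SimpleGraph V :=
  T.map (Function.Embedding.subtype _) ⊔ SimpleGraph.edge l j

lemma attachLeaf_adj_coe {V : Type*} {l : V} {j : ↥({l}ᶜ : Set V)}
    {T : SimpleGraph ↥({l}ᶜ : Set V)} (a b : ↥({l}ᶜ : Set V)) :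
    (attachLeaf l j T).Adj a b ↔ T.Adj a b := by
  have ha : (a : V) ≠ l := a.2
  have hb : (b : V) ≠ l := b.2
  have h : (T.map (Function.Embedding.subtype _)).Adj (a : V) b ↔ T.Adj a b :=
    SimpleGraph.map_adj_apply (f := Function.Embedding.subtype _)
  rw [attachLeaf, SimpleGraph.sup_adj, h, SimpleGraph.edge_adj]
  constructor
  · rintro (h | ⟨⟨h, -⟩ | ⟨-, h⟩, -⟩)
    · exact h
    · exact (ha h).elim
    · exact (hb h).elim
  · exact Or.inl

lemma attachLeaf_adj_leaf {V : Type*} {l : V} {j : ↥({l}ᶜ : Set V)}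
    {T : SimpleGraph ↥({l}ᶜ : Set V)} (v : V) :
    (attachLeaf l j T).Adj l v ↔ v = j := by
  have hj : (j : V) ≠ l := j.2
  have h : ¬ (T.map (Function.Embedding.subtype _)).Adj l v := by
    rw [SimpleGraph.map_adj]
    rintro ⟨u, u', -, hu, -⟩
    exact u.2 hu
  rw [attachLeaf, SimpleGraph.sup_adj, SimpleGraph.edge_adj]
  constructor
  · rintro (h' | ⟨⟨-, h'⟩ | ⟨h', -⟩, -⟩)
    · exact (h h').elim
    · exact h'
    · exact (hj h'.symm).elim
  · rintro rfl
    exact Or.inr ⟨Or.inl ⟨rfl, rfl⟩, hj.symm⟩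

lemma attachLeaf_induce {V : Type*} {l : V} {j : ↥({l}ᶜ : Set V)}
    (T : SimpleGraph ↥({l}ᶜ : Set V)) :
    (attachLeaf l j T).induce {l}ᶜ = T := by
  ext a b
  exact attachLeaf_adj_coe a b

lemma degree_attachLeaf_leaf {l : V} {j : ↥({l}ᶜ : Set V)} (T : SimpleGraph ↥({l}ᶜ : Set V)) :
    (attachLeaf l j T).degree l = 1 := by
  have h := sum_adj_eq_degree (attachLeaf l j T) l
  simp only [attachLeaf_adj_leaf, ind, Finset.sum_ite_eq', Finset.mem_univ, if_true] at h
  exact_mod_cast h.symm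

lemma degree_attachLeaf_coe {l : V} {j : ↥({l}ᶜ : Set V)} (T : SimpleGraph ↥({l}ᶜ : Set V))
    (v : ↥({l}ᶜ : Set V)) :
    (attachLeaf l j T).degree v = T.degree v + if v = j then 1 else 0 := by
  have h := sum_adj_eq_degree (attachLeaf l j T) v
  rw [sum_eq_add_sum_compl_singleton l] at h
  simp only [attachLeaf_adj_coe, sum_adj_eq_degree, (attachLeaf l j T).adj_comm (v : V) l,
    attachLeaf_adj_leaf, Subtype.coe_inj] at h
  rw [add_comm, ind] at h
  exact_mod_cast h.symm

lemma sum_degree_eq_of_isTree {T : SimpleGraph V} (hT : T.IsTree) :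
    ∑ v, T.degree v + 2 = 2 * Fintype.card V := by
  have h1 := hT.card_edgeFinset
  have h2 := T.sum_degrees_eq_twice_card_edges
  omega

lemma isTree_attachLeaf {l : V} {j : ↥({l}ᶜ : Set V)} {T : SimpleGraph ↥({l}ᶜ : Set V)}
    (hT : T.IsTree) : (attachLeaf l j T).IsTree := by
  rw [SimpleGraph.isTree_iff_connected_and_card]
  constructor
  · have hr : ∀ v, (attachLeaf l j T).Reachable v j := by
      intro v
      by_cases hv : v = l
      · subst hv
        exact (attachLeaf_adj_leaf _ |>.mpr rfl : (attachLeaf v j T).Adj v j).reachable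
      · have h := hT.connected.preconnected ⟨v, hv⟩ j
        let f : T →g attachLeaf l j T := ⟨Subtype.val, fun {a b} h => (attachLeaf_adj_coe a b).mpr h⟩
        exact h.map f
    have : Nonempty V := ⟨l⟩
    exact ⟨fun a b => (hr a).trans (hr b).symm⟩
  · have h1 := sum_degree_eq_of_isTree hT
    have h2 := (attachLeaf l j T).sum_degrees_eq_twice_card_edges
    rw [sum_eq_add_sum_compl_singleton l, degree_attachLeaf_leaf] at h2
    simp only [degree_attachLeaf_coe, Finset.sum_add_distrib, Finset.sum_ite_eq', Finset.mem_univ,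
      if_true] at h2
    have h3 : Fintype.card V = Fintype.card ↥({l}ᶜ : Set V) + 1 := by
      have := sum_eq_add_sum_compl_singleton l (fun _ => 1)
      simp only [Finset.sum_const, Finset.card_univ, smul_eq_mul, mul_one] at this
      omega
    rw [Nat.card_eq_fintype_card, Nat.card_eq_fintype_card, ← SimpleGraph.edgeFinset_card]
    omega

lemma attachLeaf_induce_of_adj {G : SimpleGraph V} {l : V} {j : ↥({l}ᶜ : Set V)}
    (hdeg : G.degree l = 1) (hadj : G.Adj l j) :
    attachLeaf l j (G.induce {l}ᶜ) = G := by
  obtain ⟨u, hu, huniq⟩ := SimpleGraph.degree_eq_one_iff_existsUnique_adj.mp hdeg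
  have hl : ∀ v, G.Adj l v ↔ v = j := by
    intro v
    constructor
    · intro h
      rw [huniq v h, huniq _ hadj]
    · rintro rfl
      exact hadj
  ext a b
  by_cases ha : a = l
  · subst ha
    rw [attachLeaf_adj_leaf, hl]
  by_cases hb : b = l
  · subst hb
    rw [SimpleGraph.adj_comm, attachLeaf_adj_leaf, SimpleGraph.adj_comm, hl]
  exact attachLeaf_adj_coe (T := G.induce {l}ᶜ) ⟨a, ha⟩ ⟨b, hb⟩

/-- Removing the leaf `l` from the trees with degree sequence `x`. -/
theorem sum_treesOf_eq (x : V → ℕ) (l : V) (hl : x l = 1) (F : SimpleGraph V → ℝ) :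
    ∑ T ∈ treesOf x, F T = ∑ j : ↥({l}ᶜ : Set V),
      ∑ T ∈ Finset.univ.filter (fun T : SimpleGraph ↥({l}ᶜ : Set V) =>
        T.IsTree ∧ ∀ v, T.degree v + (if v = j then 1 else 0) = x v), F (attachLeaf l j T) := by
  have h1 : ∑ T ∈ treesOf x, F T
      = ∑ T ∈ treesOf x, ∑ j : ↥({l}ᶜ : Set V), ind (T.Adj l j) * F T := by
    refine Finset.sum_congr rfl fun T hT => ?_
    have h2 := sum_adj_eq_degree T l
    rw [(mem_treesOf.mp hT).2 l, hl, sum_eq_add_sum_compl_singleton l,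
      ind_of_false (T.loopless.irrefl l), zero_add, Nat.cast_one] at h2
    rw [← Finset.sum_mul, h2, one_mul]
  rw [h1, Finset.sum_comm]
  refine Finset.sum_congr rfl fun j _ => ?_
  have h3 : ∑ T ∈ treesOf x, ind (T.Adj l j) * F T
      = ∑ T ∈ (treesOf x).filter (fun T => T.Adj l j), F T := by
    rw [Finset.sum_filter]
    refine Finset.sum_congr rfl fun T _ => ?_
    simp only [ind, ite_mul, one_mul, zero_mul]
  rw [h3]
  refine Finset.sum_nbij' (fun T => T.induce {l}ᶜ) (fun T => attachLeaf l j T) ?_ ?_ ?_ ?_ ?_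
  · intro T hT
    simp only [Finset.mem_filter, mem_treesOf] at hT
    obtain ⟨⟨hT, hd⟩, hadj⟩ := hT
    have hdl : T.degree l = 1 := by rw [hd, hl]
    simp only [Finset.mem_filter, Finset.mem_univ, true_and]
    refine ⟨⟨hT.connected.induce_compl_singleton_of_degree_eq_one hdl,
      hT.isAcyclic.induce _⟩, fun v => ?_⟩
    have h4 := degree_attachLeaf_coe (j := j) (T.induce {l}ᶜ) v
    rw [← hd v, ← h4]
    rw [attachLeaf_induce_of_adj hdl hadj]
  · intro T hT
    simp only [Finset.mem_filter, Finset.mem_univ, true_and] at hT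
    simp only [Finset.mem_filter, mem_treesOf]
    refine ⟨⟨isTree_attachLeaf hT.1, fun v => ?_⟩, (attachLeaf_adj_leaf _).mpr rfl⟩
    by_cases hv : v = l
    · subst hv
      rw [degree_attachLeaf_leaf, hl]
    · rw [← hT.2 ⟨v, hv⟩]
      exact degree_attachLeaf_coe T ⟨v, hv⟩
  · intro T hT
    simp only [Finset.mem_filter, mem_treesOf] at hT
    exact attachLeaf_induce_of_adj (by rw [hT.1.2, hl]) hT.2
  · intro T _
    exact attachLeaf_induce T
  · intro T hT
    simp only [Finset.mem_filter, mem_treesOf] at hT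
    rw [attachLeaf_induce_of_adj (by rw [hT.1.2, hl]) hT.2]

end LeafRemoval

section TreeRecursion

variable {V : Type*} [Fintype V]

lemma card_compl_singleton (l : V) :
    Fintype.card V = Fintype.card ↥({l}ᶜ : Set V) + 1 := by
  have := sum_eq_add_sum_compl_singleton l (fun _ => 1)
  simp only [Finset.sum_const, Finset.card_univ, smul_eq_mul, mul_one] at this
  omega

/-- The excess degrees `z` restricted to the complement of a leaf `l` attached to `j`. -/
noncomputable def removeLeaf {V : Type*} (z : V → ℕ) (l : V) (j : ↥({l}ᶜ : Set V)) : ↥({l}ᶜ : Set V) → ℕ :=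
  fun v => z v - if v = j then 1 else 0

lemma removeLeaf_cast {V : Type*} {z : V → ℕ} {l : V} {j : ↥({l}ᶜ : Set V)} (hj : z j ≠ 0)
    (v : ↥({l}ᶜ : Set V)) :
    (removeLeaf z l j v : ℝ) = z v - if v = j then 1 else 0 := by
  unfold removeLeaf
  split_ifs with h
  · subst h
    rw [Nat.cast_sub (Nat.one_le_iff_ne_zero.mpr hj), Nat.cast_one]
  · simp

lemma sum_removeLeaf {z : V → ℕ} {l : V} {j : ↥({l}ᶜ : Set V)} (hl : z l = 0) (hj : z j ≠ 0) :
    ∑ v, removeLeaf z l j v + 1 = ∑ v, z v := by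
  have h : (∑ v, (removeLeaf z l j v : ℝ)) + 1 = ∑ v, (z v : ℝ) := by
    simp only [removeLeaf_cast hj, Finset.sum_sub_distrib, Finset.sum_ite_eq', Finset.mem_univ,
      if_true]
    rw [sum_eq_add_sum_compl_singleton l, hl]
    simp
  exact_mod_cast h

lemma exists_zero_of_sum_add_two {z : V → ℕ} (hz : ∑ v, z v + 2 = Fintype.card V) :
    ∃ l, z l = 0 := by
  by_contra h
  push Not at h
  have : ∑ _v : V, 1 ≤ ∑ v, z v := Finset.sum_le_sum fun v _ => Nat.one_le_iff_ne_zero.mpr (h v)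
  simp only [Finset.sum_const, Finset.card_univ, smul_eq_mul, mul_one] at this
  omega

lemma sum_treesOf_succ (z : V → ℕ) (l : V) (hl : z l = 0) (hV : 3 ≤ Fintype.card V)
    (F : SimpleGraph V → ℝ) :
    ∑ T ∈ treesOf (fun v => z v + 1), F T = ∑ j : ↥({l}ᶜ : Set V), if z j = 0 then 0 else
      ∑ T ∈ treesOf (fun v => removeLeaf z l j v + 1), F (attachLeaf l j T) := by
  rw [sum_treesOf_eq _ l (by simp [hl])]
  refine Finset.sum_congr rfl fun j _ => ?_
  have hU : 2 ≤ Fintype.card ↥({l}ᶜ : Set V) := by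
    have := card_compl_singleton l
    omega
  split_ifs with hj
  · refine Finset.sum_eq_zero fun T hT => ?_
    simp only [Finset.mem_filter, Finset.mem_univ, true_and] at hT
    have hnt : Nontrivial ↥({l}ᶜ : Set V) := Fintype.one_lt_card_iff_nontrivial.mp hU
    have h1 := hT.1.connected.preconnected.degree_pos_of_nontrivial j
    have h2 := hT.2 j
    rw [if_pos rfl, hj] at h2
    omega
  · refine Finset.sum_congr ?_ fun _ _ => rfl
    ext T
    simp only [Finset.mem_filter, Finset.mem_univ, true_and, mem_treesOf]
    refine and_congr_right fun _ => forall_congr' fun v => ?_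
    unfold removeLeaf
    split_ifs with h
    · subst h
      omega
    · omega

lemma sum_treesOf_one (hV : Fintype.card V = 2) (F : SimpleGraph V → ℝ) :
    ∃ T : SimpleGraph V, (∀ a b, T.Adj a b ↔ a ≠ b) ∧
      ∑ T ∈ treesOf (fun _ : V => 0 + 1), F T = F T := by
  refine ⟨⊤, fun a b => by simp, ?_⟩
  have h : treesOf (fun _ : V => 0 + 1) = {⊤} := by
    ext T
    rw [mem_treesOf, Finset.mem_singleton]
    constructor
    · rintro ⟨-, hd⟩
      refine eq_top_iff.mpr fun a b hab => ?_
      rw [SimpleGraph.top_adj] at hab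
      have h1 : 0 < T.degree a := by rw [hd a]; norm_num
      obtain ⟨c, hc⟩ := (T.degree_pos_iff_exists_adj a).mp h1
      by_cases hcb : c = b
      · rwa [← hcb]
      have h3 : ({a, b, c} : Finset V).card = 3 :=
        Finset.card_eq_three.mpr ⟨a, b, c, hab, hc.ne, Ne.symm hcb, rfl⟩
      have := Finset.card_le_univ ({a, b, c} : Finset V)
      omega
    · rintro rfl
      have : Nonempty V := Fintype.card_pos_iff.mp (by omega)
      refine ⟨⟨SimpleGraph.connected_top, .of_card_le_two ?_⟩, fun v => ?_⟩
      · rw [ENat.card_eq_coe_fintype_card, hV]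
        rfl
      · have h1 := SimpleGraph.complete_graph_degree v
        rw [hV] at h1
        convert h1
  rw [h, Finset.sum_singleton]

end TreeRecursion

section TreeWeight

universe u

variable {V : Type u} [Fintype V]

/-- The sum of `y i * y j` over the edges of `T`. -/
noncomputable def edgeSum (y : V → ℝ) (T : SimpleGraph V) : ℝ :=
  (∑ a, ∑ b, ind (T.Adj a b) * (y a * y b)) / 2

lemma edgeSum_attachLeaf (y : V → ℝ) {l : V} {j : ↥({l}ᶜ : Set V)}
    (T : SimpleGraph ↥({l}ᶜ : Set V)) :
    edgeSum y (attachLeaf l j T) = y l * y j + edgeSum (fun v : ↥({l}ᶜ : Set V) => y v) T := by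
  unfold edgeSum
  rw [sum_eq_add_sum_compl_singleton l]
  have h1 : ∑ b, ind ((attachLeaf l j T).Adj l b) * (y l * y b) = y l * y j := by
    simp only [attachLeaf_adj_leaf, ind, ite_mul, one_mul, zero_mul, Finset.sum_ite_eq',
      Finset.mem_univ, if_true]
  have h2 : ∀ a : ↥({l}ᶜ : Set V), ∑ b, ind ((attachLeaf l j T).Adj a b) * (y a * y b)
      = (if a = j then y a * y l else 0) +
        ∑ b : ↥({l}ᶜ : Set V), ind (T.Adj a b) * (y a * y b) := by
    intro a
    rw [sum_eq_add_sum_compl_singleton l]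
    simp only [attachLeaf_adj_coe, (attachLeaf l j T).adj_comm (a : V) l, attachLeaf_adj_leaf,
      Subtype.coe_inj]
    congr 1
    simp only [ind, ite_mul, one_mul, zero_mul]
  rw [h1]
  simp only [h2, Finset.sum_add_distrib, Finset.sum_ite_eq', Finset.mem_univ, if_true]
  ring

lemma edgeSum_of_adj_iff_ne (y : V → ℝ) {T : SimpleGraph V} (hT : ∀ a b, T.Adj a b ↔ a ≠ b) :
    edgeSum y T = ((∑ v, y v) ^ 2 - ∑ v, y v ^ 2) / 2 := by
  unfold edgeSum
  congr 1
  have h : ∀ a, ∑ b, ind (T.Adj a b) * (y a * y b) = y a * ∑ b, y b - y a ^ 2 := by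
    intro a
    have h1 : ∀ b, ind (T.Adj a b) * (y a * y b) = y a * y b - if a = b then y a * y b else 0 := by
      intro b
      by_cases hab : a = b
      · rw [ind_of_false (by simp [hab]), if_pos hab]
        ring
      · rw [ind_of_true (by simp [hT, hab]), if_neg hab]
        ring
    simp only [h1, Finset.sum_sub_distrib, Finset.sum_ite_eq, Finset.mem_univ, if_true,
      Finset.mul_sum]
    ring
  simp only [h, Finset.sum_sub_distrib, ← Finset.sum_mul]
  ring

/-- The number of trees whose degree sequence is `z + 1`. -/
noncomputable def treeCount (z : V → ℕ) : ℝ := ((treesOf fun v => z v + 1).card : ℝ)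

lemma treeCount_eq_sum (z : V → ℕ) :
    treeCount z = ∑ _T ∈ treesOf (fun v => z v + 1), (1 : ℝ) := by
  simp [treeCount]

lemma prod_factorial_removeLeaf {z : V → ℕ} {l : V} {j : ↥({l}ᶜ : Set V)} (hl : z l = 0)
    (hj : z j ≠ 0) :
    ∏ v, ((z v).factorial : ℝ) = z j * ∏ v, ((removeLeaf z l j v).factorial : ℝ) := by
  have h1 : ∏ v, ((z v).factorial : ℝ) = ∏ v : ↥({l}ᶜ : Set V), ((z v).factorial : ℝ) := by
    rw [Fintype.prod_eq_mul_prod_compl l, hl, Nat.factorial_zero, Nat.cast_one, one_mul]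
    exact Finset.prod_subtype _ (by simp) _
  rw [h1, Fintype.prod_eq_mul_prod_compl j,
    Fintype.prod_eq_mul_prod_compl j (fun v => ((removeLeaf z l j v).factorial : ℝ)), ← mul_assoc]
  congr 1
  · rw [removeLeaf, if_pos rfl]
    exact_mod_cast (Nat.mul_factorial_pred hj).symm
  · refine Finset.prod_congr rfl fun v hv => ?_
    have hvj : v ≠ j := by simpa using hv
    rw [removeLeaf, if_neg hvj, Nat.sub_zero]

theorem treeCount_mul_prod_factorial (k : ℕ) : ∀ (V : Type u) [Fintype V] (z : V → ℕ),
    Fintype.card V = k + 2 → ∑ v, z v = k →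
      treeCount z * ∏ v, ((z v).factorial : ℝ) = k.factorial := by
  induction k with
  | zero =>
    intro V _ z hV hz
    have hz0 : z = fun _ => 0 := by
      rw [Finset.sum_eq_zero_iff] at hz
      exact funext fun v => hz v (Finset.mem_univ v)
    subst hz0
    obtain ⟨T, -, h⟩ := sum_treesOf_one hV (fun _ => 1)
    rw [treeCount_eq_sum, h]
    simp
  | succ k ih =>
    intro V _ z hV hz
    obtain ⟨l, hl⟩ := exists_zero_of_sum_add_two (z := z) (by omega)
    have hU := card_compl_singleton l
    rw [treeCount_eq_sum, sum_treesOf_succ z l hl (by omega), Finset.sum_mul]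
    have h1 : ∀ j : ↥({l}ᶜ : Set V), (if z j = 0 then 0 else
        ∑ _T ∈ treesOf (fun v => removeLeaf z l j v + 1), (1 : ℝ)) * ∏ v, ((z v).factorial : ℝ)
        = z j * k.factorial := by
      intro j
      split_ifs with hj
      · rw [hj]
        simp
      · have h2 := sum_removeLeaf hl hj
        rw [← treeCount_eq_sum, prod_factorial_removeLeaf hl hj,
          ← ih _ (removeLeaf z l j) (by omega) (by omega)]
        ring
    simp only [h1, ← Finset.sum_mul]
    have h3 : ∑ j : ↥({l}ᶜ : Set V), (z j : ℝ) = (k + 1 : ℕ) := by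
      rw [← hz, Nat.cast_sum, sum_eq_add_sum_compl_singleton l, hl, Nat.cast_zero, zero_add]
    rw [h3, Nat.factorial_succ]
    push_cast
    ring

lemma treeCount_removeLeaf {k : ℕ} {z : V → ℕ} (hV : Fintype.card V = k + 3)
    (hz : ∑ v, z v = k + 1) {l : V} {j : ↥({l}ᶜ : Set V)} (hl : z l = 0) (hj : z j ≠ 0) :
    treeCount (removeLeaf z l j) = z j / (k + 1) * treeCount z := by
  have h1 := treeCount_mul_prod_factorial (k + 1) V z (by omega) hz
  have h2 := sum_removeLeaf hl hj
  have h3 := treeCount_mul_prod_factorial k _ (removeLeaf z l j)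
    (by have := card_compl_singleton l; omega) (by omega)
  rw [prod_factorial_removeLeaf hl hj, Nat.factorial_succ, Nat.cast_mul, ← h3] at h1
  have h4 : 0 < ∏ v, ((removeLeaf z l j v).factorial : ℝ) :=
    Finset.prod_pos fun v _ => by positivity
  have h5 : ((k + 1 : ℕ) : ℝ) * treeCount (removeLeaf z l j) = treeCount z * z j := by
    apply mul_right_cancel₀ h4.ne'
    linarith
  push_cast at h5
  field_simp
  linarith

/-- The mean of `edgeSum y` over the trees with degree sequence `z + 1`. -/
noncomputable def meanEdgeSum (z : V → ℕ) (y : V → ℝ) : ℝ :=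
  if Fintype.card V = 2 then ((∑ v, y v) ^ 2 - ∑ v, y v ^ 2) / 2
  else (∑ v, z v * (y v * (∑ u, y u - y v))) / (Fintype.card V - 2)

end TreeWeight

section TreeMean

universe u

variable {V : Type u} [Fintype V]

lemma sum_sq_sub_of_card_two (hV : Fintype.card V = 2) (y : V → ℝ) (j : V) :
    ((∑ v, y v) ^ 2 - ∑ v, y v ^ 2) / 2 = y j * (∑ v, y v - y j) := by
  obtain ⟨a, b, hab, h⟩ := Finset.card_eq_two.mp (Finset.card_univ (α := V) ▸ hV)
  have hj : j ∈ ({a, b} : Finset V) := h ▸ Finset.mem_univ j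
  rw [h, Finset.sum_pair hab, Finset.sum_pair hab]
  rw [Finset.mem_insert, Finset.mem_singleton] at hj
  rcases hj with rfl | rfl <;> ring

lemma meanEdgeSum_eq_of_leaf {k : ℕ} {z : V → ℕ} (hV : Fintype.card V = k + 3) {l : V}
    (hl : z l = 0) (y : V → ℝ) :
    meanEdgeSum z y = (∑ j : ↥({l}ᶜ : Set V),
      z j * (y j * (y l + (∑ u : ↥({l}ᶜ : Set V), y u - y j)))) / (k + 1) := by
  rw [meanEdgeSum, if_neg (by omega), sum_eq_add_sum_compl_singleton l, hl, hV,
    sum_eq_add_sum_compl_singleton l y]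
  congr 1
  · rw [Nat.cast_zero, zero_mul, zero_add]
    refine Finset.sum_congr rfl fun j _ => ?_
    ring
  · push_cast
    ring

lemma meanEdgeSum_removeLeaf {k : ℕ} {z : V → ℕ} (hV : Fintype.card V = k + 4) {l : V}
    {j : ↥({l}ᶜ : Set V)} (hj : z j ≠ 0) (y : V → ℝ) :
    meanEdgeSum (removeLeaf z l j) (fun v => y v)
      = (∑ i : ↥({l}ᶜ : Set V), z i * (y i * (∑ u : ↥({l}ᶜ : Set V), y u - y i))
        - y j * (∑ u : ↥({l}ᶜ : Set V), y u - y j)) / (k + 1) := by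
  have hU := card_compl_singleton l
  rw [meanEdgeSum, if_neg (by omega)]
  have hU' : (Fintype.card ↥({l}ᶜ : Set V) : ℝ) = k + 3 := by
    have : Fintype.card ↥({l}ᶜ : Set V) = k + 3 := by omega
    rw [this]
    push_cast
    ring
  rw [hU']
  congr 1
  · simp only [removeLeaf_cast hj, sub_mul, Finset.sum_sub_distrib, ite_mul, one_mul, zero_mul,
      Finset.sum_ite_eq', Finset.mem_univ, if_true]
  · ring

lemma meanEdgeSum_leaf_step {k : ℕ} {z : V → ℕ} (hV : Fintype.card V = k + 3)
    (hz : ∑ v, z v = k + 1) {l : V} (hl : z l = 0) {y : V → ℝ} {Y : ℝ} (hy0 : ∀ v, 0 ≤ y v)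
    (hyY : ∀ v, y v ≤ Y) :
    ∑ j : ↥({l}ᶜ : Set V), (z j : ℝ) / (k + 1) *
        (y l * y j + meanEdgeSum (removeLeaf z l j) (fun v => y v)) = meanEdgeSum z y ∧
      ∃ t, 0 ≤ t ∧ t ≤ 3 * Y ∧ k * t ≤ ∑ v, y v ∧ ∀ j : ↥({l}ᶜ : Set V), z j ≠ 0 →
        |y l * y j + meanEdgeSum (removeLeaf z l j) (fun v => y v) - meanEdgeSum z y|
          ≤ Y * (y l + t) := by
  have hY0 : 0 ≤ Y := (hy0 l).trans (hyY l)
  have hzU : ∑ j : ↥({l}ᶜ : Set V), (z j : ℝ) = k + 1 := by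
    have h3 : ∑ v, (z v : ℝ) = ((k + 1 : ℕ) : ℝ) := by rw [← hz, Nat.cast_sum]
    rw [sum_eq_add_sum_compl_singleton l, hl, Nat.cast_zero, zero_add] at h3
    rw [h3]
    push_cast
    ring
  have hk1 : (0 : ℝ) < k + 1 := by positivity
  have hU := card_compl_singleton l
  rw [meanEdgeSum_eq_of_leaf hV hl]
  set S : ℝ := ∑ u : ↥({l}ᶜ : Set V), y u with hS
  have hS0 : 0 ≤ S := Finset.sum_nonneg fun _ _ => hy0 _
  have hSy : ∑ v, y v = y l + S := sum_eq_add_sum_compl_singleton l y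
  rcases Nat.eq_zero_or_pos k with rfl | hk
  · have hpair : ∀ j : ↥({l}ᶜ : Set V),
        meanEdgeSum (removeLeaf z l j) (fun v => y v) = y j * (S - y j) := by
      intro j
      rw [meanEdgeSum, if_pos (by omega)]
      exact sum_sq_sub_of_card_two (by omega) (fun v : ↥({l}ᶜ : Set V) => y v) j
    simp only [hpair]
    refine ⟨?_, 0, le_rfl, by positivity, ?_, ?_⟩
    · rw [Finset.sum_div]
      refine Finset.sum_congr rfl fun j _ => ?_
      ring
    · rw [mul_zero]
      exact Finset.sum_nonneg fun v _ => hy0 v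
    · intro j hj
      have hzi : ∀ i : ↥({l}ᶜ : Set V), i ≠ j → z i = 0 := by
        intro i hij
        have h1 : z j + z i ≤ ∑ v : ↥({l}ᶜ : Set V), z v := by
          rw [← Finset.sum_pair (f := fun v : ↥({l}ᶜ : Set V) => z v) (Ne.symm hij)]
          exact Finset.sum_le_sum_of_subset (Finset.subset_univ _)
        have h2 := sum_eq_add_sum_compl_singleton l z
        omega
      have hzj : z j = 1 := by
        have h1 : ∑ v : ↥({l}ᶜ : Set V), z v = z j :=
          Finset.sum_eq_single j (fun i _ h => hzi i h) (by simp)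
        have h2 := sum_eq_add_sum_compl_singleton l z
        omega
      rw [Finset.sum_eq_single j (fun i _ h => by rw [hzi i h]; simp) (by simp), hzj]
      have : y l * y j + y j * (S - y j) -
          ((1 : ℕ) : ℝ) * (y j * (y l + (S - y j))) / (((0 : ℕ) : ℝ) + 1) = 0 := by
        push_cast
        ring
      rw [this, abs_zero]
      have := hy0 l
      positivity
  · obtain ⟨k, rfl⟩ : ∃ k', k = k' + 1 := ⟨k - 1, by omega⟩
    obtain ⟨Q, hQ⟩ : ∃ Q : ℝ, Q = ∑ i : ↥({l}ᶜ : Set V), z i * (y i * (S - y i)) := ⟨_, rfl⟩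
    have hk0 : (0 : ℝ) < (k : ℝ) + 1 := by positivity
    have hcast : ((k + 1 : ℕ) : ℝ) = k + 1 := by push_cast; ring
    rw [hcast] at hzU hk1 ⊢
    have hstep : ∀ j : ↥({l}ᶜ : Set V), z j ≠ 0 →
        y l * y j + meanEdgeSum (removeLeaf z l j) (fun v => y v)
          = Q / (k + 1) + (y l * y j - y j * (S - y j) / (k + 1)) := by
      intro j hj
      rw [meanEdgeSum_removeLeaf hV hj, ← hS, ← hQ]
      ring
    have hmean : (∑ j : ↥({l}ᶜ : Set V), z j * (y j * (y l + (S - y j)))) / ((k : ℝ) + 1 + 1)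
        = ∑ j : ↥({l}ᶜ : Set V), (z j : ℝ) / (k + 1 + 1) *
          (Q / (k + 1) + (y l * y j - y j * (S - y j) / (k + 1))) := by
      have e1 : ∑ j : ↥({l}ᶜ : Set V), (z j : ℝ) / (k + 1 + 1) *
          (Q / (k + 1) + (y l * y j - y j * (S - y j) / (k + 1)))
          = (∑ j : ↥({l}ᶜ : Set V), (z j : ℝ)) * (Q / ((k + 1) * (k + 1 + 1)))
            + y l / (k + 1 + 1) * ∑ j : ↥({l}ᶜ : Set V), z j * y j
            - (∑ j : ↥({l}ᶜ : Set V), z j * (y j * (S - y j))) / ((k + 1) * (k + 1 + 1)) := by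
        rw [Finset.sum_mul, Finset.mul_sum, Finset.sum_div, ← Finset.sum_add_distrib,
          ← Finset.sum_sub_distrib]
        refine Finset.sum_congr rfl fun j _ => ?_
        field_simp
        ring
      have e2 : ∑ j : ↥({l}ᶜ : Set V), (z j : ℝ) * (y j * (y l + (S - y j)))
          = y l * ∑ j : ↥({l}ᶜ : Set V), z j * y j + Q := by
        rw [hQ, Finset.mul_sum, ← Finset.sum_add_distrib]
        refine Finset.sum_congr rfl fun j _ => ?_
        ring
      rw [e1, e2, hzU, ← hQ]
      field_simp
      ring
    have hyS : ∀ j : ↥({l}ᶜ : Set V), y j ≤ S := fun j =>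
      Finset.single_le_sum (f := fun u : ↥({l}ᶜ : Set V) => y u) (fun _ _ => hy0 _)
        (Finset.mem_univ j)
    have hbd : ∀ j : ↥({l}ᶜ : Set V),
        -(Y * (S / (k + 1))) ≤ y l * y j - y j * (S - y j) / (k + 1) ∧
          y l * y j - y j * (S - y j) / (k + 1) ≤ Y * y l := by
      intro j
      have h1 : 0 ≤ y l * y j := mul_nonneg (hy0 _) (hy0 _)
      have h2 : y l * y j ≤ Y * y l := by
        rw [mul_comm]
        exact mul_le_mul_of_nonneg_right (hyY _) (hy0 _)
      have h3 : 0 ≤ y j * (S - y j) / (k + 1) :=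
        div_nonneg (mul_nonneg (hy0 _) (sub_nonneg.mpr (hyS j))) hk0.le
      have h4 : y j * (S - y j) / (k + 1) ≤ Y * (S / (k + 1)) := by
        rw [← mul_div_assoc]
        gcongr
        · exact sub_nonneg.mpr (hyS j)
        · exact hyY _
        · linarith [hy0 j]
      constructor <;> linarith
    refine ⟨?_, S / (k + 1), by positivity, ?_, ?_, ?_⟩
    · rw [hmean]
      refine Finset.sum_congr rfl fun j _ => ?_
      by_cases hj : z j = 0
      · simp [hj]
      · rw [hstep j hj]
    · have hcard : (Fintype.card ↥({l}ᶜ : Set V) : ℝ) = k + 3 := by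
        have : Fintype.card ↥({l}ᶜ : Set V) = k + 3 := by omega
        rw [this]
        push_cast
        ring
      have hSY : S ≤ (k + 3) * Y := by
        rw [hS, ← hcard, ← nsmul_eq_mul, ← Finset.card_univ]
        exact Finset.sum_le_card_nsmul _ _ _ fun v _ => hyY v
      rw [div_le_iff₀ hk0]
      have : 0 ≤ (k : ℝ) * Y := by positivity
      nlinarith
    · rw [mul_div_cancel₀ _ hk0.ne', hSy]
      linarith [hy0 l]
    · intro j hj
      rw [hstep j hj, hmean]
      have hsum1 : ∑ j : ↥({l}ᶜ : Set V), (z j : ℝ) / (k + 1 + 1) = 1 := by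
        rw [← Finset.sum_div, hzU, div_self hk1.ne']
      have hup : ∑ j : ↥({l}ᶜ : Set V), (z j : ℝ) / (k + 1 + 1) *
          (Q / (k + 1) + (y l * y j - y j * (S - y j) / (k + 1))) ≤ Q / (k + 1) + Y * y l := by
        calc _ ≤ ∑ j : ↥({l}ᶜ : Set V), (z j : ℝ) / (k + 1 + 1) * (Q / (k + 1) + Y * y l) :=
              Finset.sum_le_sum fun i _ =>
                mul_le_mul_of_nonneg_left (by linarith [(hbd i).2]) (by positivity)
          _ = _ := by rw [← Finset.sum_mul, hsum1, one_mul]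
      have hlo : Q / (k + 1) - Y * (S / (k + 1)) ≤ ∑ j : ↥({l}ᶜ : Set V), (z j : ℝ) / (k + 1 + 1) *
          (Q / (k + 1) + (y l * y j - y j * (S - y j) / (k + 1))) := by
        calc _ = ∑ j : ↥({l}ᶜ : Set V),
                (z j : ℝ) / (k + 1 + 1) * (Q / (k + 1) - Y * (S / (k + 1))) := by
              rw [← Finset.sum_mul, hsum1, one_mul]
          _ ≤ _ := Finset.sum_le_sum fun i _ =>
                mul_le_mul_of_nonneg_left (by linarith [(hbd i).1]) (by positivity)
      have := hbd j
      rw [abs_le]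
      constructor <;> linarith

theorem sum_edgeSum_treesOf (k : ℕ) : ∀ (V : Type u) [Fintype V] (z : V → ℕ) (y : V → ℝ),
    Fintype.card V = k + 2 → ∑ v, z v = k → (∀ v, 0 ≤ y v) →
      ∑ T ∈ treesOf (fun v => z v + 1), edgeSum y T = treeCount z * meanEdgeSum z y := by
  induction k with
  | zero =>
    intro V _ z y hV hz _
    have hz0 : z = fun _ => 0 := by
      rw [Finset.sum_eq_zero_iff] at hz
      exact funext fun v => hz v (Finset.mem_univ v)
    subst hz0
    obtain ⟨T, hT, h⟩ := sum_treesOf_one hV (edgeSum y)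
    obtain ⟨T', -, h'⟩ := sum_treesOf_one hV (fun _ => 1)
    rw [h, treeCount_eq_sum, h', meanEdgeSum, if_pos (by omega), edgeSum_of_adj_iff_ne y hT, one_mul]
  | succ k ih =>
    intro V _ z y hV hz hy
    obtain ⟨l, hl⟩ := exists_zero_of_sum_add_two (z := z) (by omega)
    have hU := card_compl_singleton l
    rw [sum_treesOf_succ z l hl (by omega)]
    rw [← (meanEdgeSum_leaf_step (Y := ∑ v, y v) (by omega) hz hl hy fun v =>
      Finset.single_le_sum (f := y) (fun _ _ => hy _) (Finset.mem_univ v)).1, Finset.mul_sum]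
    refine Finset.sum_congr rfl fun j _ => ?_
    split_ifs with hj
    · simp [hj]
    · have h2 := sum_removeLeaf hl hj
      simp only [edgeSum_attachLeaf, Finset.sum_add_distrib]
      rw [ih _ (removeLeaf z l j) _ (by omega) (by omega) (fun _ => hy _), Finset.sum_const,
        nsmul_eq_mul, ← treeCount, treeCount_removeLeaf (by omega) hz hl hj]
      ring

end TreeMean

section TreeConcentration

universe u

variable {V : Type u} [Fintype V]

lemma sum_mul_exp_neg_le {ι : Type*} [Fintype ι] {p τ : ι → ℝ} (hp : ∀ i, 0 ≤ p i)
    (hp1 : ∑ i, p i = 1) (hτ : ∑ i, p i * τ i = 0) {r : ℝ} (hr1 : r ≤ 1)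
    (hr : ∀ i, p i ≠ 0 → |τ i| ≤ r) :
    ∑ i, p i * Real.exp (-τ i) ≤ Real.exp (r ^ 2) := by
  have h : ∀ i, p i * Real.exp (-τ i) ≤ p i * (1 + r ^ 2) - p i * τ i := by
    intro i
    by_cases hi : p i = 0
    · simp [hi]
    have h1 := hr i hi
    have h2 := (abs_le.mp (Real.abs_exp_sub_one_sub_id_le (x := -τ i)
      (by rw [abs_neg]; linarith))).2
    have h3 : (-τ i) ^ 2 ≤ r ^ 2 := by
      rw [neg_sq]
      exact sq_le_sq' (abs_le.mp h1).1 (abs_le.mp h1).2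
    rw [← mul_sub]
    exact mul_le_mul_of_nonneg_left (by linarith) (hp i)
  calc _ ≤ ∑ i, (p i * (1 + r ^ 2) - p i * τ i) := Finset.sum_le_sum fun i _ => h i
    _ = r ^ 2 + 1 := by rw [Finset.sum_sub_distrib, ← Finset.sum_mul, hp1, hτ]; ring
    _ ≤ _ := Real.add_one_le_exp _

lemma sum_exp_treesOf_le_of_potential {a Y S : ℝ} (ha : 0 ≤ a) (haY : 4 * (a * Y ^ 2) ≤ 1)
    {φ : ℕ → ℝ} (hφ0 : 0 ≤ φ 0)
    (hφ : ∀ (k : ℕ) (t : ℝ), 0 ≤ t → t ≤ 3 * Y → k * t ≤ S → φ k + t ^ 2 ≤ φ (k + 1)) (k : ℕ) :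
    ∀ (V : Type u) [Fintype V] (z : V → ℕ) (y : V → ℝ),
    Fintype.card V = k + 2 → ∑ v, z v = k → (∀ v, 0 ≤ y v) → (∀ v, y v ≤ Y) → ∑ v, y v ≤ S →
      ∑ T ∈ treesOf (fun v => z v + 1), Real.exp (-(a * edgeSum y T))
        ≤ treeCount z * Real.exp (-(a * meanEdgeSum z y)
          + a ^ 2 * (2 * Y ^ 2) * (Y * ∑ v, y v + φ k)) := by
  induction k with
  | zero =>
    intro V _ z y hV hz hy0 hyY _
    have hz0 : z = fun _ => 0 := by
      rw [Finset.sum_eq_zero_iff] at hz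
      exact funext fun v => hz v (Finset.mem_univ v)
    subst hz0
    obtain ⟨T, hT, h⟩ := sum_treesOf_one hV (fun T => Real.exp (-(a * edgeSum y T)))
    obtain ⟨T', -, h'⟩ := sum_treesOf_one hV (fun _ => 1)
    rw [h, treeCount_eq_sum, h', meanEdgeSum, if_pos (by omega), edgeSum_of_adj_iff_ne y hT, one_mul]
    apply Real.exp_le_exp.mpr
    have : Nonempty V := Fintype.card_pos_iff.mp (by omega)
    have hY0 : 0 ≤ Y := (hy0 (Classical.arbitrary V)).trans (hyY _)
    have h1 : 0 ≤ ∑ v, y v := Finset.sum_nonneg fun v _ => hy0 v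
    have h2 : 0 ≤ a ^ 2 * (2 * Y ^ 2) * (Y * ∑ v, y v + φ 0) := by positivity
    linarith
  | succ k ih =>
    intro V _ z y hV hz hy0 hyY hyS
    obtain ⟨l, hl⟩ := exists_zero_of_sum_add_two (z := z) (by omega)
    have hU := card_compl_singleton l
    have hY0 : 0 ≤ Y := (hy0 l).trans (hyY l)
    obtain ⟨hmean, t, ht0, htY, htS, hdev⟩ :=
      meanEdgeSum_leaf_step (V := V) (k := k) (by omega) hz hl hy0 hyY
    have hSy : ∑ v, y v = y l + ∑ v : ↥({l}ᶜ : Set V), y v := sum_eq_add_sum_compl_singleton l y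
    have hφt := hφ k t ht0 htY (htS.trans hyS)
    have hzU : ∑ j : ↥({l}ᶜ : Set V), (z j : ℝ) = k + 1 := by
      have h3 : ∑ v, (z v : ℝ) = ((k + 1 : ℕ) : ℝ) := by rw [← hz, Nat.cast_sum]
      rw [sum_eq_add_sum_compl_singleton l, hl, Nat.cast_zero, zero_add] at h3
      rw [h3]
      push_cast
      ring
    have hk1 : (0 : ℝ) < k + 1 := by positivity
    have hp1 : ∑ j : ↥({l}ᶜ : Set V), (z j : ℝ) / (k + 1) = 1 := by
      rw [← Finset.sum_div, hzU, div_self hk1.ne']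
    set M := meanEdgeSum z y with hM
    obtain ⟨W, hW⟩ : ∃ W : ↥({l}ᶜ : Set V) → ℝ, ∀ j, W j = y l * y j
      + meanEdgeSum (removeLeaf z l j) (fun v => y v) := ⟨_, fun _ => rfl⟩
    simp only [← hW] at hmean hdev
    have hc0 : 0 ≤ treeCount z := Nat.cast_nonneg _
    obtain ⟨B, hB⟩ : ∃ B : ℝ, B = a ^ 2 * (2 * Y ^ 2) *
      (Y * ∑ v : ↥({l}ᶜ : Set V), y v + φ k) := ⟨_, rfl⟩
    have hstep : ∑ T ∈ treesOf (fun v => z v + 1), Real.exp (-(a * edgeSum y T))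
        ≤ treeCount z * Real.exp (-(a * M) + B) *
          ∑ j : ↥({l}ᶜ : Set V), (z j : ℝ) / (k + 1) * Real.exp (-(a * (W j - M))) := by
      rw [sum_treesOf_succ z l hl (by omega), Finset.mul_sum]
      refine Finset.sum_le_sum fun j _ => ?_
      split_ifs with hj
      · simp [hj]
      · have h2 := sum_removeLeaf hl hj
        have h3 := ih _ (removeLeaf z l j) (fun v => y v) (by omega) (by omega)
          (fun _ => hy0 _) (fun _ => hyY _) (by linarith [hy0 l])
        rw [← hB, treeCount_removeLeaf (by omega) hz hl hj] at h3
        have h4 : ∀ T : SimpleGraph ↥({l}ᶜ : Set V),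
            Real.exp (-(a * edgeSum y (attachLeaf l j T)))
              = Real.exp (-(a * (y l * y j))) *
                Real.exp (-(a * edgeSum (fun v : ↥({l}ᶜ : Set V) => y v) T)) := by
          intro T
          rw [edgeSum_attachLeaf, ← Real.exp_add]
          ring_nf
        simp only [h4, ← Finset.mul_sum]
        refine (mul_le_mul_of_nonneg_left h3 (Real.exp_nonneg _)).trans (le_of_eq ?_)
        have h5 : Real.exp (-(a * M) + B) * Real.exp (-(a * (W j - M)))
            = Real.exp (-(a * (y l * y j))) *
              Real.exp (-(a * meanEdgeSum (removeLeaf z l j) (fun v => y v)) + B) := by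
          rw [← Real.exp_add, ← Real.exp_add, hW]
          ring_nf
        linear_combination (-(treeCount z * ((z j : ℝ) / (k + 1)))) * h5
    have hr := sum_mul_exp_neg_le (p := fun j : ↥({l}ᶜ : Set V) => (z j : ℝ) / (k + 1))
      (τ := fun j => a * (W j - M)) (r := a * (Y * (y l + t))) (fun j => by positivity) hp1 ?_ ?_ ?_
    · refine (hstep.trans (mul_le_mul_of_nonneg_left hr (by positivity))).trans ?_
      rw [mul_assoc, ← Real.exp_add]
      refine mul_le_mul_of_nonneg_left (Real.exp_le_exp.mpr ?_) hc0
      rw [hB, hSy]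
      have h6 : (y l + t) ^ 2 ≤ 2 * (Y * y l + t ^ 2) := by
        nlinarith [sq_nonneg (y l - t), mul_le_mul_of_nonneg_right (hyY l) (hy0 l)]
      have h7 : (a * (Y * (y l + t))) ^ 2 ≤ a ^ 2 * (2 * Y ^ 2) * (Y * y l + t ^ 2) := by
        have : 0 ≤ a ^ 2 * Y ^ 2 := by positivity
        nlinarith
      have h8 : a ^ 2 * (2 * Y ^ 2) * (φ k + t ^ 2) ≤ a ^ 2 * (2 * Y ^ 2) * φ (k + 1) :=
        mul_le_mul_of_nonneg_left hφt (by positivity)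
      linarith
    · have : ∀ j : ↥({l}ᶜ : Set V), (z j : ℝ) / (k + 1) * (a * (W j - M))
          = a * ((z j : ℝ) / (k + 1) * W j) - a * M * ((z j : ℝ) / (k + 1)) := fun j => by ring
      simp only [this, Finset.sum_sub_distrib, ← Finset.mul_sum, hmean, hp1]
      ring
    · have h9 : Y * (y l + t) ≤ Y * (4 * Y) :=
        mul_le_mul_of_nonneg_left (by linarith [hyY l]) hY0
      nlinarith [mul_le_mul_of_nonneg_left h9 ha]
    · intro j hj
      have hj' : z j ≠ 0 := by
        rintro h
        simp [h] at hj
      rw [abs_mul, abs_of_nonneg ha]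
      exact mul_le_mul_of_nonneg_left (hdev j hj') ha

/-- The moment generating function of `edgeSum y` over random trees with given degrees. -/
theorem sum_exp_treesOf_le {k : ℕ} {z : V → ℕ} {y : V → ℝ} (hV : Fintype.card V = k + 2)
    (hz : ∑ v, z v = k) (hy0 : ∀ v, 0 ≤ y v) {Y : ℝ} (hyY : ∀ v, y v ≤ Y) {m : ℝ}
    (hm : m = ∑ v, y v) (hm0 : 0 < m) (hYm : 4 * Y ^ 2 ≤ m) (hYm' : 3 * Y ≤ m) :
    ∑ T ∈ treesOf (fun v => z v + 1), Real.exp (-(edgeSum y T / m))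
      ≤ treeCount z * Real.exp (-(meanEdgeSum z y / m) + 38 * (Y ^ 3 / m)) := by
  have hne : Nonempty V := Fintype.card_pos_iff.mp (by omega)
  have hY0 : 0 ≤ Y := (hy0 (Classical.arbitrary V)).trans (hyY _)
  have h := sum_exp_treesOf_le_of_potential (a := 1 / m) (Y := Y) (S := m) (by positivity)
    (by rw [← mul_assoc, mul_one_div, div_mul_eq_mul_div, div_le_one hm0]; exact hYm)
    (φ := fun k => 18 * Y * m - 18 * Y * m ^ 2 / (m + 3 * Y * k)) ?_ ?_ k V z y hV hz hy0 hyY hm.ge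
  · have e : ∀ x, 1 / m * x = x / m := fun x => by ring
    simp only [e] at h
    refine h.trans (mul_le_mul_of_nonneg_left (Real.exp_le_exp.mpr ?_) (Nat.cast_nonneg _))
    rw [← hm]
    have h1 : 0 ≤ 18 * Y * m ^ 2 / (m + 3 * Y * k) := by positivity
    have h2 : (1 / m) ^ 2 * (2 * Y ^ 2) * (Y * m + (18 * Y * m - 18 * Y * m ^ 2 / (m + 3 * Y * k)))
        ≤ (1 / m) ^ 2 * (2 * Y ^ 2) * (Y * m + 18 * Y * m) :=
      mul_le_mul_of_nonneg_left (by linarith) (by positivity)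
    have h3 : (1 / m) ^ 2 * (2 * Y ^ 2) * (Y * m + 18 * Y * m) = 38 * (Y ^ 3 / m) := by
      field_simp
      ring
    linarith
  · have : 18 * Y * m - 18 * Y * m ^ 2 / (m + 3 * Y * ((0 : ℕ) : ℝ)) = 0 := by
      rw [Nat.cast_zero, mul_zero, add_zero]
      field_simp
      ring
    exact this.ge
  · intro k t ht0 htY htm
    have hA : 0 < m + 3 * Y * k := by positivity
    have hB : 0 < m + 3 * Y * ((k + 1 : ℕ) : ℝ) := by positivity
    have hdiff : 18 * Y * m - 18 * Y * m ^ 2 / (m + 3 * Y * ((k + 1 : ℕ) : ℝ))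
        - (18 * Y * m - 18 * Y * m ^ 2 / (m + 3 * Y * k))
        = 6 * (3 * Y) ^ 2 * m ^ 2 / ((m + 3 * Y * k) * (m + 3 * Y * ((k + 1 : ℕ) : ℝ))) := by
      field_simp
      push_cast
      ring
    have h1 : t * (m + 3 * Y * k) ≤ 2 * (3 * Y * m) := by nlinarith
    have h2 : t * (m + 3 * Y * ((k + 1 : ℕ) : ℝ)) ≤ 3 * (3 * Y * m) := by
      push_cast
      nlinarith
    have h3 : t ^ 2 ≤ 6 * (3 * Y) ^ 2 * m ^ 2 /
        ((m + 3 * Y * k) * (m + 3 * Y * ((k + 1 : ℕ) : ℝ))) := by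
      rw [le_div_iff₀ (mul_pos hA hB)]
      have := mul_le_mul h1 h2 (by positivity) (by positivity)
      nlinarith
    linarith

end TreeConcentration

section Stirling

open Filter Topology in
lemma log_stirlingSeq_le {k : ℕ} (hk : k ≠ 0) :
    Real.log (Stirling.stirlingSeq k) ≤ Real.log (√Real.pi) + 1 / (12 * k) := by
  obtain ⟨k, rfl⟩ := Nat.exists_eq_succ_of_ne_zero hk
  have hmono : Monotone fun i : ℕ =>
      Real.log (Stirling.stirlingSeq (i + 1)) - 1 / (12 * ((i + 1 : ℕ) : ℝ)) := by
    refine monotone_nat_of_le_succ fun i => ?_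
    have h := Stirling.log_stirlingSeq_sdiff_le (i + 1)
    have e : (1 : ℝ) / (12 * ((i + 1 : ℕ) : ℝ) * (((i + 1 : ℕ) : ℝ) + 1))
        = 1 / (12 * ((i + 1 : ℕ) : ℝ)) - 1 / (12 * ((i + 1 + 1 : ℕ) : ℝ)) := by
      push_cast
      field_simp
      ring
    rw [e] at h
    linarith
  have hlim : Tendsto (fun i : ℕ =>
      Real.log (Stirling.stirlingSeq (i + 1)) - 1 / (12 * ((i + 1 : ℕ) : ℝ))) atTop
      (𝓝 (Real.log (√Real.pi) - 0)) := by
    refine Tendsto.sub ?_ ?_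
    · have h1 := Stirling.tendsto_stirlingSeq_sqrt_pi.comp (tendsto_add_atTop_nat 1)
      exact h1.log (by positivity)
    · have h1 : Tendsto (fun i : ℕ => (1 / 12 : ℝ) * (1 / ((i : ℝ) + 1))) atTop (𝓝 (1 / 12 * 0)) :=
        tendsto_one_div_add_atTop_nhds_zero_nat.const_mul _
      rw [mul_zero] at h1
      refine h1.congr fun i => ?_
      push_cast
      field_simp
  have h := hmono.ge_of_tendsto hlim k
  simp only [sub_zero] at h
  change Real.log (Stirling.stirlingSeq (k + 1)) ≤ _ + 1 / (12 * ((k + 1 : ℕ) : ℝ))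
  linarith

lemma log_factorial_bounds {k : ℕ} (hk : k ≠ 0) :
    k * Real.log k - k + Real.log k / 2 + Real.log (2 * Real.pi) / 2 ≤ Real.log k.factorial ∧
      Real.log k.factorial ≤ k * Real.log k - k + Real.log k / 2 + Real.log (2 * Real.pi) / 2
        + 1 / (12 * k) := by
  refine ⟨Stirling.le_log_factorial_stirling hk, ?_⟩
  have h1 := log_stirlingSeq_le hk
  have hk0 : (k : ℝ) ≠ 0 := by exact_mod_cast hk
  rw [Stirling.log_stirlingSeq_formula, Real.log_div hk0 (Real.exp_ne_zero 1), Real.log_exp,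
    Real.log_sqrt Real.pi_pos.le, Real.log_mul two_ne_zero hk0] at h1
  rw [Real.log_mul two_ne_zero Real.pi_ne_zero]
  linarith

/-- The factorial expression that is approximated by `Hd` up to the factor `∏ d j`. -/
noncomputable def factorialRatio (n q : ℕ) : ℝ :=
  (((2 * q + n).factorial : ℝ) * (q + n).factorial * 2 ^ (n - 1)) /
    ((q + 1).factorial * (2 * (q + n)).factorial)

lemma factorialRatio_pos (n q : ℕ) : 0 < factorialRatio n q := by
  unfold factorialRatio
  positivity

lemma abs_log_factorialRatio_sub_le {n q : ℕ} (hn : 1 ≤ n) (hq : 1 ≤ q) :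
    |Real.log (factorialRatio n q) - (Real.log (2 * q + n) / 2 - 3 / 2 * Real.log (2 * q)
        + (2 * q + n) * Real.log (2 * q + n) - (q + n) * Real.log (2 * (q + n))
        - q * Real.log (2 * q))| ≤ 3 / (2 * q) := by
  have hq0 : (0 : ℝ) < q := by exact_mod_cast hq
  have hn0 : (0 : ℝ) < n := by exact_mod_cast hn
  have hM := log_factorial_bounds (k := 2 * q + n) (by omega)
  have hh := log_factorial_bounds (k := q + n) (by omega)
  have hQ := log_factorial_bounds (k := q) (by omega)
  have hD := log_factorial_bounds (k := 2 * (q + n)) (by omega)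
  push_cast at hM hh hQ hD
  have hlog : Real.log (factorialRatio n q) = Real.log (2 * q + n).factorial
      + Real.log (q + n).factorial + (n - 1) * Real.log 2 - Real.log ((q : ℝ) + 1)
      - Real.log q.factorial - Real.log (2 * (q + n)).factorial := by
    unfold factorialRatio
    rw [Real.log_div (by positivity) (by positivity), Real.log_mul (by positivity) (by positivity),
      Real.log_mul (by positivity) (by positivity), Real.log_mul (by positivity) (by positivity),
      Real.log_pow, Nat.factorial_succ, Nat.cast_mul, Real.log_mul (by positivity) (by positivity),
      Nat.cast_sub hn]
    push_cast
    ring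
  have hq1 : Real.log q ≤ Real.log ((q : ℝ) + 1) := Real.log_le_log hq0 (by linarith)
  have hq2 : Real.log ((q : ℝ) + 1) ≤ Real.log q + 1 / q := by
    have h1 : (q : ℝ) + 1 = q * (1 + 1 / q) := by field_simp
    rw [h1, Real.log_mul hq0.ne' (by positivity)]
    have := Real.log_le_sub_one_of_pos (x := 1 + 1 / (q : ℝ)) (by positivity)
    linarith
  have e1 : Real.log (2 * (q : ℝ)) = Real.log 2 + Real.log q :=
    Real.log_mul two_ne_zero hq0.ne'
  have e2 : Real.log (2 * ((q : ℝ) + n)) = Real.log 2 + Real.log (q + n) :=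
    Real.log_mul two_ne_zero (by positivity)
  rw [e2] at hD ⊢
  rw [hlog, e1]
  have b1 : 1 / (12 * (2 * (q : ℝ) + n)) ≤ 1 / (12 * q) :=
    one_div_le_one_div_of_le (by positivity) (by linarith)
  have b2 : 1 / (12 * ((q : ℝ) + n)) ≤ 1 / (12 * q) :=
    one_div_le_one_div_of_le (by positivity) (by linarith)
  have b3 : 1 / (12 * (2 * ((q : ℝ) + n))) ≤ 1 / (12 * q) :=
    one_div_le_one_div_of_le (by positivity) (by linarith)
  have b4 : 1 / (12 * (q : ℝ)) = 1 / 12 * (1 / q) := by field_simp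
  have b5 : 3 / (2 * (q : ℝ)) = 3 / 2 * (1 / q) := by field_simp
  have b6 : 0 < 1 / (q : ℝ) := by positivity
  rw [abs_le]
  constructor <;> linarith

lemma log_Hd {n q : ℕ} (hn : 1 ≤ n) (hq : 1 ≤ q) {d : Fin n → ℕ} (hd : ∀ j, 1 ≤ d j)
    (hsum : ∑ j, d j = 2 * (q + n)) :
    0 < Hd n d ∧ Real.log (Hd n d) = Real.log (∏ j, (d j : ℝ)) +
      (Real.log (2 * q + n) / 2 - 3 / 2 * Real.log (2 * q)
        + (2 * q + n) * Real.log (2 * q + n) - (q + n) * Real.log (2 * (q + n))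
        - q * Real.log (2 * q)) := by
  have hq0 : (0 : ℝ) < q := by exact_mod_cast hq
  have hn0 : (0 : ℝ) < n := by exact_mod_cast hn
  have hsum' : ∑ j, (d j : ℝ) = 2 * (q + n) := by exact_mod_cast hsum
  have hP : 0 < ∏ j, (d j : ℝ) := Finset.prod_pos fun j _ => by exact_mod_cast hd j
  obtain ⟨a, ha⟩ : ∃ a, a = davg n d := ⟨_, rfl⟩
  have han : a * n = 2 * (q + n) := by
    rw [ha, davg, hsum']
    field_simp
  have ha2 : (a - 2) * n = 2 * q := by linarith
  have ha1 : (a - 1) * n = 2 * q + n := by linarith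
  have h2 : 0 < a - 2 := by
    by_contra h
    have : (a - 2) * n ≤ 0 := mul_nonpos_of_nonpos_of_nonneg (not_lt.mp h) hn0.le
    linarith
  have h1 : 0 < a - 1 := by linarith
  have h0 : 0 < a := by linarith
  unfold Hd
  rw [← ha]
  have hA : 0 < (∏ j, (d j : ℝ)) ^ ((1 : ℝ) / n) := Real.rpow_pos_of_pos hP _
  have hB := Real.rpow_pos_of_pos h1 (a - 1)
  have hC := Real.rpow_pos_of_pos h0 (a / 2)
  have hD := Real.rpow_pos_of_pos h2 (a / 2 - 1)
  have hE := Real.rpow_pos_of_pos h2 ((3 : ℝ) / 2)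
  have hF : 0 < (∏ j, (d j : ℝ)) ^ ((1 : ℝ) / n) * (a - 1) ^ (a - 1)
    / (a ^ (a / 2) * (a - 2) ^ (a / 2 - 1)) := by positivity
  have hG := Real.rpow_pos_of_pos hF (n : ℝ)
  have hS : 0 < √(a - 1) := Real.sqrt_pos.mpr h1
  refine ⟨by positivity, ?_⟩
  rw [Real.log_mul (by positivity) hG.ne', Real.log_div hS.ne' (by positivity),
    Real.log_mul hE.ne' hn0.ne', Real.log_sqrt h1.le, Real.log_rpow h2, Real.log_rpow hF,
    Real.log_div (by positivity) (by positivity), Real.log_mul hA.ne' hB.ne',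
    Real.log_mul hC.ne' hD.ne', Real.log_rpow hP, Real.log_rpow h1, Real.log_rpow h0,
    Real.log_rpow h2, ← ha1, ← ha2, Real.log_mul h1.ne' hn0.ne', Real.log_mul h2.ne' hn0.ne', ← han,
    Real.log_mul h0.ne' hn0.ne']
  have hq' : (q : ℝ) = (a - 2) * n / 2 := by linarith
  rw [hq']
  field_simp
  ring

end Stirling

section TreeSum

universe u

variable {V : Type u} [Fintype V]

lemma sum_edgeFinset_edgeWeight (y : V → ℝ) (T : SimpleGraph V) :
    ∑ e ∈ T.edgeFinset, edgeWeight y e = edgeSum y T := by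
  have h := two_mul_sum_edgeFinset T (edgeWeight y)
  simp only [edgeWeight_mk] at h
  rw [edgeSum, ← h]
  ring

lemma treeCount_mul_exp_le {k : ℕ} {z : V → ℕ} {y : V → ℝ} (hV : Fintype.card V = k + 2)
    (hz : ∑ v, z v = k) (hy : ∀ v, 0 ≤ y v) (m : ℝ) :
    treeCount z * Real.exp (-(meanEdgeSum z y / m))
      ≤ ∑ T ∈ treesOf (fun v => z v + 1), Real.exp (-(edgeSum y T / m)) := by
  have hmean := sum_edgeSum_treesOf k V z y hV hz hy
  have h1 : ∀ T ∈ treesOf (fun v => z v + 1),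
      Real.exp (-(meanEdgeSum z y / m)) * (1 + meanEdgeSum z y / m - edgeSum y T / m)
        ≤ Real.exp (-(edgeSum y T / m)) := by
    intro T _
    have h2 := Real.add_one_le_exp (meanEdgeSum z y / m - edgeSum y T / m)
    calc Real.exp (-(meanEdgeSum z y / m)) * (1 + meanEdgeSum z y / m - edgeSum y T / m)
        ≤ Real.exp (-(meanEdgeSum z y / m)) *
            Real.exp (meanEdgeSum z y / m - edgeSum y T / m) := by
          gcongr
          linarith
      _ = Real.exp (-(edgeSum y T / m)) := by
          rw [← Real.exp_add]
          congr 1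
          ring
  refine le_trans (le_of_eq ?_) (Finset.sum_le_sum h1)
  rw [← Finset.mul_sum, Finset.sum_sub_distrib, Finset.sum_const, nsmul_eq_mul,
    ← Finset.sum_div, hmean]
  unfold treeCount
  ring

set_option maxHeartbeats 1000000 in
/-- The total number of ways to complete a tree of degree sequence `z + 1` by an edge-disjoint
graph of degree sequence `y`. -/
theorem sum_countGraphs_treesOf_bounds {k q Δ : ℕ} {z y : V → ℕ} (hV : Fintype.card V = k + 2)
    (hz : ∑ v, z v = k) (hΔ : ∀ v, y v + (z v + 1) ≤ Δ) (hΔ3 : 3 ≤ Δ)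
    (hsum : ∑ v, (y v : ℝ) = 2 * (q + 1)) (hq : (Δ : ℝ) ^ 4 ≤ 2 * q) :
    Real.exp (-(400 * (Δ ^ 4 / (2 * q)))) * (treeCount z * matchingCount (q + 1) *
        Real.exp (-(lam y + lam y ^ 2) - meanEdgeSum z (fun v => (y v : ℝ)) / (2 * (q + 1))))
      ≤ (∑ T ∈ treesOf (fun v => z v + 1), countGraphs y T (fun _ => True)) *
          ∏ v, ((y v).factorial : ℝ) ∧
    (∑ T ∈ treesOf (fun v => z v + 1), countGraphs y T (fun _ => True)) *
          ∏ v, ((y v).factorial : ℝ)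
      ≤ Real.exp (400 * (Δ ^ 4 / (2 * q))) * (treeCount z * matchingCount (q + 1) *
        Real.exp (-(lam y + lam y ^ 2) - meanEdgeSum z (fun v => (y v : ℝ)) / (2 * (q + 1)))) := by
  have hΔ3' : (3 : ℝ) ≤ Δ := by exact_mod_cast hΔ3
  have hΔ9 : 9 * (Δ : ℝ) ^ 2 ≤ Δ ^ 4 := by
    have h2 : (9 : ℝ) ≤ Δ ^ 2 := by nlinarith
    have h4 : (Δ : ℝ) ^ 4 = Δ ^ 2 * Δ ^ 2 := by ring
    rw [h4]
    gcongr
  have hΔ34 : (Δ : ℝ) ^ 3 ≤ Δ ^ 4 := by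
    have : (0 : ℝ) ≤ Δ ^ 3 := by positivity
    nlinarith
  have hq0 : (0 : ℝ) < q := by nlinarith
  obtain ⟨m, hm⟩ : ∃ m : ℝ, m = 2 * (q + 1) := ⟨_, rfl⟩
  obtain ⟨ε, hε⟩ : ∃ ε : ℝ, ε = Δ ^ 4 / (2 * q) := ⟨_, rfl⟩
  have hm0 : 0 < m := by rw [hm]; positivity
  have hεm : (Δ : ℝ) ^ 4 / m ≤ ε := by
    rw [hε, hm]
    gcongr
    linarith
  have hyΔ : ∀ v, y v ≤ Δ := fun v => by have := hΔ v; omega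
  have hysum : m = ∑ v, (y v : ℝ) := by rw [hm, hsum]
  have hlam0 := lam_nonneg y
  have hlam := lam_le y hyΔ (by rw [← hysum]; exact hm0)
  obtain ⟨Q, hQ⟩ : ∃ Q : ℝ, Q = lam y + lam y ^ 2 := ⟨_, rfl⟩
  have hQ0 : 0 ≤ Q := by rw [hQ]; positivity
  have hQΔ : Q ≤ (Δ : ℝ) ^ 2 := by
    rw [hQ]
    nlinarith
  have hB := countGraphs_bot_bounds hΔ3 (k := q + 1) (by push_cast; linarith) y hyΔ
    (by push_cast; exact hsum)
  obtain ⟨N, hN⟩ : ∃ N : ℝ, N = countGraphs y ⊥ (fun _ => True) * ∏ v, ((y v).factorial : ℝ) :=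
    ⟨_, rfl⟩
  rw [← hN, ← hQ] at hB
  push_cast at hB
  rw [← hm] at hB
  have hN0 : 0 ≤ N := by
    rw [hN]
    exact mul_nonneg (countGraphs_nonneg _ _ _) (Finset.prod_nonneg fun _ _ => by positivity)
  have hmc := (matchingCount_pos (q + 1)).le
  have hfrac : ∀ t : ℝ, 0 ≤ t → t ≤ (Δ : ℝ) ^ 2 → (Δ : ℝ) ^ 2 / m * t ≤ ε := by
    intro t _ ht
    refine le_trans ?_ hεm
    rw [div_mul_eq_mul_div]
    gcongr
    nlinarith [sq_nonneg (Δ : ℝ)]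
  have hBl : Real.exp (-Q - 261 * ε) * matchingCount (q + 1) ≤ N := by
    refine le_trans ?_ hB.1
    gcongr
    have := hfrac Q hQ0 hQΔ
    nlinarith
  have hBu : N ≤ Real.exp (-Q + 261 * ε) * matchingCount (q + 1) := by
    refine hB.2.trans ?_
    gcongr
    have := hfrac Q hQ0 hQΔ
    nlinarith
  have hT : ∀ T ∈ treesOf (fun v => z v + 1),
      Real.exp (-(edgeSum (fun v => (y v : ℝ)) T / m)) * (Real.exp (-(60 * ε)) * N)
        ≤ countGraphs y T (fun _ => True) * ∏ v, ((y v).factorial : ℝ) ∧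
      countGraphs y T (fun _ => True) * ∏ v, ((y v).factorial : ℝ) ≤
        Real.exp (-(edgeSum (fun v => (y v : ℝ)) T / m)) * (Real.exp (60 * ε) * N) := by
    intro T hT
    rw [mem_treesOf] at hT
    have hdeg : ∀ v, y v + T.degree v ≤ Δ := fun v => by rw [hT.2 v]; exact hΔ v
    have h1 := countGraphs_avoiding_bounds y hdeg hΔ3 hysum (by rw [hm]; linarith) rfl
    have h2 := sum_edgeWeight_le hdeg
    rw [sum_edgeFinset_edgeWeight] at h1 h2
    obtain ⟨μ, hμ⟩ : ∃ μ, μ = edgeSum (fun v => (y v : ℝ)) T / m := ⟨_, rfl⟩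
    rw [← hμ] at h1 ⊢
    have hμ0 : 0 ≤ μ := by
      rw [hμ, edgeSum]
      have : ∀ a b, 0 ≤ ind (T.Adj a b) * ((y a : ℝ) * y b) := fun a b =>
        mul_nonneg (ind_nonneg _) (by positivity)
      exact div_nonneg (div_nonneg (Finset.sum_nonneg fun a _ => Finset.sum_nonneg fun b _ =>
        this a b) (by norm_num)) hm0.le
    have hμΔ : μ ≤ (Δ : ℝ) ^ 2 := by
      rw [hμ, div_le_iff₀ hm0, hysum]
      exact h2
    have h3 := hfrac μ hμ0 hμΔ
    have hP : (0 : ℝ) ≤ ∏ v, ((y v).factorial : ℝ) := Finset.prod_nonneg fun _ _ => by positivity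
    have hC := countGraphs_nonneg y ⊥ (fun _ => True)
    rw [hN, ← mul_assoc, ← mul_assoc, ← mul_assoc, ← mul_assoc, ← Real.exp_add, ← Real.exp_add]
    constructor
    · refine mul_le_mul_of_nonneg_right (le_trans ?_ h1.1) hP
      gcongr
      nlinarith
    · refine mul_le_mul_of_nonneg_right (h1.2.trans ?_) hP
      gcongr
      nlinarith
  obtain ⟨S, hS⟩ : ∃ S, S = ∑ T ∈ treesOf (fun v => z v + 1),
    Real.exp (-(edgeSum (fun v => (y v : ℝ)) T / m)) := ⟨_, rfl⟩
  obtain ⟨a, ha⟩ : ∃ a, a = meanEdgeSum z (fun v => (y v : ℝ)) / m := ⟨_, rfl⟩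
  have hSl := treeCount_mul_exp_le (y := fun v => (y v : ℝ)) hV hz (fun v => by positivity) m
  have hSu := sum_exp_treesOf_le (y := fun v => (y v : ℝ)) (Y := Δ) hV hz (fun v => by positivity)
    (fun v => by exact_mod_cast hyΔ v) hysum hm0 (by rw [hm]; nlinarith) (by rw [hm]; nlinarith)
  rw [← hS, ← ha] at hSl hSu
  have hε0 : 0 ≤ ε := by rw [hε]; positivity
  have hε3 : (Δ : ℝ) ^ 3 / m ≤ ε := le_trans (by gcongr) hεm
  have hTC : 0 ≤ treeCount z := Nat.cast_nonneg _
  have hS0 : 0 ≤ S := le_trans (by positivity) hSl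
  rw [← hε, ← hQ, ← hm, ← ha, Finset.sum_mul]
  constructor
  · calc Real.exp (-(400 * ε)) * (treeCount z * matchingCount (q + 1) * Real.exp (-Q - a))
        ≤ Real.exp (-(321 * ε)) * (treeCount z * matchingCount (q + 1) * Real.exp (-Q - a)) := by
          gcongr
          linarith
      _ = (treeCount z * Real.exp (-a)) * (Real.exp (-(60 * ε)) *
            (Real.exp (-Q - 261 * ε) * matchingCount (q + 1))) := by
          have : Real.exp (-(321 * ε)) * Real.exp (-Q - a)
              = Real.exp (-a) * Real.exp (-(60 * ε)) * Real.exp (-Q - 261 * ε) := by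
            rw [← Real.exp_add, ← Real.exp_add, ← Real.exp_add]
            congr 1
            ring
          linear_combination treeCount z * matchingCount (q + 1) * this
      _ ≤ S * (Real.exp (-(60 * ε)) * N) := by gcongr
      _ ≤ _ := by
          rw [hS, Finset.sum_mul]
          exact Finset.sum_le_sum fun T h => (hT T h).1
  · calc _ ≤ S * (Real.exp (60 * ε) * N) := by
          rw [hS, Finset.sum_mul]
          exact Finset.sum_le_sum fun T h => (hT T h).2
      _ ≤ (treeCount z * Real.exp (-a + 38 * ε)) * (Real.exp (60 * ε) *
            (Real.exp (-Q + 261 * ε) * matchingCount (q + 1))) := by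
          gcongr
          refine hSu.trans ?_
          gcongr
      _ = Real.exp (359 * ε) * (treeCount z * matchingCount (q + 1) * Real.exp (-Q - a)) := by
          have : Real.exp (359 * ε) * Real.exp (-Q - a)
              = Real.exp (-a + 38 * ε) * Real.exp (60 * ε) * Real.exp (-Q + 261 * ε) := by
            rw [← Real.exp_add, ← Real.exp_add, ← Real.exp_add]
            congr 1
            ring
          linear_combination -treeCount z * matchingCount (q + 1) * this
      _ ≤ _ := by
          gcongr
          linarith

end TreeSum

section DegreeDecomposition

/-- The sequences `z` with `z j < d j` and total `k`. -/
noncomputable def smallSequences {n : ℕ} (d : Fin n → ℕ) (k : ℕ) : Finset (Fin n → ℕ) :=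
  (Fintype.piFinset fun j => Finset.range (d j)).filter fun z => ∑ j, z j = k

lemma mem_smallSequences {n : ℕ} {d : Fin n → ℕ} {k : ℕ} {z : Fin n → ℕ} :
    z ∈ smallSequences d k ↔ (∀ j, z j < d j) ∧ ∑ j, z j = k := by
  simp [smallSequences]

lemma sum_card_inter_of_partition {n M : ℕ} {A : Fin n → Finset (Fin M)}
    (hA : ∀ i j, i ≠ j → Disjoint (A i) (A j)) (hA' : ∀ v : Fin M, ∃ j, v ∈ A j)
    (B : Finset (Fin M)) : ∑ j, (A j ∩ B).card = B.card := by
  rw [← Finset.card_biUnion]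
  · congr 1
    ext v
    simp only [Finset.mem_biUnion, Finset.mem_univ, true_and, Finset.mem_inter]
    exact ⟨fun ⟨_, _, h⟩ => h, fun h => (hA' v).imp fun j hj => ⟨hj, h⟩⟩
  · intro i _ j _ hij
    exact (hA i j hij).mono Finset.inter_subset_left Finset.inter_subset_left

lemma card_filter_inter_card_eq {n M : ℕ} {A : Fin n → Finset (Fin M)}
    (hA : ∀ i j, i ≠ j → Disjoint (A i) (A j)) (hA' : ∀ v : Fin M, ∃ j, v ∈ A j)
    {k : ℕ} {z : Fin n → ℕ} (hz : ∑ j, z j = k) :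
    ((Finset.powersetCard k (Finset.univ : Finset (Fin M))).filter
      fun B => (fun j => (A j ∩ B).card) = z).card = ∏ j, (A j).card.choose (z j) := by
  simp only [← Finset.card_powersetCard]
  rw [← Fintype.card_piFinset]
  have hinter : ∀ (F : Fin n → Finset (Fin M)), (∀ j, F j ⊆ A j) → ∀ j,
      A j ∩ Finset.univ.biUnion F = F j := by
    intro F hF j
    ext v
    simp only [Finset.mem_inter, Finset.mem_biUnion, Finset.mem_univ, true_and]
    constructor
    · rintro ⟨hv, i, hi⟩
      by_cases hij : i = j
      · exact hij ▸ hi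
      · exact absurd hv (Finset.disjoint_left.mp (hA i j hij) (hF i hi))
    · exact fun hv => ⟨hF j hv, j, hv⟩
  refine Finset.card_bij' (fun B _ j => A j ∩ B) (fun F _ => Finset.univ.biUnion F) ?_ ?_ ?_ ?_
  · intro B hB
    simp only [Finset.mem_filter] at hB
    simp only [Fintype.mem_piFinset, Finset.mem_powersetCard]
    exact fun j => ⟨Finset.inter_subset_left, congrFun hB.2 j⟩
  · intro F hF
    simp only [Fintype.mem_piFinset, Finset.mem_powersetCard] at hF
    have h := hinter F fun j => (hF j).1
    have hcard : ∀ j, (A j ∩ Finset.univ.biUnion F).card = z j := fun j => by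
      rw [h j, (hF j).2]
    simp only [Finset.mem_filter, Finset.mem_powersetCard]
    refine ⟨⟨Finset.subset_univ _, ?_⟩, funext hcard⟩
    rw [← sum_card_inter_of_partition hA hA', ← hz]
    exact Finset.sum_congr rfl fun j _ => hcard j
  · intro B _
    ext v
    simp only [Finset.mem_biUnion, Finset.mem_univ, true_and, Finset.mem_inter]
    exact ⟨fun ⟨_, _, h⟩ => h, fun h => (hA' v).imp fun j hj => ⟨hj, h⟩⟩
  · intro F hF
    simp only [Fintype.mem_piFinset, Finset.mem_powersetCard] at hF
    exact funext (hinter F fun j => (hF j).1)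

/-- Sampling a uniformly random subset, sorted by the sizes of its intersections with the blocks
of a partition. -/
lemma sum_powersetCard_eq_sum_smallSequences {n M : ℕ} {d : Fin n → ℕ} (hd : ∀ j, 1 ≤ d j)
    {A : Fin n → Finset (Fin M)} (hA : ∀ i j, i ≠ j → Disjoint (A i) (A j))
    (hA' : ∀ v : Fin M, ∃ j, v ∈ A j) (hcard : ∀ j, (A j).card = d j - 1) (k : ℕ)
    (f : (Fin n → ℕ) → ℝ) :
    ∑ B ∈ Finset.powersetCard k (Finset.univ : Finset (Fin M)), f (fun j => (A j ∩ B).card)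
      = ∑ z ∈ smallSequences d k, (∏ j, ((d j - 1).choose (z j) : ℝ)) * f z := by
  have hmaps : ∀ B ∈ Finset.powersetCard k (Finset.univ : Finset (Fin M)),
      (fun j => (A j ∩ B).card) ∈ smallSequences d k := by
    intro B hB
    rw [Finset.mem_powersetCard] at hB
    rw [mem_smallSequences, sum_card_inter_of_partition hA hA']
    refine ⟨fun j => ?_, hB.2⟩
    have h1 := Finset.card_le_card (Finset.inter_subset_left (s₁ := A j) (s₂ := B))
    have h2 := hcard j
    have h3 := hd j
    omega
  rw [← Finset.sum_fiberwise_of_maps_to hmaps]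
  refine Finset.sum_congr rfl fun z hz => ?_
  rw [Finset.sum_congr rfl (g := fun _ => f z) fun B hB => by
    rw [Finset.mem_filter] at hB; rw [hB.2]]
  rw [Finset.sum_const, nsmul_eq_mul]
  have h := card_filter_inter_card_eq hA hA' (mem_smallSequences.mp hz).2
  simp only [hcard] at h
  rw [← Nat.cast_prod, ← h]

lemma countGraphs_tree_le {n : ℕ} {d z : Fin n → ℕ} (hz : ∀ j, z j < d j)
    {T : SimpleGraph (Fin n)} (hT : T ∈ treesOf (fun j => z j + 1)) :
    countGraphs d ⊥ (fun G => T ≤ G) = countGraphs (fun j => d j - (z j + 1)) T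
      (fun _ => True) := by
  rw [mem_treesOf] at hT
  have h := countGraphs_extract (fun j => d j - (z j + 1)) (X := ⊥) (F := T) disjoint_bot_right
    (fun _ => True)
  simp only [and_true, bot_sup_eq] at h
  rw [← h]
  congr 1
  funext j
  rw [hT.2 j]
  have := hz j
  omega

/-- The total number of spanning trees in graphs of degree sequence `d`, sorted by the degree
sequence of the tree. -/
lemma sum_spanningTreeCount {k : ℕ} {d : Fin (k + 2) → ℕ} :
    ∑ G ∈ Finset.univ.filter
        (fun G : SimpleGraph (Fin (k + 2)) => ∀ j, G.degree j = d j), (spanningTreeCount G : ℝ)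
      = ∑ z ∈ smallSequences d k, ∑ T ∈ treesOf (fun j => z j + 1),
          countGraphs (fun j => d j - (z j + 1)) T (fun _ => True) := by
  have h1 : ∑ G ∈ Finset.univ.filter
        (fun G : SimpleGraph (Fin (k + 2)) => ∀ j, G.degree j = d j), (spanningTreeCount G : ℝ)
      = ∑ T ∈ Finset.univ.filter (fun T : SimpleGraph (Fin (k + 2)) => T.IsTree),
          countGraphs d ⊥ (fun G => T ≤ G) := by
    simp only [countGraphs_eq_sum]
    rw [Finset.sum_comm]
    refine Finset.sum_congr ?_ fun G _ => ?_
    · ext G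
      simp [mem_graphsAvoiding]
    · simp only [spanningTreeCount, ind]
      rw [Finset.sum_boole, Finset.filter_filter]
      congr 2
      ext T
      simp only [Finset.mem_filter, Finset.mem_univ, true_and, and_comm]
  rw [h1, ← Finset.sum_filter_add_sum_filter_not _
    (fun T : SimpleGraph (Fin (k + 2)) => ∀ j, T.degree j ≤ d j)]
  have hzero : ∑ T ∈ (Finset.univ.filter
      (fun T : SimpleGraph (Fin (k + 2)) => T.IsTree)).filter
        (fun T => ¬ ∀ j, T.degree j ≤ d j), countGraphs d ⊥ (fun G => T ≤ G) = 0 := by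
    refine Finset.sum_eq_zero fun T hT => countGraphs_eq_zero fun G hG hTG => ?_
    rw [Finset.mem_filter] at hT
    refine hT.2 fun j => ?_
    rw [← (mem_graphsAvoiding.mp hG).1 j]
    have := SimpleGraph.degree_le_of_le (v := j) hTG
    convert this
  rw [hzero, add_zero]
  have hpos : ∀ (T : SimpleGraph (Fin (k + 2))), T.IsTree → ∀ j, 1 ≤ T.degree j := by
    intro T hT j
    have := hT.connected.preconnected.degree_pos_of_nontrivial j
    exact this
  have hmaps : ∀ T ∈ (Finset.univ.filter
      (fun T : SimpleGraph (Fin (k + 2)) => T.IsTree)).filter (fun T => ∀ j, T.degree j ≤ d j),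
      (fun j => T.degree j - 1) ∈ smallSequences d k := by
    intro T hT
    simp only [Finset.mem_filter, Finset.mem_univ, true_and] at hT
    rw [mem_smallSequences]
    refine ⟨fun j => ?_, ?_⟩
    · have := hT.2 j
      have := hpos T hT.1 j
      omega
    · have h2 := sum_degree_eq_of_isTree hT.1
      have hone : ∑ _j : Fin (k + 2), 1 = k + 2 := by simp
      have h3 : ∑ j, (T.degree j - 1) + ∑ _j : Fin (k + 2), 1 = ∑ j, T.degree j := by
        rw [← Finset.sum_add_distrib]
        exact Finset.sum_congr rfl fun j _ => by have := hpos T hT.1 j; omega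
      rw [Fintype.card_fin] at h2
      omega
  rw [← Finset.sum_fiberwise_of_maps_to hmaps]
  refine Finset.sum_congr rfl fun z hz => ?_
  have hz' := (mem_smallSequences.mp hz).1
  rw [← Finset.sum_congr rfl fun T hT => countGraphs_tree_le hz' hT]
  refine Finset.sum_congr ?_ fun _ _ => rfl
  ext T
  simp only [Finset.mem_filter, Finset.mem_univ, true_and, mem_treesOf, funext_iff]
  constructor
  · rintro ⟨⟨hT, _⟩, h⟩
    exact ⟨hT, fun j => by have := hpos T hT j; have := h j; omega⟩
  · rintro ⟨hT, h⟩
    exact ⟨⟨hT, fun j => by have := h j; have := hz' j; omega⟩, fun j => by have := h j; omega⟩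

end DegreeDecomposition

section Comparison

lemma davg_sub_two_mul {n q : ℕ} (hn : 1 ≤ n) {d : Fin n → ℕ}
    (hsum : ∑ j, d j = 2 * (q + n)) : (davg n d - 2) * n = 2 * q := by
  have hn0 : (n : ℝ) ≠ 0 := by positivity
  have hsum' : ∑ j, (d j : ℝ) = 2 * (q + n) := by exact_mod_cast hsum
  rw [davg, hsum']
  field_simp
  ring

lemma lam_add_lam_sq {n : ℕ} (hn : 1 ≤ n) {d : Fin n → ℕ} (hd : ∀ j, 1 ≤ d j) :
    lam d + lam d ^ 2
      = (Rvar n d + davg n d ^ 2) ^ 2 / (4 * davg n d ^ 2) - 1 / 4 := by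
  have hn0 : (0 : ℝ) < n := by exact_mod_cast hn
  have hD : 0 < ∑ j, (d j : ℝ) :=
    Finset.sum_pos (fun j _ => by exact_mod_cast hd j) ⟨⟨0, hn⟩, Finset.mem_univ _⟩
  obtain ⟨a, ha⟩ : ∃ a, a = davg n d := ⟨_, rfl⟩
  have haD : ∑ j, (d j : ℝ) = a * n := by
    rw [ha, davg]
    field_simp
  have ha0 : 0 < a := by
    rw [ha, davg]
    positivity
  obtain ⟨Q, hQ⟩ : ∃ Q, Q = ∑ j, (d j : ℝ) ^ 2 := ⟨_, rfl⟩
  have hR : Rvar n d = Q / n - a ^ 2 := by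
    have : ∑ j, ((d j : ℝ) - a) ^ 2 = Q - n * a ^ 2 := by
      have h : ∀ j, ((d j : ℝ) - a) ^ 2 = d j ^ 2 - 2 * a * d j + a ^ 2 := fun j => by ring
      simp only [h, Finset.sum_add_distrib, Finset.sum_sub_distrib, ← Finset.mul_sum, haD,
        ← hQ, Finset.sum_const, Finset.card_univ, Fintype.card_fin, nsmul_eq_mul]
      ring
    rw [Rvar, ← ha, this]
    field_simp
  have hl : lam d = Q / (2 * (a * n)) - 1 / 2 := by
    have : ∑ j, (d j : ℝ) * (d j - 1) = Q - a * n := by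
      have h : ∀ j, (d j : ℝ) * (d j - 1) = d j ^ 2 - d j := fun j => by ring
      simp only [h, Finset.sum_sub_distrib, haD, ← hQ]
    rw [lam, this, haD]
    field_simp
  rw [hl, hR, ← ha]
  field_simp
  ring

lemma lamx_eq_lam {n q : ℕ} (hn : 1 ≤ n) {d x : Fin n → ℕ} (hsum : ∑ j, d j = 2 * (q + n))
    (hy : ∑ j, ((d j - x j : ℕ) : ℝ) = 2 * (q + 1)) :
    lamx n d x = lam (fun j => d j - x j) := by
  simp only [lamx, lam, davg_sub_two_mul hn hsum, hy, Nat.cast_descFactorial_two]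
  congr 1
  ring

lemma mubar_eq_meanEdgeSum {k q : ℕ} {d z : Fin (k + 2) → ℕ}
    (hsum : ∑ j, d j = 2 * (q + (k + 2))) (hz : ∑ j, z j = k) :
    mubar (k + 2) d (fun j => z j + 1)
      = meanEdgeSum z (fun j => ((d j - (z j + 1) : ℕ) : ℝ)) / (2 * (q + 1)) := by
  have htrees : treesWith (k + 2) (fun j => z j + 1) = treesOf (fun j => z j + 1) := by
    ext T
    simp only [treesWith, Finset.mem_filter, Finset.mem_univ, true_and, mem_treesOf]
  have hmu : ∀ T, muT (k + 2) d (fun j => z j + 1) T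
      = edgeSum (fun j => ((d j - (z j + 1) : ℕ) : ℝ)) T / (2 * (q + 1)) := by
    intro T
    rw [muT, davg_sub_two_mul (by omega) hsum, ← sum_edgeFinset_edgeWeight]
    congr 1
    ring
  have htc := treeCount_mul_prod_factorial k (Fin (k + 2)) z (by simp) hz
  have hpos : treeCount z ≠ 0 := by
    intro h
    rw [h, zero_mul] at htc
    exact (Nat.cast_ne_zero.mpr (Nat.factorial_ne_zero k)) htc.symm
  rw [mubar, htrees, Finset.sum_congr rfl fun T _ => hmu T, ← Finset.sum_div,
    sum_edgeSum_treesOf k _ z _ (by simp) hz (fun j => by positivity)]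
  change treeCount z * _ / _ / treeCount z = _
  field_simp

lemma gfun_eq {k q : ℕ} {d z : Fin (k + 2) → ℕ} (hd : ∀ j, 1 ≤ d j)
    (hsum : ∑ j, d j = 2 * (q + (k + 2))) (hz : ∑ j, z j = k)
    (hy : ∑ j, ((d j - (z j + 1) : ℕ) : ℝ) = 2 * (q + 1)) :
    gfun (k + 2) d (fun j => z j + 1) = (lam d + lam d ^ 2)
      + (-(lam (fun j => d j - (z j + 1)) + lam (fun j => d j - (z j + 1)) ^ 2)
        - meanEdgeSum z (fun j => ((d j - (z j + 1) : ℕ) : ℝ)) / (2 * (q + 1))) := by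
  rw [gfun, lamx_eq_lam (by omega) hsum hy, mubar_eq_meanEdgeSum hsum hz,
    lam_add_lam_sq (by omega) hd]
  ring

lemma sum_sub_succ {k q : ℕ} {d z : Fin (k + 2) → ℕ} (hsum : ∑ j, d j = 2 * (q + (k + 2)))
    (hz : z ∈ smallSequences d k) : ∑ j, ((d j - (z j + 1) : ℕ) : ℝ) = 2 * (q + 1) := by
  rw [mem_smallSequences] at hz
  have h : ∑ j, (d j - (z j + 1)) + ∑ j, z j + ∑ _j : Fin (k + 2), 1 = ∑ j, d j := by
    rw [← Finset.sum_add_distrib, ← Finset.sum_add_distrib]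
    exact Finset.sum_congr rfl fun j _ => by have := hz.1 j; omega
  have hone : ∑ _j : Fin (k + 2), 1 = k + 2 := by simp
  have h2 : ∑ j, (d j - (z j + 1)) = 2 * (q + 1) := by
    rw [hz.2, hsum] at h
    omega
  exact_mod_cast h2

lemma treeCount_div_prod_factorial {k : ℕ} {d z : Fin (k + 2) → ℕ}
    (hz : z ∈ smallSequences d k) :
    treeCount z * ∏ j, ((d j - 1).factorial : ℝ)
      = k.factorial * (∏ j, ((d j - 1).choose (z j) : ℝ)) *
        ∏ j, ((d j - (z j + 1)).factorial : ℝ) := by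
  rw [mem_smallSequences] at hz
  have htc := treeCount_mul_prod_factorial k (Fin (k + 2)) z (by simp) hz.2
  have hprod : ∏ j, ((d j - 1).factorial : ℝ) = (∏ j, ((d j - 1).choose (z j) : ℝ)) *
      (∏ j, ((z j).factorial : ℝ)) * ∏ j, ((d j - (z j + 1)).factorial : ℝ) := by
    rw [← Finset.prod_mul_distrib, ← Finset.prod_mul_distrib]
    refine Finset.prod_congr rfl fun j _ => ?_
    have h := hz.1 j
    have h2 := Nat.choose_mul_factorial_mul_factorial (n := d j - 1) (k := z j) (by omega)
    have h3 : d j - 1 - z j = d j - (z j + 1) := by omega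
    rw [h3] at h2
    exact_mod_cast h2.symm
  rw [hprod, ← htc]
  ring

/-- The total number of spanning trees over all graphs of degree sequence `d`, in terms of a sum
of `exp ∘ gfun`. -/
lemma sum_spanningTreeCount_bounds {k q Δ : ℕ} {d : Fin (k + 2) → ℕ} (hd : ∀ j, 1 ≤ d j)
    (hsum : ∑ j, d j = 2 * (q + (k + 2))) (hΔ : ∀ j, d j ≤ Δ) (hΔ3 : 3 ≤ Δ)
    (hq : (Δ : ℝ) ^ 4 ≤ 2 * q) {S W : ℝ}
    (hS : S = ∑ z ∈ smallSequences d k, ∑ T ∈ treesOf (fun j => z j + 1),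
          countGraphs (fun j => d j - (z j + 1)) T (fun _ => True))
    (hW : W = Real.exp (-(lam d + lam d ^ 2)) * (k.factorial * matchingCount (q + 1)) *
      ∑ z ∈ smallSequences d k, (∏ j, ((d j - 1).choose (z j) : ℝ)) *
        Real.exp (gfun (k + 2) d fun j => z j + 1)) :
    Real.exp (-(400 * (Δ ^ 4 / (2 * q)))) * W ≤ S * ∏ j, ((d j - 1).factorial : ℝ) ∧
      S * ∏ j, ((d j - 1).factorial : ℝ) ≤ Real.exp (400 * (Δ ^ 4 / (2 * q))) * W := by
  have hP : (0 : ℝ) < ∏ j, ((d j - 1).factorial : ℝ) := Finset.prod_pos fun j _ => by positivity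
  have key : ∀ z ∈ smallSequences d k,
      Real.exp (-(400 * (Δ ^ 4 / (2 * q)))) * (Real.exp (-(lam d + lam d ^ 2)) *
          (k.factorial * matchingCount (q + 1)) * ((∏ j, ((d j - 1).choose (z j) : ℝ)) *
        Real.exp (gfun (k + 2) d fun j => z j + 1)))
        ≤ (∑ T ∈ treesOf (fun j => z j + 1),
          countGraphs (fun j => d j - (z j + 1)) T (fun _ => True)) *
            ∏ j, ((d j - 1).factorial : ℝ) ∧
      (∑ T ∈ treesOf (fun j => z j + 1),
          countGraphs (fun j => d j - (z j + 1)) T (fun _ => True)) *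
            ∏ j, ((d j - 1).factorial : ℝ)
        ≤ Real.exp (400 * (Δ ^ 4 / (2 * q))) * (Real.exp (-(lam d + lam d ^ 2)) *
          (k.factorial * matchingCount (q + 1)) * ((∏ j, ((d j - 1).choose (z j) : ℝ)) *
        Real.exp (gfun (k + 2) d fun j => z j + 1))) := by
    intro z hz
    have hz' := mem_smallSequences.mp hz
    have hy := sum_sub_succ hsum hz
    have hb := sum_countGraphs_treesOf_bounds (V := Fin (k + 2)) (k := k) (q := q) (Δ := Δ)
      (z := z) (y := fun j => d j - (z j + 1)) (by simp) hz'.2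
      (fun j => by have := hz'.1 j; have := hΔ j; omega) hΔ3 hy hq
    have hg := gfun_eq hd hsum hz'.2 hy
    have htc := treeCount_div_prod_factorial hz
    obtain ⟨a, ha⟩ : ∃ a, a = -(lam (fun j => d j - (z j + 1)) +
        lam (fun j => d j - (z j + 1)) ^ 2)
        - meanEdgeSum z (fun j => ((d j - (z j + 1) : ℕ) : ℝ)) / (2 * (q + 1)) := ⟨_, rfl⟩
    obtain ⟨F, hF⟩ : ∃ F, F = ∏ j, ((d j - (z j + 1)).factorial : ℝ) := ⟨_, rfl⟩
    have hF0 : 0 < F := by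
      rw [hF]
      exact Finset.prod_pos fun j _ => by positivity
    rw [← ha] at hg
    rw [← ha, ← hF] at hb
    rw [← hF] at htc
    have hexp : Real.exp (-(lam d + lam d ^ 2)) * Real.exp (gfun (k + 2) d fun j => z j + 1)
        = Real.exp a := by
      rw [hg, ← Real.exp_add]
      congr 1
      ring
    obtain ⟨P, hPdef⟩ : ∃ P, P = ∏ j, ((d j - 1).factorial : ℝ) := ⟨_, rfl⟩
    rw [← hPdef] at htc hP ⊢
    constructor
    · refine le_of_mul_le_mul_right ?_ hF0
      refine le_trans (le_of_eq ?_) ((mul_le_mul_of_nonneg_right hb.1 hP.le).trans_eq (by ring))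
      rw [← hexp]
      linear_combination (-(Real.exp (-(400 * (Δ ^ 4 / (2 * q)))) * matchingCount (q + 1) *
        (Real.exp (-(lam d + lam d ^ 2)) * Real.exp (gfun (k + 2) d fun j => z j + 1)))) * htc
    · refine le_of_mul_le_mul_right ?_ hF0
      refine le_trans (le_of_eq (by ring)) ((mul_le_mul_of_nonneg_right hb.2 hP.le).trans_eq ?_)
      rw [← hexp]
      linear_combination (Real.exp (400 * (Δ ^ 4 / (2 * q))) * matchingCount (q + 1) *
        (Real.exp (-(lam d + lam d ^ 2)) * Real.exp (gfun (k + 2) d fun j => z j + 1))) * htc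
  rw [hS, hW, Finset.mul_sum, Finset.mul_sum, Finset.mul_sum, Finset.sum_mul]
  exact ⟨Finset.sum_le_sum fun z hz => (key z hz).1, Finset.sum_le_sum fun z hz => (key z hz).2⟩

end Comparison

section Main

lemma matchingCount_ratio (k q : ℕ) :
    (k.factorial : ℝ) * matchingCount (q + 1) * ((2 * q + (k + 2)).choose k : ℝ)
      = factorialRatio (k + 2) q * matchingCount (q + (k + 2)) := by
  have hch : ((2 * q + (k + 2)).choose k : ℝ) * k.factorial * (2 * (q + 1)).factorial
      = (2 * q + (k + 2)).factorial := by
    have h := Nat.choose_mul_factorial_mul_factorial (n := 2 * q + (k + 2)) (k := k) (by omega)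
    have h3 : 2 * q + (k + 2) - k = 2 * (q + 1) := by omega
    rw [h3] at h
    exact_mod_cast h
  have hpow : (2 : ℝ) ^ (q + (k + 2)) = 2 ^ (q + 1) * 2 ^ (k + 2 - 1) := by
    rw [← pow_add]
    congr 1
    omega
  rw [matchingCount, matchingCount, factorialRatio, ← hch, hpow]
  field_simp

lemma prod_factorial_eq {n : ℕ} {d : Fin n → ℕ} (hd : ∀ j, 1 ≤ d j) :
    ∏ j, ((d j).factorial : ℝ) = (∏ j, (d j : ℝ)) * ∏ j, ((d j - 1).factorial : ℝ) := by
  rw [← Finset.prod_mul_distrib]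
  refine Finset.prod_congr rfl fun j _ => ?_
  have := hd j
  rw [← Nat.mul_factorial_pred (by omega)]
  push_cast
  rfl

lemma exists_eq_mul_exp {c r H a : ℝ} (hH : 0 < H) (ha : 0 < a)
    (h1 : Real.exp (-c) * (H * a) ≤ r) (h2 : r ≤ Real.exp c * (H * a)) :
    ∃ E : ℝ, |E| ≤ c ∧ r = H * Real.exp E * a := by
  have hHa : 0 < H * a := mul_pos hH ha
  have hr : 0 < r := lt_of_lt_of_le (by positivity) h1
  have hexp : Real.exp (Real.log (r / (H * a))) = r / (H * a) := Real.exp_log (by positivity)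
  refine ⟨Real.log (r / (H * a)), abs_le.mpr ⟨?_, ?_⟩, ?_⟩
  · rw [← Real.exp_le_exp, hexp, le_div_iff₀ hHa]
    exact h1
  · rw [← Real.exp_le_exp, hexp, div_le_iff₀ hHa]
    exact h2
  · rw [hexp]
    field_simp

lemma card_filter_degree_eq {n : ℕ} (d : Fin n → ℕ) :
    ((Finset.univ.filter
      (fun G : SimpleGraph (Fin n) => ∀ j, G.degree j = d j)).card : ℝ)
        = countGraphs d ⊥ (fun _ => True) := by
  unfold countGraphs
  congr 2
  ext G
  simp [mem_graphsAvoiding]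

/-- The comparison of `Hd` with its exact factorial counterpart. -/
lemma prod_mul_factorialRatio_bounds {n q : ℕ} (hn : 1 ≤ n) (hq : 1 ≤ q) {d : Fin n → ℕ}
    (hd : ∀ j, 1 ≤ d j) (hsum : ∑ j, d j = 2 * (q + n)) :
    Real.exp (-(3 / (2 * q))) * Hd n d ≤ (∏ j, (d j : ℝ)) * factorialRatio n q ∧
      (∏ j, (d j : ℝ)) * factorialRatio n q ≤ Real.exp (3 / (2 * q)) * Hd n d := by
  obtain ⟨hH, hlog⟩ := log_Hd hn hq hd hsum
  have hR := abs_le.mp (abs_log_factorialRatio_sub_le hn hq)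
  have hF := factorialRatio_pos n q
  have hP : 0 < ∏ j, (d j : ℝ) := Finset.prod_pos fun j _ => by exact_mod_cast hd j
  have hlog' := Real.log_mul hP.ne' hF.ne'
  constructor
  · rw [← Real.log_le_log_iff (by positivity) (by positivity), hlog',
      Real.log_mul (Real.exp_pos _).ne' hH.ne', Real.log_exp, hlog]
    linarith [hR.1]
  · rw [← Real.log_le_log_iff (by positivity) (by positivity), hlog',
      Real.log_mul (Real.exp_pos _).ne' hH.ne', Real.log_exp, hlog]
    linarith [hR.2]

/-- The number of graphs of degree sequence `d`. -/
lemma countGraphs_bot_bounds_of_pow_four_le {V : Type*} [Fintype V] {h Δ : ℕ} {s : ℝ} {d : V → ℕ}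
    (hΔ : ∀ j, d j ≤ Δ) (hΔ3 : 3 ≤ Δ) (hsum : ∑ j, (d j : ℝ) = 2 * h)
    (hs : (Δ : ℝ) ^ 4 ≤ s) (hsh : s ≤ 2 * h) :
    Real.exp (-(261 * (Δ ^ 4 / s))) * (Real.exp (-(lam d + lam d ^ 2)) * matchingCount h)
        ≤ countGraphs d ⊥ (fun _ => True) * ∏ j, ((d j).factorial : ℝ) ∧
      countGraphs d ⊥ (fun _ => True) * ∏ j, ((d j).factorial : ℝ)
        ≤ Real.exp (261 * (Δ ^ 4 / s)) * (Real.exp (-(lam d + lam d ^ 2)) * matchingCount h) := by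
  have hΔ3' : (3 : ℝ) ≤ Δ := by exact_mod_cast hΔ3
  have hΔ9 : 9 * (Δ : ℝ) ^ 2 ≤ Δ ^ 4 := by
    have h2 : (9 : ℝ) ≤ Δ ^ 2 := by nlinarith
    have h4 : (Δ : ℝ) ^ 4 = Δ ^ 2 * Δ ^ 2 := by ring
    rw [h4]
    gcongr
  have hs0 : 0 < s := by nlinarith
  have hb := countGraphs_bot_bounds hΔ3 (k := h) (by linarith) d hΔ hsum
  have hlam0 := lam_nonneg d
  have hlam := lam_le d hΔ (by rw [hsum]; linarith)
  obtain ⟨Q, hQ⟩ : ∃ Q : ℝ, Q = lam d + lam d ^ 2 := ⟨_, rfl⟩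
  have hQ0 : 0 ≤ Q := by rw [hQ]; positivity
  have hQΔ : Q ≤ (Δ : ℝ) ^ 2 := by
    rw [hQ]
    nlinarith
  have hmc := (matchingCount_pos h).le
  have herr : (Δ : ℝ) ^ 2 / (2 * h) * Q ≤ Δ ^ 4 / s := by
    have h4 : (Δ : ℝ) ^ 4 / s = Δ ^ 2 / s * Δ ^ 2 := by ring
    rw [h4]
    gcongr
  rw [← hQ] at hb ⊢
  rw [← mul_assoc, ← mul_assoc, ← Real.exp_add, ← Real.exp_add]
  constructor
  · refine le_trans ?_ hb.1
    gcongr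
    nlinarith
  · refine hb.2.trans ?_
    gcongr
    nlinarith

lemma three_le_sup {n q : ℕ} (hq : 1 ≤ q) {d : Fin n → ℕ} (hsum : ∑ j, d j = 2 * (q + n)) :
    3 ≤ Finset.univ.sup d := by
  by_contra h
  have h2 : ∑ j, d j ≤ ∑ _j : Fin n, 2 := Finset.sum_le_sum fun j _ => by
    have := Finset.le_sup (f := d) (Finset.mem_univ j)
    omega
  simp at h2
  omega

/-- The quotient of a quantity of size `S` by one of size `N`, both known up to exponential
factors. -/
lemma div_bounds_of_exp_bounds {e₁ e₂ e₃ L P Q K mc G ch F H S N p : ℝ} (hP : 0 < P) (hp : 0 < p)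
    (hQ : Q = p * P) (hmc : 0 < mc) (hG : 0 < G) (hch : 0 < ch) (hK : K * ch = F * mc)
    (hS1 : Real.exp (-e₁) * (Real.exp L * K * G) ≤ S * P)
    (hS2 : S * P ≤ Real.exp e₁ * (Real.exp L * K * G))
    (hN1 : Real.exp (-e₂) * (Real.exp L * mc) ≤ N * Q)
    (hN2 : N * Q ≤ Real.exp e₂ * (Real.exp L * mc))
    (hF1 : Real.exp (-e₃) * H ≤ p * F) (hF2 : p * F ≤ Real.exp e₃ * H) (hF : 0 < F) :
    Real.exp (-(e₁ + e₂ + e₃)) * (H * (G / ch)) ≤ S / N ∧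
      S / N ≤ Real.exp (e₁ + e₂ + e₃) * (H * (G / ch)) := by
  have hK' : K = F * mc / ch := by rw [← hK]; field_simp
  have hK0 : 0 < K := by rw [hK']; positivity
  have hNQ : 0 < N * Q := lt_of_lt_of_le (by positivity) hN1
  have hQ0 : 0 < Q := by rw [hQ]; positivity
  have hN : 0 < N := pos_of_mul_pos_left hNQ hQ0.le
  have hSP : 0 < S * P := lt_of_lt_of_le (by positivity) hS1
  have hratio : S / N = p * (S * P) / (N * Q) := by
    rw [hQ]
    field_simp
  have hGch : 0 < G / ch := div_pos hG hch
  have hinv : ∀ t, Real.exp t * Real.exp (-t) = 1 := fun t => by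
    rw [← Real.exp_add, add_neg_cancel, Real.exp_zero]
  rw [hratio]
  constructor
  · rw [le_div_iff₀ hNQ]
    calc Real.exp (-(e₁ + e₂ + e₃)) * (H * (G / ch)) * (N * Q)
        = (Real.exp (-e₃) * H) * (G / ch) * (Real.exp (-e₁) * Real.exp (-e₂)) * (N * Q) := by
          rw [neg_add, neg_add, Real.exp_add, Real.exp_add]
          ring
      _ ≤ (p * F) * (G / ch) * (Real.exp (-e₁) * Real.exp (-e₂)) *
            (Real.exp e₂ * (Real.exp L * mc)) := by gcongr
      _ = (Real.exp e₂ * Real.exp (-e₂)) * (p * (Real.exp (-e₁) *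
            (Real.exp L * (F * mc / ch) * G))) := by ring
      _ = p * (Real.exp (-e₁) * (Real.exp L * K * G)) := by rw [hinv, one_mul, hK']
      _ ≤ p * (S * P) := by gcongr
  · rw [div_le_iff₀ hNQ]
    calc p * (S * P) ≤ p * (Real.exp e₁ * (Real.exp L * K * G)) := by gcongr
      _ = (p * F) * (G / ch) * Real.exp e₁ * ((Real.exp e₂ * Real.exp (-e₂)) *
            (Real.exp L * mc)) := by
          rw [hinv, hK']
          ring
      _ = (p * F) * (G / ch) * (Real.exp e₁ * Real.exp e₂) *
            (Real.exp (-e₂) * (Real.exp L * mc)) := by ring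
      _ ≤ (Real.exp e₃ * H) * (G / ch) * (Real.exp e₁ * Real.exp e₂) * (N * Q) := by
          have : 0 ≤ Real.exp e₃ * H := le_trans (by positivity) hF2
          gcongr
      _ = Real.exp (e₁ + e₂ + e₃) * (H * (G / ch)) * (N * Q) := by
          rw [Real.exp_add, Real.exp_add]
          ring

end Main

theorem expected_spanning_trees_via_mgf_of_g :
    ∃ C : ℝ, 0 < C ∧ ∃ N₀ : ℕ, ∀ n : ℕ, N₀ ≤ n → ∀ d : Fin n → ℕ,
      (∀ j, 1 ≤ d j) → Even (∑ j, d j) →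
      ((Finset.univ.sup d : ℕ) : ℝ) ^ 4 ≤ (davg n d - 2) * n →
      ∀ M : ℕ, M = (∑ j, d j) - n →
      ∀ A : Fin n → Finset (Fin M),
      -- `A 1, …, A n` is a partition of `{1,…,(d−1)n}` with `|A j| = d j − 1`
      (∀ i j, i ≠ j → Disjoint (A i) (A j)) →
      (∀ v : Fin M, ∃ j, v ∈ A j) →
      (∀ j, (A j).card = d j - 1) →
      ∀ dmax : ℝ, dmax = ((Finset.univ.sup d : ℕ) : ℝ) →
      ∃ E : ℝ,
        |E| ≤ C * (dmax ^ 4 / ((davg n d - 2) * n) +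
            min (dmax ^ 4 / ((davg n d - 2) ^ 2 * n))
              (min (dmax ^ 3 * Real.log n / ((davg n d - 2) * n))
                (dmax * (davg n d - 2)))) ∧
        (∑ G ∈ Finset.univ.filter
              (fun G : SimpleGraph (Fin n) => ∀ j, G.degree j = d j),
            (spanningTreeCount G : ℝ)) /
          ((Finset.univ.filter
              (fun G : SimpleGraph (Fin n) => ∀ j, G.degree j = d j)).card : ℝ)
        = Hd n d * Real.exp E *
            ((∑ B ∈ Finset.powersetCard (n - 2) (Finset.univ : Finset (Fin M)),
                Real.exp (gfun n d (fun j => (A j ∩ B).card + 1))) /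
              ((Finset.powersetCard (n - 2)
                  (Finset.univ : Finset (Fin M))).card : ℝ)) := by
  refine ⟨664, by norm_num, 2, ?_⟩
  intro n hn d hd heven hmax M hM A hA hA' hcard dmax hdmax
  obtain ⟨k, rfl⟩ : ∃ k, n = k + 2 := ⟨n - 2, by omega⟩
  obtain ⟨h, hh⟩ := heven
  obtain ⟨Δ, hΔdef⟩ : ∃ Δ : ℕ, Δ = Finset.univ.sup d := ⟨_, rfl⟩
  rw [← hΔdef] at hmax hdmax
  have hΔ : ∀ j, d j ≤ Δ := fun j => hΔdef ▸ Finset.le_sup (Finset.mem_univ j)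
  have hn0 : (0 : ℝ) < ((k + 2 : ℕ) : ℝ) := by positivity
  have hΔ1 : (1 : ℝ) ≤ Δ := by exact_mod_cast (hd 0).trans (hΔ 0)
  have hpos : 0 < (davg (k + 2) d - 2) * ((k + 2 : ℕ) : ℝ) :=
    lt_of_lt_of_le (by positivity) hmax
  have havg : 0 < davg (k + 2) d - 2 := pos_of_mul_pos_left hpos hn0.le
  obtain ⟨q, rfl⟩ : ∃ q, h = q + (k + 2) := by
    have hlt : (2 : ℝ) * ((k + 2 : ℕ) : ℝ) < ∑ j, (d j : ℝ) := by
      rw [sub_pos, davg, lt_div_iff₀ hn0] at havg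
      exact havg
    have hlt' : 2 * (k + 2) < ∑ j, d j := by exact_mod_cast hlt
    exact ⟨h - (k + 2), by omega⟩
  have hsum : ∑ j, d j = 2 * (q + (k + 2)) := by omega
  have hs := davg_sub_two_mul (by omega) hsum
  have hq0 : (0 : ℝ) < q := by linarith
  have hq1 : 1 ≤ q := by exact_mod_cast hq0
  have hΔ3 : 3 ≤ Δ := hΔdef ▸ three_le_sup hq1 hsum
  have hΔq : (Δ : ℝ) ^ 4 ≤ 2 * q := by rw [← hs]; exact hmax
  have hΔ3' : (3 : ℝ) ≤ Δ := by exact_mod_cast hΔ3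
  have hM' : M = 2 * q + (k + 2) := by omega
  have hk : k + 2 - 2 = k := by omega
  have hB := sum_powersetCard_eq_sum_smallSequences hd hA hA' hcard k
    (fun z => Real.exp (gfun (k + 2) d fun j => z j + 1))
  simp only at hB
  rw [sum_spanningTreeCount, card_filter_degree_eq, hk, hB, Finset.card_powersetCard,
    Finset.card_univ, Fintype.card_fin, hM']
  have hchoose : 0 < (2 * q + (k + 2)).choose k := Nat.choose_pos (by omega)
  have hG : 0 < ∑ z ∈ smallSequences d k, (∏ j, ((d j - 1).choose (z j) : ℝ)) *
      Real.exp (gfun (k + 2) d fun j => z j + 1) := by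
    rw [← hB]
    refine Finset.sum_pos (fun _ _ => Real.exp_pos _) ?_
    rw [← Finset.card_pos, Finset.card_powersetCard, Finset.card_univ, Fintype.card_fin, hM']
    exact hchoose
  have hSb := sum_spanningTreeCount_bounds hd hsum hΔ hΔ3 hΔq rfl rfl
  have hNb := countGraphs_bot_bounds_of_pow_four_le (h := q + (k + 2)) hΔ hΔ3
    (by exact_mod_cast hsum) hΔq (by push_cast; linarith)
  have hHb := prod_mul_factorialRatio_bounds (by omega) hq1 hd hsum
  have hb := div_bounds_of_exp_bounds (Finset.prod_pos fun j _ => by positivity)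
    (Finset.prod_pos fun j _ => by exact_mod_cast hd j) (prod_factorial_eq hd)
    (matchingCount_pos _) hG (by exact_mod_cast hchoose) (matchingCount_ratio k q) hSb.1 hSb.2
    hNb.1 hNb.2 hHb.1 hHb.2 (factorialRatio_pos _ _)
  obtain ⟨E, hE, hEeq⟩ := exists_eq_mul_exp (log_Hd (by omega) hq1 hd hsum).1
    (div_pos hG (by exact_mod_cast hchoose)) hb.1 hb.2
  refine ⟨E, hE.trans ?_, hEeq⟩
  have hlogn : 0 ≤ Real.log ((k + 2 : ℕ) : ℝ) := Real.log_natCast_nonneg _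
  have hdmax0 : 0 ≤ dmax := by rw [hdmax]; positivity
  have hmin : 0 ≤ min (dmax ^ 4 / ((davg (k + 2) d - 2) ^ 2 * ((k + 2 : ℕ) : ℝ)))
      (min (dmax ^ 3 * Real.log ((k + 2 : ℕ) : ℝ) / ((davg (k + 2) d - 2) * ((k + 2 : ℕ) : ℝ)))
        (dmax * (davg (k + 2) d - 2))) :=
    le_min (by positivity) (le_min (by positivity) (by positivity))
  have h3 : (3 : ℝ) / (2 * q) ≤ 3 * (Δ ^ 4 / (2 * q)) := by
    rw [← mul_div_assoc]
    gcongr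
    have : (1 : ℝ) ≤ Δ ^ 4 := one_le_pow₀ hΔ1
    linarith
  rw [hs, hdmax] at *
  linarith

end ExpectedSpanningTrees
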